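/- arXiv:2401.03982 — 2 statements merged into one kernel-verified Lean document; each statement's English description precedes it below -/
import Mathlib

section
/- There is an absolute constant c such that the following holds. Let f ∈ ℚ[x₀,x₁,x₂] be an irreducible homogeneous polynomial of degree d > 0 and let C ⊆ ℙ²_ℚ be the plane curve it defines. Then for every real H > 2, the number of ℚ-rational points of C of height at most H satisfies #C(ℚ,H) ≤ c·d²·H^{2/d}·(log H)^{12}. -/
open MvPolynomial

/-- `x ∈ ℙⁿ(ℚ)` has height at most `H`: it has primitive integer homogeneous
coordinates `y` with `max_i |y_i| ≤ H`. -/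
def qHeightLe {n : ℕ} (x : Projectivization ℚ (Fin n → ℚ)) (H : ℝ) : Prop :=
  ∃ y : Fin n → ℤ,
    (∃ hy : (fun i => (y i : ℚ)) ≠ 0, Projectivization.mk ℚ (fun i => (y i : ℚ)) hy = x) ∧
    Finset.univ.gcd y = 1 ∧ ∀ i, |(y i : ℝ)| ≤ H

open scoped ContDiff
open Set (Ioo)

/-- Rolle's theorem between consecutive zeros. -/
theorem exists_strictMono_deriv_eq_zero {f : ℝ → ℝ} {a b : ℝ}
    (hf : DifferentiableOn ℝ f (Ioo a b)) {n : ℕ} {t : Fin (n + 1) → ℝ} (ht : StrictMono t)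
    (htI : ∀ i, t i ∈ Ioo a b) (h0 : ∀ i, f (t i) = 0) :
    ∃ u : Fin n → ℝ, StrictMono u ∧ (∀ i, u i ∈ Ioo a b) ∧ ∀ i, deriv f (u i) = 0 := by
  have key : ∀ i : Fin n, ∃ x ∈ Ioo (t i.castSucc) (t i.succ), deriv f x = 0 := by
    intro i
    refine exists_deriv_eq_zero (ht (Fin.castSucc_lt_succ)) ?_ (by rw [h0, h0])
    refine hf.continuousOn.mono fun x hx => ?_
    exact ⟨(htI _).1.trans_le hx.1, hx.2.trans_lt (htI _).2⟩
  choose u hu hu0 using key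
  refine ⟨u, fun i j hij => ?_, fun i => ?_, hu0⟩
  · refine (hu i).2.trans_le (le_trans (ht.monotone ?_) (hu j).1.le)
    exact Fin.succ_le_castSucc_iff.mpr hij
  · exact ⟨(htI _).1.trans (hu i).1, (hu i).2.trans (htI _).2⟩

theorem ContDiffOn.deriv_Ioo {f : ℝ → ℝ} {a b : ℝ} (hf : ContDiffOn ℝ ∞ f (Ioo a b)) :
    ContDiffOn ℝ ∞ (deriv f) (Ioo a b) :=
  hf.deriv_of_isOpen isOpen_Ioo (by simp)

theorem ContDiffOn.iteratedDeriv_Ioo {f : ℝ → ℝ} {a b : ℝ} (hf : ContDiffOn ℝ ∞ f (Ioo a b))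
    (k : ℕ) : ContDiffOn ℝ ∞ (iteratedDeriv k f) (Ioo a b) := by
  induction k with
  | zero => simpa using hf
  | succ k ih => rw [iteratedDeriv_succ]; exact ih.deriv_Ioo

theorem ContDiffOn.contDiffAt_Ioo {f : ℝ → ℝ} {a b x : ℝ} (hf : ContDiffOn ℝ ∞ f (Ioo a b))
    (hx : x ∈ Ioo a b) (n : ℕ) : ContDiffAt ℝ n f x :=
  (hf.contDiffAt (isOpen_Ioo.mem_nhds hx)).of_le (by exact_mod_cast le_top)

theorem ContDiffOn.differentiableOn_Ioo {f : ℝ → ℝ} {a b : ℝ} (hf : ContDiffOn ℝ ∞ f (Ioo a b)) :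
    DifferentiableOn ℝ f (Ioo a b) :=
  hf.differentiableOn (by simp)

/-- A smooth function with `k + 1` zeros has a zero of its `k`-th derivative. -/
theorem exists_iteratedDeriv_eq_zero {a b : ℝ} {k : ℕ} :
    ∀ {f : ℝ → ℝ}, ContDiffOn ℝ ∞ f (Ioo a b) → ∀ {t : Fin (k + 1) → ℝ}, StrictMono t →
    (∀ i, t i ∈ Ioo a b) → (∀ i, f (t i) = 0) →
    ∃ x ∈ Ioo a b, iteratedDeriv k f x = 0 := by
  induction k with
  | zero => intro f _ t _ htI h0; exact ⟨t 0, htI 0, by simpa using h0 0⟩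
  | succ k ih =>
    intro f hf t ht htI h0
    obtain ⟨u, hu, huI, hu0⟩ :=
      exists_strictMono_deriv_eq_zero hf.differentiableOn_Ioo ht htI h0
    obtain ⟨x, hx, hx0⟩ := ih hf.deriv_Ioo hu huI hu0
    exact ⟨x, hx, by rwa [iteratedDeriv_succ']⟩

theorem iteratedDeriv_polynomial_eval (p : Polynomial ℝ) (k : ℕ) :
    iteratedDeriv k (fun x => p.eval x) = fun x => (Polynomial.derivative^[k] p).eval x := by
  induction k with
  | zero => simp
  | succ k ih =>
    rw [iteratedDeriv_succ, ih, Function.iterate_succ_apply']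
    ext x; simp

theorem iteratedDeriv_prod_sub (k : ℕ) (t : Fin k → ℝ) (x : ℝ) :
    iteratedDeriv k (fun z => ∏ i, (z - t i)) x = k.factorial := by
  have h : (fun z : ℝ => ∏ i, (z - t i)) =
      fun z => (∏ i, (Polynomial.X - Polynomial.C (t i))).eval z := by
    ext z; simp [Polynomial.eval_prod]
  rw [h, iteratedDeriv_polynomial_eval]
  have hm : (∏ i, (Polynomial.X - Polynomial.C (t i))).Monic :=
    Polynomial.monic_prod_of_monic _ _ fun i _ => Polynomial.monic_X_sub_C _
  have hd : (∏ i, (Polynomial.X - Polynomial.C (t i))).natDegree = k := by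
    rw [Polynomial.natDegree_prod_of_monic _ _ fun i _ => Polynomial.monic_X_sub_C _]; simp
  have h2 : (Polynomial.derivative^[k] (∏ i, (Polynomial.X - Polynomial.C (t i)))) =
      Polynomial.C (k.factorial : ℝ) := by
    ext n
    rw [Polynomial.coeff_iterate_derivative]
    rcases n with _ | n
    · have : (∏ i, (Polynomial.X - Polynomial.C (t i))).coeff k = 1 := by
        have h3 := hm.coeff_natDegree
        rwa [hd] at h3
      simp [this, Nat.descFactorial_self]
    · rw [Polynomial.coeff_eq_zero_of_natDegree_lt (by omega)]
      simp
  rw [h2]; simp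

/-- Error term of interpolation by the zero polynomial. -/
theorem exists_eq_iteratedDeriv_mul_prod {f : ℝ → ℝ} {a b : ℝ} (hf : ContDiffOn ℝ ∞ f (Ioo a b))
    {k : ℕ} {t : Fin k → ℝ} (ht : Function.Injective t) (htI : ∀ i, t i ∈ Ioo a b)
    (h0 : ∀ i, f (t i) = 0) {x : ℝ} (hx : x ∈ Ioo a b) :
    ∃ ξ ∈ Ioo a b, f x = iteratedDeriv k f ξ / k.factorial * ∏ i, (x - t i) := by
  by_cases hxt : ∃ i, x = t i
  · obtain ⟨i, rfl⟩ := hxt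
    refine ⟨t i, hx, ?_⟩
    rw [h0, Finset.prod_eq_zero (Finset.mem_univ i) (sub_self _), mul_zero]
  push Not at hxt
  have hP : ∏ i, (x - t i) ≠ 0 := Finset.prod_ne_zero_iff.mpr fun i _ => sub_ne_zero.mpr (hxt i)
  set K := f x / ∏ i, (x - t i) with hK
  have hPs : ContDiff ℝ ∞ (fun z => ∏ i, (z - t i)) := by fun_prop
  let g : ℝ → ℝ := fun z => f z - K * ∏ i, (z - t i)
  have hg : ContDiffOn ℝ ∞ g (Ioo a b) := hf.sub (contDiff_const.mul hPs).contDiffOn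
  let T : Finset ℝ := insert x (Finset.univ.image t)
  have hT : T.card = k + 1 := by
    rw [Finset.card_insert_of_notMem, Finset.card_image_of_injective _ ht, Finset.card_fin]
    simpa using fun i => (hxt i).symm
  have hTm : ∀ i, T.orderEmbOfFin hT i ∈ T := fun i => Finset.orderEmbOfFin_mem _ _ _
  have hTI : ∀ z ∈ T, z ∈ Ioo a b ∧ g z = 0 := by
    intro z hz
    rcases Finset.mem_insert.mp hz with rfl | hz
    · refine ⟨hx, ?_⟩
      simp only [g, hK]; field_simp; ring
    · obtain ⟨i, -, rfl⟩ := Finset.mem_image.mp hz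
      refine ⟨htI i, ?_⟩
      simp only [g]
      rw [h0, Finset.prod_eq_zero (Finset.mem_univ i) (sub_self _)]; simp
  obtain ⟨ξ, hξ, hξ0⟩ := exists_iteratedDeriv_eq_zero hg (T.orderEmbOfFin hT).strictMono
    (fun i => (hTI _ (hTm i)).1) (fun i => (hTI _ (hTm i)).2)
  refine ⟨ξ, hξ, ?_⟩
  have h1 : iteratedDeriv k g ξ = iteratedDeriv k f ξ - K * k.factorial := by
    have := iteratedDeriv_sub (f := f) (g := fun z => K * ∏ i, (z - t i)) (n := k) (x := ξ)
      (hf.contDiffAt_Ioo hξ k)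
        ((contDiff_const.mul hPs).contDiffAt.of_le (by exact_mod_cast le_top))
    rw [iteratedDeriv_const_mul_field, iteratedDeriv_prod_sub] at this
    exact this
  rw [hξ0] at h1
  have h2 : iteratedDeriv k f ξ = K * k.factorial := by linarith
  rw [h2, mul_div_assoc, div_self (by positivity), hK]
  field_simp

theorem iteratedDeriv_cramer {s : ℕ} {f : Fin s → ℝ → ℝ} {a b : ℝ}
    (hf : ∀ i, ContDiffOn ℝ ∞ (f i) (Ioo a b)) (A : Matrix (Fin s) (Fin s) ℝ) (m : Fin s)
    (k : ℕ) {z : ℝ}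
    (hz : z ∈ Ioo a b) :
    iteratedDeriv k (fun z => A.cramer (fun i => f i z) m) z =
      A.cramer (fun i => iteratedDeriv k (f i) z) m := by
  have h1 : ∀ b : Fin s → ℝ, A.cramer b m = ∑ i, A.cramer (Pi.single i 1) m * b i := by
    intro b
    conv_lhs => rw [pi_eq_sum_univ b]
    rw [map_sum, Finset.sum_apply]
    refine Finset.sum_congr rfl fun i _ => ?_
    have : (fun j => if i = j then (1 : ℝ) else 0) = Pi.single i 1 := by
      ext j; simp [Pi.single_apply, eq_comm]
    rw [map_smul, this, Pi.smul_apply, smul_eq_mul, mul_comm]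
  rw [h1]
  simp_rw [h1 (fun i => f i _)]
  rw [iteratedDeriv_fun_sum fun i _ =>
    contDiffAt_const.mul ((hf i).contDiffAt_Ioo hz k)]
  simp_rw [iteratedDeriv_const_mul_field]

/-- Mean value theorem for interpolation determinants. -/
theorem exists_det_eq_prod_mul_det {s : ℕ} {f : Fin s → ℝ → ℝ} {a b : ℝ}
    (hf : ∀ i, ContDiffOn ℝ ∞ (f i) (Ioo a b)) {t : Fin s → ℝ} (ht : Function.Injective t)
    (htI : ∀ j, t j ∈ Ioo a b) :
    ∃ ξ : Fin s → ℝ, (∀ j, ξ j ∈ Ioo a b) ∧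
      (Matrix.of fun i j => f i (t j)).det =
        (∏ j : Fin s, ∏ l : Fin j, (t j - t (l.castLE j.2.le))) *
          (Matrix.of fun i j : Fin s => iteratedDeriv j (f i) (ξ j) / (j : ℕ).factorial).det := by
  let V : Fin s → ℝ := fun j => ∏ l : Fin j, (t j - t (l.castLE j.2.le))
  have key : ∀ n m : ℕ, n + m = s → ∃ ξ : Fin s → ℝ, (∀ j, ξ j ∈ Ioo a b) ∧
      (Matrix.of fun i j => f i (t j)).det =
        (∏ j : Fin s, if (j : ℕ) < m then 1 else V j) *
          (Matrix.of fun i j : Fin s => if (j : ℕ) < m then f i (t j) else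
            iteratedDeriv j (f i) (ξ j) / (j : ℕ).factorial).det := by
    intro n
    induction n with
    | zero =>
      intro m hm
      refine ⟨t, htI, ?_⟩
      have : ∀ j : Fin s, (j : ℕ) < m := fun j => by omega
      simp [this]
    | succ n ih =>
      intro m hm
      obtain ⟨ξ, hξ, hdet⟩ := ih (m + 1) (by omega)
      have hms : m < s := by omega
      let m' : Fin s := ⟨m, hms⟩
      set A : Matrix (Fin s) (Fin s) ℝ := Matrix.of fun i j : Fin s =>
        if (j : ℕ) < m + 1 then f i (t j) else
            iteratedDeriv j (f i) (ξ j) / (j : ℕ).factorial with hA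
      let G : ℝ → ℝ := fun z => A.cramer (fun i => f i z) m'
      have hG : ContDiffOn ℝ ∞ G (Ioo a b) := by
        have h1 : G = fun z => ∑ i, f i z * A.cramer (Pi.single i 1) m' := by
          ext z
          simp only [G]
          conv_lhs => rw [pi_eq_sum_univ (fun i => f i z)]
          rw [map_sum, Finset.sum_apply]
          refine Finset.sum_congr rfl fun i _ => ?_
          have : (fun j => if i = j then (1 : ℝ) else 0) = Pi.single i 1 := by
            ext j; simp [Pi.single_apply, eq_comm]
          rw [map_smul, this, Pi.smul_apply, smul_eq_mul]
        rw [h1]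
        exact ContDiffOn.sum fun i _ => (hf i).mul contDiffOn_const
      have hG0 : ∀ l : Fin m, G (t (l.castLE hms.le)) = 0 := by
        intro l
        simp only [G, Matrix.cramer_apply]
        have hne : m' ≠ l.castLE hms.le := by
          intro h; have := congrArg Fin.val h; simp [m'] at this; omega
        refine Matrix.det_zero_of_column_eq hne fun i => ?_
        rw [Matrix.updateCol_self, Matrix.updateCol_ne hne.symm]
        simp [hA]
      obtain ⟨η, hη, hηG⟩ := exists_eq_iteratedDeriv_mul_prod hG
        (ht.comp (Fin.castLE_injective hms.le)) (fun l => htI _) hG0 (htI m')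
      refine ⟨Function.update ξ m' η, fun j => ?_, ?_⟩
      · by_cases hj : j = m'
        · subst hj; simpa using hη
        · simpa [hj] using hξ j
      · rw [iteratedDeriv_cramer hf A m' m hη] at hηG
        have hAG : A.det = G (t m') := by
          simp only [G, Matrix.cramer_apply]
          congr 1
          ext i j
          by_cases hj : j = m'
          · subst hj; simp [hA, m']
          · rw [Matrix.updateCol_ne hj]
        rw [hdet, hAG, hηG]
        have hprod : (∏ j : Fin s, if (j : ℕ) < m then 1 else V j) =
            (∏ j : Fin s, if (j : ℕ) < m + 1 then 1 else V j) * V m' := by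
          rw [← Finset.mul_prod_erase _ _ (Finset.mem_univ m'),
            ← Finset.mul_prod_erase (f := fun j : Fin s => if (j : ℕ) < m + 1 then 1 else V j) _
              (Finset.mem_univ m')]
          have : ∏ x ∈ Finset.univ.erase m', (if (x : ℕ) < m then 1 else V x) =
              ∏ x ∈ Finset.univ.erase m', (if (x : ℕ) < m + 1 then 1 else V x) := by
            refine Finset.prod_congr rfl fun j hj => ?_
            have hj' : (j : ℕ) ≠ m := fun h => (Finset.mem_erase.mp hj).1 (Fin.ext h)
            have : (j : ℕ) < m ↔ (j : ℕ) < m + 1 := by omega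
            simp [this]
          rw [this]; simp [m']; ring
        rw [hprod]
        have hV : V m' = ∏ l : Fin m, (t m' - (t ∘ Fin.castLE hms.le) l) := rfl
        have hd : A.cramer (fun i => iteratedDeriv m (f i) η) m' / (m.factorial : ℝ) =
            (Matrix.of fun i j : Fin s => if (j : ℕ) < m then f i (t j) else
              iteratedDeriv j (f i) (Function.update ξ m' η j) / (j : ℕ).factorial).det := by
          have h1 : A.cramer (fun i => iteratedDeriv m (f i) η) m' / (m.factorial : ℝ) =
              A.cramer ((m.factorial : ℝ)⁻¹ • fun i => iteratedDeriv m (f i) η) m' := by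
            rw [map_smul, Pi.smul_apply, smul_eq_mul]; ring
          rw [h1, Matrix.cramer_apply]
          congr 1
          ext i j
          by_cases hj : j = m'
          · subst hj
            simp [m']; ring
          · rw [Matrix.updateCol_ne hj]
            have hj' : (j : ℕ) ≠ m := fun h => hj (Fin.ext h)
            have : (j : ℕ) < m ↔ (j : ℕ) < m + 1 := by omega
            simp [hA, this, hj]
        rw [← hd, hV]
        ring
  obtain ⟨ξ, hξ, h⟩ := key s 0 (by omega)
  exact ⟨ξ, hξ, by simpa using h⟩

theorem abs_det_le_of_iteratedDeriv_le {s : ℕ} {f : Fin s → ℝ → ℝ} {a b : ℝ}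
    (hf : ∀ i, ContDiffOn ℝ ∞ (f i) (Ioo a b)) {t : Fin s → ℝ} (ht : Function.Injective t)
    (htI : ∀ j, t j ∈ Ioo a b) {δ A B : ℝ}
    (hδ : ∀ j l, |t j - t l| ≤ δ)
    (hfB : ∀ i, ∀ k < s, ∀ x ∈ Ioo a b, |iteratedDeriv k (f i) x| / k.factorial ≤ B * A ^ k) :
    |(Matrix.of fun i j => f i (t j)).det| ≤
      s.factorial * B ^ s * (δ * A) ^ (s * (s - 1) / 2) := by
  obtain ⟨ξ, hξ, h⟩ := exists_det_eq_prod_mul_det hf ht htI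
  have hsum : ∀ x : ℝ, ∏ j : Fin s, x ^ (j : ℕ) = x ^ (s * (s - 1) / 2) := by
    intro x
    rw [Finset.prod_pow_eq_pow_sum, Fin.sum_univ_eq_sum_range (fun i => i), Finset.sum_range_id]
  have h1 : |∏ j : Fin s, ∏ l : Fin j, (t j - t (l.castLE j.2.le))| ≤ δ ^ (s * (s - 1) / 2) := by
    rw [Finset.abs_prod, ← hsum]
    refine Finset.prod_le_prod (fun _ _ => abs_nonneg _) fun j _ => ?_
    rw [Finset.abs_prod]
    refine (Finset.prod_le_prod (fun _ _ => abs_nonneg _) fun l _ => hδ _ _).trans ?_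
    simp
  have h2 : |(Matrix.of fun i j : Fin s => iteratedDeriv j (f i) (ξ j) / (j : ℕ).factorial).det|
      ≤ s.factorial * (B ^ s * A ^ (s * (s - 1) / 2)) := by
    rw [Matrix.det_apply']
    refine (Finset.abs_sum_le_sum_abs _ _).trans ?_
    have : ∀ σ ∈ (Finset.univ : Finset (Equiv.Perm (Fin s))),
        |((Equiv.Perm.sign σ : ℤ) : ℝ) * ∏ i, (Matrix.of fun i j : Fin s =>
          iteratedDeriv j (f i) (ξ j) / (j : ℕ).factorial) (σ i) i| ≤
          B ^ s * A ^ (s * (s - 1) / 2) := by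
      intro σ _
      rw [abs_mul, Finset.abs_prod]
      have hs : |((Equiv.Perm.sign σ : ℤ) : ℝ)| = 1 := by
        rcases Int.units_eq_one_or (Equiv.Perm.sign σ) with h | h <;> simp [h]
      rw [hs, one_mul]
      refine (Finset.prod_le_prod (fun _ _ => abs_nonneg _)
        (g := fun j : Fin s => B * A ^ (j : ℕ)) fun j _ => ?_).trans ?_
      · rw [Matrix.of_apply, abs_div, Nat.abs_cast]
        exact hfB _ _ j.2 _ (hξ j)
      · rw [Finset.prod_mul_distrib, hsum]; simp
    refine (Finset.sum_le_card_nsmul _ _ _ this).trans ?_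
    rw [Finset.card_univ, Fintype.card_perm, Fintype.card_fin, nsmul_eq_mul]
  rw [h, abs_mul]
  refine (mul_le_mul h1 h2 (abs_nonneg _) ((abs_nonneg _).trans h1)).trans_eq ?_
  rw [mul_pow]; ring

/-- The Wronskian of the first `k` functions of a sequence. -/
noncomputable def wronskian (k : ℕ) (f : ℕ → ℝ → ℝ) (t : ℝ) : ℝ :=
  (Matrix.of fun i j : Fin k => iteratedDeriv i (f j) t).det

theorem wronskian_one (f : ℕ → ℝ → ℝ) (t : ℝ) : wronskian 1 f t = f 0 t := by
  simp [wronskian]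

theorem wronskian_congr {k : ℕ} {f g : ℕ → ℝ → ℝ} {a b t : ℝ} (ht : t ∈ Ioo a b)
    (h : ∀ j, Set.EqOn (f j) (g j) (Ioo a b)) : wronskian k f t = wronskian k g t := by
  unfold wronskian
  congr 1
  ext i j
  exact (h j).iteratedDeriv_of_isOpen isOpen_Ioo _ ht

theorem wronskian_mul {k : ℕ} {u : ℝ → ℝ} {f : ℕ → ℝ → ℝ} {a b t : ℝ} (ht : t ∈ Ioo a b)
    (hu : ContDiffOn ℝ ∞ u (Ioo a b)) (hf : ∀ j, ContDiffOn ℝ ∞ (f j) (Ioo a b)) :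
    wronskian k (fun j => u * f j) t = u t ^ k * wronskian k f t := by
  let T : Matrix (Fin k) (Fin k) ℝ := Matrix.of fun i l : Fin k =>
    if (l : ℕ) ≤ i then ((i : ℕ).choose l : ℝ) * iteratedDeriv (i - l) u t else 0
  have hT : T.det = u t ^ k := by
    rw [Matrix.det_of_isLowerTriangular T]
    · simp [T]
    · intro i j hij
      have : ¬ (j : ℕ) ≤ i := by
        have : i < j := hij
        simpa using this
      simp [T]
      omega
  unfold wronskian
  rw [← hT, ← Matrix.det_mul]
  congr 1
  ext i j
  change iteratedDeriv (i : ℕ) (u * f j) t = _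
  rw [mul_comm u (f j), iteratedDeriv_mul ((hf j).contDiffAt_Ioo ht _) (hu.contDiffAt_Ioo ht _),
    Matrix.mul_apply, Finset.sum_fin_eq_sum_range]
  have hsub : Finset.range ((i : ℕ) + 1) ⊆ Finset.range k := Finset.range_subset_range.mpr i.2
  rw [← Finset.sum_subset hsub]
  · refine Finset.sum_congr rfl fun l hl => ?_
    have h1 : l < k := Finset.mem_range.mp (hsub hl)
    have h2 : l ≤ i := by simpa [Nat.lt_succ_iff] using hl
    have h3 : (⟨l, h1⟩ : Fin k) ≤ i := h2
    simp [h1, T, h3]; ring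
  · intro l hl hl'
    have h1 : l < k := Finset.mem_range.mp hl
    have h2 : ¬ l ≤ i := by simpa [Nat.lt_succ_iff] using hl'
    have h3 : ¬ (⟨l, h1⟩ : Fin k) ≤ i := h2
    simp [h1, T, h3]

theorem wronskian_succ_of_one {k : ℕ} {f : ℕ → ℝ → ℝ} {t : ℝ} (h0 : f 0 = fun _ => 1) :
    wronskian (k + 1) f t = wronskian k (fun j => deriv (f (j + 1))) t := by
  unfold wronskian
  rw [Matrix.det_succ_column_zero, Finset.sum_eq_single 0]
  · simp only [h0, Fin.val_zero, Matrix.of_apply, pow_zero, one_mul, iteratedDeriv_zero]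
    congr 1
    ext i j
    simp [iteratedDeriv_succ']
  · intro i _ hi
    have : (i : ℕ) ≠ 0 := fun h => hi (Fin.ext h)
    simp [h0, iteratedDeriv_const, this]
  · simp

/-- Reduction of order for Wronskians. -/
theorem wronskian_succ {k : ℕ} {f : ℕ → ℝ → ℝ} {a b t : ℝ} (ht : t ∈ Ioo a b)
    (hf : ∀ j, ContDiffOn ℝ ∞ (f j) (Ioo a b)) (h0 : ∀ x ∈ Ioo a b, f 0 x ≠ 0) :
    wronskian (k + 1) f t =
      f 0 t ^ (k + 1) * wronskian k (fun j => deriv (f (j + 1) / f 0)) t := by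
  let v : ℕ → ℝ → ℝ := fun j => if j = 0 then fun _ => 1 else f j / f 0
  have hv : ∀ j, ContDiffOn ℝ ∞ (v j) (Ioo a b) := by
    intro j
    by_cases hj : j = 0
    · simp only [v, hj, if_true]; exact contDiffOn_const
    · simp only [v, hj, if_false]; exact (hf j).div (hf 0) h0
  rw [wronskian_congr (g := fun j => f 0 * v j) ht, wronskian_mul ht (hf 0) hv,
    wronskian_succ_of_one (by simp [v])]
  · simp [v]
  · intro j x hx
    by_cases hj : j = 0
    · simp [v, hj]
    · simp only [v, hj, if_false, Pi.mul_apply, Pi.div_apply]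
      field_simp [h0 x hx]

/-- Pólya's criterion: nonvanishing Wronskians force a Chebyshev system. -/
theorem no_zeros_of_wronskian_ne_zero {a b : ℝ} {s : ℕ} : ∀ {f : ℕ → ℝ → ℝ},
    (∀ j, ContDiffOn ℝ ∞ (f j) (Ioo a b)) →
    (∀ k ≤ s, ∀ x ∈ Ioo a b, wronskian k f x ≠ 0) →
    ∀ {c : Fin s → ℝ}, c ≠ 0 → ∀ {t : Fin s → ℝ}, StrictMono t → (∀ i, t i ∈ Ioo a b) →
    ¬ ∀ i, ∑ j, c j * f j (t i) = 0 := by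
  induction s with
  | zero => intro f _ _ c hc; exact absurd (Subsingleton.elim c 0) hc
  | succ s ih =>
    intro f hf hW c hc t ht htI h0
    have hf0 : ∀ x ∈ Ioo a b, f 0 x ≠ 0 := fun x hx => by
      simpa [wronskian_one] using hW 1 (by omega) x hx
    have hq : ∀ j, ContDiffOn ℝ ∞ (f j / f 0) (Ioo a b) := fun j => (hf j).div (hf 0) hf0
    by_cases hc' : (fun j : Fin s => c j.succ) = 0
    · have hs : ∀ j : Fin s, c j.succ = 0 := fun j => congrFun hc' j
      have h1 := h0 0
      rw [Fin.sum_univ_succ] at h1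
      simp only [hs, zero_mul, Finset.sum_const_zero, add_zero, mul_eq_zero, Fin.val_zero,
        hf0 _ (htI 0), or_false] at h1
      exact hc (funext fun j => by refine Fin.cases h1 hs j)
    · let g : ℝ → ℝ := fun x => c 0 + ∑ j : Fin s, c j.succ * (f (j + 1) / f 0) x
      have hg : DifferentiableOn ℝ g (Ioo a b) := by
        refine (differentiableOn_const _).add (DifferentiableOn.fun_sum fun j _ => ?_)
        exact (differentiableOn_const _).mul (hq _).differentiableOn_Ioo
      have hg0 : ∀ i, g (t i) = 0 := by
        intro i
        have h1 := h0 i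
        rw [Fin.sum_univ_succ] at h1
        have h2 : g (t i) * f 0 (t i) = 0 := by
          rw [← h1]
          simp only [g, add_mul, Finset.sum_mul, Pi.div_apply, Fin.val_zero, Fin.val_succ]
          congr 1
          refine Finset.sum_congr rfl fun j _ => ?_
          field_simp [hf0 _ (htI i)]
        exact (mul_eq_zero.mp h2).resolve_right (hf0 _ (htI i))
      obtain ⟨u, hu, huI, hu0⟩ := exists_strictMono_deriv_eq_zero hg ht htI hg0
      refine ih (f := fun j => deriv (f (j + 1) / f 0)) (fun j => (hq _).deriv_Ioo) ?_ hc' hu huI ?_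
      · intro k hk x hx hx0
        refine hW (k + 1) (by omega) x hx ?_
        rw [wronskian_succ hx hf hf0, hx0, mul_zero]
      · intro i
        rw [← hu0 i]
        have hd : ∀ j : Fin s, DifferentiableAt ℝ (f (j + 1) / f 0) (u i) := fun j =>
          (hq _).differentiableOn_Ioo.differentiableAt (isOpen_Ioo.mem_nhds (huI i))
        simp only [g]
        rw [deriv_const_add, deriv_fun_sum fun j _ => (hd j).const_mul _]
        refine Finset.sum_congr rfl fun j _ => ?_
        rw [deriv_const_mul _ (hd j)]

theorem det_ne_zero_of_wronskian_ne_zero {a b : ℝ} {s : ℕ} {f : ℕ → ℝ → ℝ}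
    (hf : ∀ j, ContDiffOn ℝ ∞ (f j) (Ioo a b))
    (hW : ∀ k ≤ s, ∀ x ∈ Ioo a b, wronskian k f x ≠ 0)
    {t : Fin s → ℝ} (ht : StrictMono t) (htI : ∀ i, t i ∈ Ioo a b) :
    (Matrix.of fun i j : Fin s => f i (t j)).det ≠ 0 := by
  intro hdet
  obtain ⟨c, hc, hc0⟩ := Matrix.exists_vecMul_eq_zero_iff.mpr hdet
  refine no_zeros_of_wronskian_ne_zero hf hW hc ht htI fun i => ?_
  simpa [Matrix.vecMul, dotProduct] using congrFun hc0 i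

/-- A vanishing Wronskian after nonvanishing ones gives a linear relation. -/
theorem exists_eq_sum_of_wronskian_eq_zero {a b : ℝ} {k : ℕ} : ∀ {f : ℕ → ℝ → ℝ},
    (∀ j, ContDiffOn ℝ ∞ (f j) (Ioo a b)) →
    (∀ j ≤ k, ∀ x ∈ Ioo a b, wronskian j f x ≠ 0) →
    (∀ x ∈ Ioo a b, wronskian (k + 1) f x = 0) →
    ∃ c : Fin k → ℝ, ∀ x ∈ Ioo a b, f k x = ∑ j, c j * f j x := by
  induction k with
  | zero =>
    intro f hf _ h0
    exact ⟨0, fun x hx => by simpa [wronskian_one] using h0 x hx⟩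
  | succ k ih =>
    intro f hf hW h0
    have hf0 : ∀ x ∈ Ioo a b, f 0 x ≠ 0 := fun x hx => by
      simpa [wronskian_one] using hW 1 (by omega) x hx
    have hq : ∀ j, ContDiffOn ℝ ∞ (f j / f 0) (Ioo a b) := fun j => (hf j).div (hf 0) hf0
    obtain ⟨c, hc⟩ := ih (f := fun j => deriv (f (j + 1) / f 0)) (fun j => (hq _).deriv_Ioo)
      (fun j hj x hx hx0 => hW (j + 1) (by omega) x hx
        (by rw [wronskian_succ hx hf hf0, hx0, mul_zero]))
      (fun x hx => by
        have h1 := h0 x hx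
        rw [wronskian_succ hx hf hf0] at h1
        exact (mul_eq_zero.mp h1).resolve_left (pow_ne_zero _ (hf0 x hx)))
    rcases (Ioo a b).eq_empty_or_nonempty with he | ⟨x0, hx0⟩
    · exact ⟨0, fun x hx => by simp [he] at hx⟩
    let g : ℝ → ℝ := fun x => (f (k + 1) / f 0) x - ∑ j : Fin k, c j * (f (j + 1) / f 0) x
    have hgd : ∀ x ∈ Ioo a b, HasDerivAt g 0 x := by
      intro x hx
      have hd : ∀ j : ℕ, HasDerivAt (f (j + 1) / f 0) (deriv (f (j + 1) / f 0) x) x := fun j =>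
          ((hq _).differentiableOn_Ioo.differentiableAt (isOpen_Ioo.mem_nhds hx)).hasDerivAt
      have := (hd k).sub (HasDerivAt.fun_sum fun (j : Fin k) (_ : j ∈ Finset.univ) =>
        (hd j).const_mul (c j))
      rw [← hc x hx, sub_self] at this
      exact this
    have hconst : ∀ x ∈ Ioo a b, g x = g x0 := by
      intro x hx
      refine (convex_Ioo a b).is_const_of_fderivWithin_eq_zero (𝕜 := ℝ)
        (fun y hy => (hgd y hy).differentiableAt.differentiableWithinAt) (fun y hy => ?_) hx hx0
      rw [fderivWithin_of_isOpen isOpen_Ioo hy]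
      ext; simp [(hgd y hy).deriv]
    refine ⟨Fin.cons (g x0) c, fun x hx => ?_⟩
    have h1 := hconst x hx
    rw [Fin.sum_univ_succ]
    simp only [Fin.cons_zero, Fin.cons_succ, Fin.val_zero, Fin.val_succ]
    rw [← h1]
    simp only [g, Pi.div_apply, sub_mul, Finset.sum_mul]
    have h2 : ∀ j : Fin k, c j * (f (j + 1) x / f 0 x) * f 0 x = c j * f (j + 1) x := by
      intro j; field_simp [hf0 x hx]
    simp only [h2]
    field_simp [hf0 x hx]
    ring

/-- A bounded function with monotone derivative has bounded derivative. -/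
theorem abs_deriv_le_of_monotone {v : ℝ → ℝ} {a b x h B : ℝ} (hv : ContDiffOn ℝ ∞ v (Ioo a b))
    (hh : 0 < h) (hx : a < x - h ∧ x + h < b)
    (hB : ∀ y, |y - x| ≤ h → |v y| ≤ B)
    (hs : (∀ y ∈ Ioo a b, 0 ≤ deriv (deriv v) y) ∨ (∀ y ∈ Ioo a b, deriv (deriv v) y ≤ 0)) :
    |deriv v x| ≤ 2 * B / h := by
  wlog hs' : ∀ y ∈ Ioo a b, 0 ≤ deriv (deriv v) y generalizing v
  · have hs2 := hs.resolve_left hs'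
    have e : deriv (-v) = -deriv v := by ext y; simp
    have := this (v := -v) hv.neg (fun y hy => by simpa using hB y hy)
      (Or.inl (fun y hy => by rw [e]; simpa using hs2 y hy))
      (fun y hy => by rw [e]; simpa using hs2 y hy)
    rw [e] at this
    simpa using this
  have hmono : MonotoneOn (deriv v) (Ioo a b) :=
    monotoneOn_of_deriv_nonneg (convex_Ioo a b) hv.deriv_Ioo.continuousOn
      (by simpa using hv.deriv_Ioo.differentiableOn_Ioo) (by simpa using hs')
  have hxI : x ∈ Ioo a b := ⟨by linarith [hx.1], by linarith [hx.2]⟩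
  have mvt : ∀ p q, p ∈ Ioo a b → q ∈ Ioo a b → p < q →
      ∃ c ∈ Ioo p q, deriv v c * (q - p) = v q - v p := by
    intro p q hp hq hpq
    have hsub : Set.Icc p q ⊆ Ioo a b := fun z hz => ⟨hp.1.trans_le hz.1, hz.2.trans_lt hq.2⟩
    obtain ⟨c, hc, e⟩ := exists_deriv_eq_slope v hpq (hv.continuousOn.mono hsub)
      (hv.differentiableOn_Ioo.mono (Set.Ioo_subset_Icc_self.trans hsub))
    refine ⟨c, hc, ?_⟩
    rw [e]; field_simp [(sub_pos.mpr hpq).ne']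
  have b0 := abs_le.mp (hB x (by simpa using hh.le))
  have b1 := abs_le.mp (hB (x + h) (by simp [abs_of_pos hh]))
  have b2 := abs_le.mp (hB (x - h) (by simp [abs_of_pos hh]))
  have e2 : 2 * B / h * h = 2 * B := by field_simp
  rw [abs_le]
  constructor
  · obtain ⟨c, hc, e⟩ := mvt (x - h) x ⟨hx.1, by linarith [hx.2]⟩ hxI (by linarith)
    have := hmono ⟨hx.1.trans hc.1, by linarith [hc.2, hx.2]⟩ hxI hc.2.le
    by_contra hcon
    push Not at hcon
    nlinarith
  · obtain ⟨c, hc, e⟩ := mvt x (x + h) hxI ⟨by linarith [hx.1], hx.2⟩ (by linarith)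
    have := hmono hxI ⟨by linarith [hc.1, hx.1], hc.2.trans hx.2⟩ hc.1.le
    by_contra hcon
    push Not at hcon
    nlinarith

/-- Derivatives of constant sign on an interval obey Cauchy-type estimates. -/
theorem abs_iteratedDeriv_le_of_sign {u : ℝ → ℝ} {a b x R : ℝ} {n : ℕ}
    (hu : ContDiffOn ℝ ∞ u (Ioo a b)) (hR : 0 < R) (hx : a ≤ x - R ∧ x + R ≤ b)
    (hu1 : ∀ y ∈ Ioo a b, |u y| ≤ 1)
    (hs : ∀ k, 1 ≤ k → k ≤ n → (∀ y ∈ Ioo a b, 0 ≤ iteratedDeriv k u y) ∨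
      (∀ y ∈ Ioo a b, iteratedDeriv k u y ≤ 0))
    {k : ℕ} (hk : k < n) : |iteratedDeriv k u x| / k.factorial ≤ (12 / R) ^ k := by
  rcases Nat.eq_zero_or_pos k with rfl | hk0
  · simpa using hu1 x ⟨by linarith [hx.1], by linarith [hx.2]⟩
  have hkR : (0 : ℝ) < k := by exact_mod_cast hk0
  set h : ℝ := R / (2 * k) with hh
  have hhpos : 0 < h := by positivity
  have key : ∀ i ≤ k, ∀ y, |y - x| ≤ (k - i) * h → |iteratedDeriv i u y| ≤ (2 / h) ^ i := by
    intro i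
    induction i with
    | zero =>
      intro _ y hy
      have hkh : k * h = R / 2 := by rw [hh]; field_simp
      have := abs_le.mp hy
      simp only [CharP.cast_eq_zero, sub_zero, hkh] at this
      simpa using hu1 y ⟨by linarith [hx.1, this.1], by linarith [hx.2, this.2]⟩
    | succ i ih =>
      intro hi y hy
      have hkh : k * h = R / 2 := by rw [hh]; field_simp
      have hy' := abs_le.mp hy
      push_cast at hy'
      have hih : 0 ≤ i * h := by positivity
      rw [iteratedDeriv_succ]
      have := abs_deriv_le_of_monotone (x := y) (h := h) (B := (2 / h) ^ i)
        (hu.iteratedDeriv_Ioo i) hhpos ⟨by nlinarith [hx.1], by nlinarith [hx.2]⟩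
        (fun z hz => ih (by omega) z (by
          have : |z - x| ≤ |z - y| + |y - x| := abs_sub_le _ _ _
          push_cast at hy
          nlinarith))
        (by
          have := hs (i + 1 + 1) (by omega) (by omega)
          rwa [iteratedDeriv_succ, iteratedDeriv_succ] at this)
      refine this.trans_eq ?_
      rw [pow_succ]; ring
  have h1 := key k le_rfl x (by simp)
  have h2 : (2 / h) ^ k = (4 / R) ^ k * (k : ℝ) ^ k := by
    rw [← mul_pow]; congr 1; rw [hh]; field_simp; norm_num
  have h3 : (k : ℝ) ^ k / k.factorial ≤ 3 ^ k := by
    refine (Real.pow_div_factorial_le_exp (k : ℝ) hkR.le k).trans ?_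
    have : Real.exp k = Real.exp 1 ^ k := by rw [← Real.exp_nat_mul]; simp
    rw [this]
    exact pow_le_pow_left₀ (Real.exp_pos 1).le (by linarith [Real.exp_one_lt_d9]) k
  calc |iteratedDeriv k u x| / k.factorial ≤ (4 / R) ^ k * (k : ℝ) ^ k / k.factorial := by
        rw [← h2]; gcongr
    _ = (4 / R) ^ k * ((k : ℝ) ^ k / k.factorial) := by ring
    _ ≤ (4 / R) ^ k * 3 ^ k := by gcongr
    _ = (12 / R) ^ k := by rw [← mul_pow]; congr 1; ring

theorem abs_iteratedDeriv_mul_le {u v : ℝ → ℝ} {a b x A c : ℝ} (hx : x ∈ Ioo a b)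
    (hu : ContDiffOn ℝ ∞ u (Ioo a b)) (hv : ContDiffOn ℝ ∞ v (Ioo a b)) (hA : 0 ≤ A) (hc : 0 ≤ c)
    {n : ℕ} (huA : ∀ k < n, |iteratedDeriv k u x| / k.factorial ≤ A ^ k)
    (hvA : ∀ k < n, |iteratedDeriv k v x| / k.factorial ≤ c * (2 * A) ^ k) {k : ℕ} (hk : k < n) :
    |iteratedDeriv k (u * v) x| / k.factorial ≤ 2 * c * (2 * A) ^ k := by
  rw [iteratedDeriv_mul (hu.contDiffAt_Ioo hx k) (hv.contDiffAt_Ioo hx k),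
    div_le_iff₀ (by positivity)]
  refine (Finset.abs_sum_le_sum_abs _ _).trans ?_
  have hterm : ∀ i ∈ Finset.range (k + 1),
      |(k.choose i : ℝ) * iteratedDeriv i u x * iteratedDeriv (k - i) v x| ≤
        c * (2 * A) ^ k * k.factorial * (1 / 2) ^ i := by
    intro i hi
    have hik : i ≤ k := by simpa [Nat.lt_succ_iff] using hi
    have h1 := huA i (by omega)
    have h2 := hvA (k - i) (by omega)
    have hf1 : (0 : ℝ) < i.factorial := by positivity
    have hf2 : (0 : ℝ) < (k - i).factorial := by positivity
    have hch : (k.choose i : ℝ) = k.factorial / (i.factorial * (k - i).factorial) :=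
      Nat.cast_choose ℝ hik
    rw [abs_mul, abs_mul, Nat.abs_cast, hch]
    calc _ = k.factorial * ((|iteratedDeriv i u x| / i.factorial) *
            (|iteratedDeriv (k - i) v x| / (k - i).factorial)) := by field_simp
      _ ≤ k.factorial * (A ^ i * (c * (2 * A) ^ (k - i))) := by gcongr
      _ = c * (2 * A) ^ k * k.factorial * (1 / 2) ^ i := by
        obtain ⟨j, rfl⟩ := Nat.exists_eq_add_of_le hik
        rw [Nat.add_sub_cancel_left, pow_add, mul_pow 2 A i, one_div, inv_pow]
        field_simp
  refine (Finset.sum_le_sum hterm).trans ?_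
  rw [← Finset.mul_sum]
  have hgeom : ∑ i ∈ Finset.range (k + 1), (1 / 2 : ℝ) ^ i ≤ 2 := sum_geometric_two_le (k + 1)
  calc _ ≤ c * (2 * A) ^ k * k.factorial * 2 := by gcongr
    _ = _ := by ring

/-- Derivative bounds for monomials in two functions. -/
theorem abs_iteratedDeriv_pow_mul_pow_le {u v : ℝ → ℝ} {a b x A : ℝ} (hx : x ∈ Ioo a b)
    (hu : ContDiffOn ℝ ∞ u (Ioo a b)) (hv : ContDiffOn ℝ ∞ v (Ioo a b)) (hA : 0 ≤ A)
    {n : ℕ} (huA : ∀ k < n, |iteratedDeriv k u x| / k.factorial ≤ A ^ k)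
    (hvA : ∀ k < n, |iteratedDeriv k v x| / k.factorial ≤ A ^ k) (p q : ℕ) {k : ℕ} (hk : k < n) :
    |iteratedDeriv k (u ^ p * v ^ q) x| / k.factorial ≤ 2 ^ (p + q) * (2 * A) ^ k := by
  induction p generalizing k with
  | zero =>
    induction q generalizing k with
    | zero =>
      simp only [pow_zero, mul_one, add_zero, one_mul]
      rcases Nat.eq_zero_or_pos k with rfl | hk0
      · simp
      · have : iteratedDeriv k (1 : ℝ → ℝ) x = 0 := by
          have := iteratedDeriv_const (n := k) (c := (1 : ℝ)) (x := x)
          rw [if_neg hk0.ne'] at this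
          exact this
        rw [this]; simp; positivity
    | succ q ih =>
      have e : u ^ 0 * v ^ (q + 1) = v * (u ^ 0 * v ^ q) := by ring
      rw [e]
      refine (abs_iteratedDeriv_mul_le hx hv ?_ hA (by positivity) hvA
        (fun k hk => ih hk) hk).trans_eq (by ring)
      exact (hu.pow 0).mul (hv.pow q)
  | succ p ih =>
    have e : u ^ (p + 1) * v ^ q = u * (u ^ p * v ^ q) := by ring
    rw [e]
    refine (abs_iteratedDeriv_mul_le hx hu ?_ hA (by positivity) huA
      (fun k hk => ih hk) hk).trans_eq (by ring)
    exact (hu.pow p).mul (hv.pow q)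

theorem two_mul_finrank_restrictTotalDegree (t : ℕ) :
    2 * Module.finrank ℚ (restrictTotalDegree (Fin 2) ℚ t) = (t + 1) * (t + 2) := by
  have h1 : Module.finrank ℚ (restrictTotalDegree (Fin 2) ℚ t) =
      Nat.card {n : Fin 2 →₀ ℕ | (n.sum fun _ e => e) ≤ t} :=
    Module.finrank_eq_nat_card_basis (basisRestrictSupport ℚ _)
  have h2 : Nat.card {n : Fin 2 →₀ ℕ | (n.sum fun _ e => e) ≤ t} =
      ((Finset.range (t + 1)).sigma fun i => Finset.range (i + 1)).card := by
    rw [← Fintype.card_coe, ← Nat.card_eq_fintype_card]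
    have hsum : ∀ n : Fin 2 →₀ ℕ, (n.sum fun _ e => e) = n 0 + n 1 := fun n => by
      rw [Finsupp.sum_fintype _ _ (fun _ => rfl), Fin.sum_univ_two]
    refine Nat.card_congr
      { toFun := fun n => ⟨⟨n.1 0 + n.1 1, n.1 0⟩, ?_⟩
        invFun := fun p => ⟨Finsupp.equivFunOnFinite.symm ![p.1.2, p.1.1 - p.1.2], ?_⟩
        left_inv := ?_
        right_inv := ?_ }
    · have := n.2
      simp only [Set.mem_ofPred_eq, hsum] at this
      simp only [Finset.mem_sigma, Finset.mem_range]
      omega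
    · have := p.2
      simp only [Finset.mem_sigma, Finset.mem_range] at this
      simp only [Set.mem_ofPred_eq, hsum]
      simp
      omega
    · rintro ⟨n, hn⟩
      ext i
      fin_cases i <;> simp
    · rintro ⟨⟨i, j⟩, hp⟩
      simp only [Finset.mem_sigma, Finset.mem_range] at hp
      simp
      omega
  have h3 : ∀ t, 2 * ∑ i ∈ Finset.range (t + 1), (i + 1) = (t + 1) * (t + 2) := by
    intro t
    induction t with
    | zero => simp
    | succ t ih => rw [Finset.sum_range_succ, mul_add, ih]; ring
  rw [h1, h2, Finset.card_sigma]
  simpa using h3 t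

/-- The quotient of `ℚ[x,y]` by two polynomials without common factor has dimension at most the
product of the degrees. -/
theorem rank_quotient_span_pair_le {F G : MvPolynomial (Fin 2) ℚ} (hF : Prime F) (hFG : ¬ F ∣ G) :
    Module.rank ℚ (MvPolynomial (Fin 2) ℚ ⧸ Ideal.span {F, G}) ≤
      ((F.totalDegree * G.totalDegree : ℕ) : Cardinal) := by
  have hG0 : G ≠ 0 := fun h => hFG (h ▸ dvd_zero F)
  set d := F.totalDegree
  set e := G.totalDegree
  set π := (Ideal.Quotient.mkₐ ℚ (Ideal.span {F, G})).toLinearMap with hπ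
  have key : ∀ t, Module.finrank ℚ ((restrictTotalDegree (Fin 2) ℚ (t + d + e)).map π) ≤ d * e := by
    intro t
    set V := restrictTotalDegree (Fin 2) ℚ (t + d + e) with hV
    set VF := (restrictTotalDegree (Fin 2) ℚ (t + e)).map (LinearMap.mulLeft ℚ F) with hVF
    set VG := (restrictTotalDegree (Fin 2) ℚ (t + d)).map (LinearMap.mulLeft ℚ G) with hVG
    set VFG := (restrictTotalDegree (Fin 2) ℚ t).map (LinearMap.mulLeft ℚ (F * G)) with hVFG
    have inj : ∀ P : MvPolynomial (Fin 2) ℚ, P ≠ 0 → Function.Injective (LinearMap.mulLeft ℚ P) :=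
      fun P hP a b h => mul_left_cancel₀ hP (by simpa using h)
    have dF : Module.finrank ℚ VF = Module.finrank ℚ (restrictTotalDegree (Fin 2) ℚ (t + e)) :=
      (Submodule.equivMapOfInjective _ (inj F hF.ne_zero) _).finrank_eq.symm
    have dG : Module.finrank ℚ VG = Module.finrank ℚ (restrictTotalDegree (Fin 2) ℚ (t + d)) := 
      (Submodule.equivMapOfInjective _ (inj G hG0) _).finrank_eq.symm
    have dFG : Module.finrank ℚ VFG = Module.finrank ℚ (restrictTotalDegree (Fin 2) ℚ t) := 
      (Submodule.equivMapOfInjective _ (inj _ (mul_ne_zero hF.ne_zero hG0)) _).finrank_eq.symm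
    have hinf : VF ⊓ VG ≤ VFG := by
      rintro p ⟨⟨a, ha, rfl⟩, ⟨b, hb, hab⟩⟩
      simp only [LinearMap.mulLeft_apply] at hab ⊢
      obtain ⟨c, rfl⟩ : F ∣ b := (hF.dvd_or_dvd (⟨a, hab⟩ : F ∣ G * b)).resolve_left hFG
      refine ⟨c, ?_, by simp only [LinearMap.mulLeft_apply]; rw [← hab]; ring⟩
      simp only [SetLike.mem_coe, mem_restrictTotalDegree] at hb ⊢
      by_cases hc : c = 0
      · simp [hc]
      · rw [totalDegree_mul_of_isDomain hF.ne_zero hc] at hb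
        omega
    have hsupV : VF ⊔ VG ≤ V := by
      refine sup_le ?_ ?_
      · rintro p ⟨a, ha, rfl⟩
        simp only [SetLike.mem_coe, mem_restrictTotalDegree, LinearMap.mulLeft_apply, hV] at ha ⊢
        exact (totalDegree_mul _ _).trans (by omega)
      · rintro p ⟨a, ha, rfl⟩
        simp only [SetLike.mem_coe, mem_restrictTotalDegree, LinearMap.mulLeft_apply, hV] at ha ⊢
        exact (totalDegree_mul _ _).trans (by omega)
    have hker : VF ⊔ VG ≤ LinearMap.ker π := by
      refine sup_le ?_ ?_
      · rintro p ⟨a, ha, rfl⟩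
        have : F * a ∈ Ideal.span {F, G} :=
          Ideal.mul_mem_right _ _ (Ideal.subset_span (by simp))
        exact Ideal.Quotient.eq_zero_iff_mem.mpr this
      · rintro p ⟨a, ha, rfl⟩
        have : G * a ∈ Ideal.span {F, G} :=
          Ideal.mul_mem_right _ _ (Ideal.subset_span (by simp))
        exact Ideal.Quotient.eq_zero_iff_mem.mpr this
    have hFr : Module.finrank ℚ (VF ⊔ VG : Submodule ℚ _) + Module.finrank ℚ (V.map π) ≤
        Module.finrank ℚ V := by
      have h1 := LinearMap.finrank_range_add_finrank_ker (π.domRestrict V)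
      rw [LinearMap.range_domRestrict] at h1
      have h2 : Module.finrank ℚ (VF ⊔ VG : Submodule ℚ _) ≤
          Module.finrank ℚ (LinearMap.ker (π.domRestrict V)) := by
        have : (VF ⊔ VG).comap V.subtype ≤ LinearMap.ker (π.domRestrict V) := by
          intro x hx
          exact hker hx
        refine le_trans (le_of_eq ?_) (Submodule.finrank_mono this)
        exact (LinearEquiv.finrank_eq (Submodule.comapSubtypeEquivOfLe hsupV)).symm
      omega
    have h3 := Submodule.finrank_sup_add_finrank_inf_eq VF VG
    have h4 := Submodule.finrank_mono hinf
    have a1 := two_mul_finrank_restrictTotalDegree (t + d + e)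
    have a2 := two_mul_finrank_restrictTotalDegree (t + e)
    have a3 := two_mul_finrank_restrictTotalDegree (t + d)
    have a4 := two_mul_finrank_restrictTotalDegree t
    rw [← hV] at a1
    rw [← dF] at a2
    rw [← dG] at a3
    rw [← dFG] at a4
    nlinarith
  refine rank_le fun s hs => ?_
  have hsurj : Function.Surjective π := Ideal.Quotient.mk_surjective
  choose g hg using hsurj
  set t := s.sup fun x => (g x).totalDegree
  have hmem : ∀ x ∈ s, x ∈ (restrictTotalDegree (Fin 2) ℚ (t + d + e)).map π := by
    intro x hx
    refine ⟨g x, ?_, hg x⟩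
    simp only [SetLike.mem_coe, mem_restrictTotalDegree]
    have : (g x).totalDegree ≤ t := Finset.le_sup (f := fun x => (g x).totalDegree) hx
    omega
  have hli : LinearIndependent ℚ (fun i : s => (⟨i, hmem i i.2⟩ :
      (restrictTotalDegree (Fin 2) ℚ (t + d + e)).map π)) := by
    apply LinearIndependent.of_comp (Submodule.subtype _)
    exact hs
  have := hli.fintype_card_le_finrank
  rw [Fintype.card_coe] at this
  exact this.trans (key t)

/-- Bézout's inequality for affine plane curves over `ℚ` and their real points. -/
theorem card_common_zeros_le {F G : MvPolynomial (Fin 2) ℚ} (hF : Prime F) (hFG : ¬ F ∣ G)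
    (Z : Finset (Fin 2 → ℝ)) (hZF : ∀ z ∈ Z, aeval z F = 0) (hZG : ∀ z ∈ Z, aeval z G = 0) :
    Z.card ≤ F.totalDegree * G.totalDegree := by
  have h2 := rank_quotient_span_pair_le hF hFG
  have : Module.Finite ℚ (MvPolynomial (Fin 2) ℚ ⧸ Ideal.span {F, G}) :=
    Module.rank_lt_aleph0_iff.mp (h2.trans_lt (Cardinal.natCast_lt_aleph0))
  have h1 := cardinalMk_algHom_le_rank ℚ (MvPolynomial (Fin 2) ℚ ⧸ Ideal.span {F, G}) ℝ
  have hI : ∀ z ∈ Z, ∀ a ∈ Ideal.span {F, G}, aeval z a = 0 := by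
    intro z hz a ha
    have : Ideal.span {F, G} ≤ RingHom.ker (aeval z : MvPolynomial (Fin 2) ℚ →ₐ[ℚ] ℝ) := by
      rw [Ideal.span_le]
      rintro x (rfl | rfl)
      · exact hZF z hz
      · exact hZG z hz
    exact this ha
  let Φ : Z → (MvPolynomial (Fin 2) ℚ ⧸ Ideal.span {F, G} →ₐ[ℚ] ℝ) := fun z =>
    Ideal.Quotient.liftₐ _ (aeval z.1) (hI z.1 z.2)
  have hΦ : Function.Injective Φ := by
    intro z w hzw
    ext i
    have := congrArg (fun φ => φ (Ideal.Quotient.mk _ (X i))) hzw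
    have e : ∀ z : Z, Φ z (Ideal.Quotient.mk _ (X i)) = z.1 i := fun z =>
      (Ideal.Quotient.lift_mk _ _ _).trans (aeval_X z.1 i)
    rwa [e, e] at this
  have h3 := Cardinal.mk_le_of_injective hΦ
  simp only [Cardinal.lift_id] at h1
  have h4 := h3.trans (h1.trans h2)
  rw [Cardinal.mk_coe_finset] at h4
  exact_mod_cast h4

theorem hasStrictFDerivAt_aeval (P : MvPolynomial (Fin 2) ℚ) (u : ℝ × ℝ) :
    HasStrictFDerivAt (fun v : ℝ × ℝ => aeval ![v.1, v.2] P)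
      (aeval ![u.1, u.2] (pderiv 0 P) • ContinuousLinearMap.fst ℝ ℝ ℝ +
        aeval ![u.1, u.2] (pderiv 1 P) • ContinuousLinearMap.snd ℝ ℝ ℝ) u := by
  induction P using MvPolynomial.induction_on with
  | C a =>
    simp only [algHom_C, pderiv_C, map_zero, zero_smul, add_zero]
    exact hasStrictFDerivAt_const _ _
  | add p q hp hq =>
    simp only [map_add]
    exact (hp.add hq).congr_fderiv (by ext <;> simp)
  | mul_X p i hp =>
    have hX : HasStrictFDerivAt (fun v : ℝ × ℝ => aeval ![v.1, v.2] (X i : MvPolynomial (Fin 2) ℚ))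
        (aeval ![u.1, u.2] (pderiv 0 (X i : MvPolynomial (Fin 2) ℚ)) •
            ContinuousLinearMap.fst ℝ ℝ ℝ +
          aeval ![u.1, u.2] (pderiv 1 (X i : MvPolynomial (Fin 2) ℚ)) •
            ContinuousLinearMap.snd ℝ ℝ ℝ) u := by
      fin_cases i
      · simpa [pderiv_X] using hasStrictFDerivAt_fst
      · simpa [pderiv_X] using hasStrictFDerivAt_snd
    simp only [map_mul, Derivation.leibniz, map_add, smul_eq_mul]
    refine (hp.mul hX).congr_fderiv ?_
    ext <;> simp

theorem hasDerivAt_aeval {φ : ℝ → ℝ} {φ' x : ℝ} (hφ : HasDerivAt φ φ' x)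
    (P : MvPolynomial (Fin 2) ℚ) :
    HasDerivAt (fun t => aeval ![t, φ t] P)
      (aeval ![x, φ x] (pderiv 0 P) + aeval ![x, φ x] (pderiv 1 P) * φ') x := by
  have h := (hasStrictFDerivAt_aeval P (x, φ x)).hasFDerivAt.comp_hasDerivAt x
    ((hasDerivAt_id x).prodMk hφ)
  exact h.congr_deriv (by simp)

theorem continuous_aeval_pair (P : MvPolynomial (Fin 2) ℚ) :
    Continuous fun v : ℝ × ℝ => (aeval ![v.1, v.2] P : ℝ) :=
  continuous_iff_continuousAt.mpr fun u => (hasStrictFDerivAt_aeval P u).continuousAt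

theorem contDiffOn_aeval_graph {n : WithTop ℕ∞} {φ : ℝ → ℝ} {s : Set ℝ} (hφ : ContDiffOn ℝ n φ s)
    (P : MvPolynomial (Fin 2) ℚ) : ContDiffOn ℝ n (fun t => (aeval ![t, φ t] P : ℝ)) s := by
  induction P using MvPolynomial.induction_on with
  | C a =>
    simp only [algHom_C]
    exact contDiffOn_const
  | add p q hp hq =>
    simp only [map_add]
    exact hp.add hq
  | mul_X p i hp =>
    simp only [map_mul]
    refine hp.mul ?_
    fin_cases i
    · simp only [Fin.zero_eta, aeval_X, Matrix.cons_val_zero]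
      exact contDiffOn_id
    · simpa using hφ

/-- The numerator of the derivative of `P` along the curve `F = 0`. -/
noncomputable def curveDeriv (F P : MvPolynomial (Fin 2) ℚ) : MvPolynomial (Fin 2) ℚ :=
  pderiv 0 P * pderiv 1 F - pderiv 1 P * pderiv 0 F

/-- The numerators of the iterated derivatives of `P` along the curve `F = 0`. -/
noncomputable def curveIterDeriv (F P : MvPolynomial (Fin 2) ℚ) : ℕ → MvPolynomial (Fin 2) ℚ
  | 0 => P
  | i + 1 => pderiv 1 F * curveDeriv F (curveIterDeriv F P i) -
      C (2 * i : ℚ) * curveIterDeriv F P i * curveDeriv F (pderiv 1 F)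

theorem totalDegree_pderiv_lt {i : Fin 2} {P : MvPolynomial (Fin 2) ℚ} (hP : pderiv i P ≠ 0) :
    (pderiv i P).totalDegree < P.totalDegree := by
  have key : ∀ m ∈ (pderiv i P).support, (m.sum fun _ e => e) < P.totalDegree := by
    intro m hm
    have h1 : m + Finsupp.single i 1 ∈ P.support := by
      rw [mem_support_iff, coeff_pderiv] at hm
      rw [mem_support_iff]
      exact left_ne_zero_of_mul hm
    have h2 := le_totalDegree h1
    rw [Finsupp.sum_add_index' (fun _ => rfl) (fun _ _ _ => rfl),
      Finsupp.sum_single_index rfl] at h2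
    omega
  obtain ⟨m, hm⟩ := support_nonempty.mpr hP
  exact (Finset.sup_lt_iff ((Nat.zero_le _).trans_lt (key m hm))).mpr key

theorem totalDegree_pderiv_le (i : Fin 2) (P : MvPolynomial (Fin 2) ℚ) :
    (pderiv i P).totalDegree ≤ P.totalDegree := by
  by_cases hP : pderiv i P = 0
  · simp [hP]
  · exact (totalDegree_pderiv_lt hP).le

theorem totalDegree_curveDeriv_le (F P : MvPolynomial (Fin 2) ℚ) :
    (curveDeriv F P).totalDegree ≤ P.totalDegree + F.totalDegree := by
  unfold curveDeriv
  refine (totalDegree_sub _ _).trans (max_le ?_ ?_) <;>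
  exact (totalDegree_mul _ _).trans (add_le_add (totalDegree_pderiv_le _ _)
    (totalDegree_pderiv_le _ _))

theorem totalDegree_curveIterDeriv_le (F P : MvPolynomial (Fin 2) ℚ) (i : ℕ) :
    (curveIterDeriv F P i).totalDegree ≤ P.totalDegree + 2 * i * F.totalDegree := by
  induction i with
  | zero => simp [curveIterDeriv]
  | succ i ih =>
    rw [curveIterDeriv]
    refine (totalDegree_sub _ _).trans (max_le ?_ ?_)
    · refine (totalDegree_mul _ _).trans ?_
      have h1 := totalDegree_pderiv_le 1 F
      have h2 := totalDegree_curveDeriv_le F (curveIterDeriv F P i)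
      nlinarith
    · refine (totalDegree_mul _ _).trans ?_
      have h1 := totalDegree_mul (C (2 * i : ℚ)) (curveIterDeriv F P i)
      rw [totalDegree_C] at h1
      have h2 := totalDegree_curveDeriv_le F (pderiv 1 F)
      have h3 := totalDegree_pderiv_le 1 F
      nlinarith

theorem hasDerivAt_aeval_curve {F : MvPolynomial (Fin 2) ℚ} {φ : ℝ → ℝ} {x : ℝ}
    (hq : (aeval ![x, φ x] (pderiv 1 F) : ℝ) ≠ 0)
    (hφ : HasDerivAt φ
      (-(aeval ![x, φ x] (pderiv 0 F) : ℝ) / aeval ![x, φ x] (pderiv 1 F)) x)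
    (P : MvPolynomial (Fin 2) ℚ) : HasDerivAt (fun t => aeval ![t, φ t] P)
      ((aeval ![x, φ x] (curveDeriv F P) : ℝ) / aeval ![x, φ x] (pderiv 1 F)) x := by
  refine (hasDerivAt_aeval hφ P).congr_deriv ?_
  simp only [curveDeriv, map_sub, map_mul]
  field_simp
  ring

theorem iteratedDeriv_aeval_curve {F : MvPolynomial (Fin 2) ℚ} {φ : ℝ → ℝ} {a b : ℝ}
    (hq : ∀ x ∈ Ioo a b, (aeval ![x, φ x] (pderiv 1 F) : ℝ) ≠ 0)
    (hφ : ∀ x ∈ Ioo a b, HasDerivAt φ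
      (-(aeval ![x, φ x] (pderiv 0 F) : ℝ) / aeval ![x, φ x] (pderiv 1 F)) x)
    (P : MvPolynomial (Fin 2) ℚ) (i : ℕ) :
    ∀ x ∈ Ioo a b, iteratedDeriv i (fun t => (aeval ![t, φ t] P : ℝ)) x =
      aeval ![x, φ x] (curveIterDeriv F P i) / aeval ![x, φ x] (pderiv 1 F) ^ (2 * i) := by
  have hD : ∀ Q : MvPolynomial (Fin 2) ℚ, ∀ x ∈ Ioo a b, HasDerivAt (fun t => aeval ![t, φ t] Q)
      ((aeval ![x, φ x] (curveDeriv F Q) : ℝ) / aeval ![x, φ x] (pderiv 1 F)) x :=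
    fun Q x hx => hasDerivAt_aeval_curve (hq x hx) (hφ x hx) Q
  induction i with
  | zero => intro x hx; simp [curveIterDeriv]
  | succ i ih =>
    intro x hx
    rw [iteratedDeriv_succ]
    have hev : iteratedDeriv i (fun t => (aeval ![t, φ t] P : ℝ)) =ᶠ[nhds x]
        fun x => aeval ![x, φ x] (curveIterDeriv F P i) /
          aeval ![x, φ x] (pderiv 1 F) ^ (2 * i) :=
      Filter.eventuallyEq_of_mem (isOpen_Ioo.mem_nhds hx) ih
    rw [hev.deriv_eq]
    have hqx := hq x hx
    have h := (hD (curveIterDeriv F P i) x hx).div ((hD (pderiv 1 F) x hx).pow (2 * i))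
      (pow_ne_zero _ hqx)
    refine h.deriv.trans ?_
    simp only [curveIterDeriv, map_sub, map_mul, algHom_C, Pi.pow_apply]
    rcases i with _ | i
    · simp
      field_simp
    · have e : 2 * (i + 1) - 1 = 2 * i + 1 := by omega
      rw [e]
      push_cast
      simp only [map_ofNat]
      field_simp
      ring

/-- The numerator of the Wronskian of the restrictions of `m 0, …, m (k - 1)` to `F = 0`. -/
noncomputable def curveWronskian (F : MvPolynomial (Fin 2) ℚ) (m : ℕ → MvPolynomial (Fin 2) ℚ)
    (k : ℕ) : MvPolynomial (Fin 2) ℚ :=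
  Matrix.det (Matrix.of fun i j : Fin k => curveIterDeriv F (m j) i)

theorem totalDegree_curveWronskian_le {F : MvPolynomial (Fin 2) ℚ}
    {m : ℕ → MvPolynomial (Fin 2) ℚ} {M : ℕ} (hm : ∀ j, (m j).totalDegree ≤ M) (k : ℕ) :
    (curveWronskian F m k).totalDegree ≤ k * (M + 2 * k * F.totalDegree) := by
  unfold curveWronskian
  rw [Matrix.det_apply]
  refine totalDegree_finsetSum_le fun σ _ => ?_
  refine (totalDegree_smul_le _ _).trans ?_
  refine (totalDegree_finsetProd _ _).trans ?_
  refine (Finset.sum_le_card_nsmul _ _ (M + 2 * k * F.totalDegree) fun i _ => ?_).trans ?_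
  · refine (totalDegree_curveIterDeriv_le _ _ _).trans ?_
    gcongr
    · exact hm _
    · exact (σ i).2.le
  · simp

theorem wronskian_aeval_curve {F : MvPolynomial (Fin 2) ℚ} {φ : ℝ → ℝ} {a b : ℝ}
    (hq : ∀ x ∈ Ioo a b, (aeval ![x, φ x] (pderiv 1 F) : ℝ) ≠ 0)
    (hφ : ∀ x ∈ Ioo a b, HasDerivAt φ
      (-(aeval ![x, φ x] (pderiv 0 F) : ℝ) / aeval ![x, φ x] (pderiv 1 F)) x)
    (m : ℕ → MvPolynomial (Fin 2) ℚ) (k : ℕ) {x : ℝ} (hx : x ∈ Ioo a b) :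
    wronskian k (fun j t => (aeval ![t, φ t] (m j) : ℝ)) x =
      (∏ i : Fin k, ((aeval ![x, φ x] (pderiv 1 F) : ℝ) ^ (2 * (i : ℕ)))⁻¹) *
        aeval ![x, φ x] (curveWronskian F m k) := by
  unfold wronskian curveWronskian
  rw [AlgHom.map_det, ← Matrix.det_mul_column]
  congr 1
  ext i j
  simp only [Matrix.of_apply, AlgHom.mapMatrix_apply, Matrix.map_apply]
  rw [iteratedDeriv_aeval_curve hq hφ _ _ x hx, div_eq_inv_mul]

/-- The graph of `φ` over `(a, b)` is an arc of the curve `F = 0` inside the box `(-2, 2)²`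
avoiding the curve `G = 0`. -/
structure IsArc (F G : MvPolynomial (Fin 2) ℚ) (a b : ℝ) (φ : ℝ → ℝ) : Prop where
  lt : a < b
  cont : ContinuousOn φ (Ioo a b)
  box : ∀ x ∈ Ioo a b, |x| < 2 ∧ |φ x| < 2
  zero : ∀ x ∈ Ioo a b, (aeval ![x, φ x] F : ℝ) = 0
  ne : ∀ x ∈ Ioo a b, (aeval ![x, φ x] G : ℝ) ≠ 0

theorem aeval_ne_zero_of_dvd {P G : MvPolynomial (Fin 2) ℚ} (h : P ∣ G) {z : Fin 2 → ℝ}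
    (hG : (aeval z G : ℝ) ≠ 0) : (aeval z P : ℝ) ≠ 0 := by
  obtain ⟨Q, rfl⟩ := h
  rw [map_mul] at hG
  exact left_ne_zero_of_mul hG

/-- Near a point with `F_y ≠ 0` the curve `F = 0` is a graph. -/
theorem exists_isArc_eventually {F G : MvPolynomial (Fin 2) ℚ} (hqG : pderiv 1 F ∣ G)
    {u : ℝ × ℝ} (hbox : |u.1| < 2 ∧ |u.2| < 2) (hF : (aeval ![u.1, u.2] F : ℝ) = 0)
    (hG : (aeval ![u.1, u.2] G : ℝ) ≠ 0) :
    ∃ a b ψ, IsArc F G a b ψ ∧ u.1 ∈ Ioo a b ∧ DifferentiableAt ℝ ψ u.1 ∧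
      ∀ᶠ v : ℝ × ℝ in nhds u, (aeval ![v.1, v.2] F : ℝ) = 0 → v.1 ∈ Ioo a b ∧ ψ v.1 = v.2 := by
  have hq := aeval_ne_zero_of_dvd hqG hG
  have hd := hasStrictFDerivAt_aeval F u
  set f' := (aeval ![u.1, u.2] (pderiv 0 F) : ℝ) • ContinuousLinearMap.fst ℝ ℝ ℝ +
        (aeval ![u.1, u.2] (pderiv 1 F) : ℝ) • ContinuousLinearMap.snd ℝ ℝ ℝ with hf'
  have hinv : (f' ∘L .inr ℝ ℝ ℝ).IsInvertible := by
    refine ⟨ContinuousLinearEquiv.unitsEquivAut ℝ (Units.mk0 _ hq), ?_⟩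
    ext
    simp [hf']
  set ψ := hd.implicitFunctionOfProdDomain hinv with hψ
  have hψd := hd.hasStrictFDerivAt_implicitFunctionOfProdDomain hinv
  have hψt := hd.tendsto_implicitFunctionOfProdDomain hinv
  have hev1 := hd.eventually_apply_eq_iff_implicitFunctionOfProdDomain hinv
  have hev2 := hd.eventually_apply_implicitFunctionOfProdDomain hinv
  obtain ⟨K, s, hs, hLip⟩ := hψd.exists_lipschitzOnWith
  have hψu : Filter.Tendsto (fun x => (x, ψ x)) (nhds u.1) (nhds u) :=
    Filter.tendsto_id.prodMk_nhds hψt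
  have hO : ∀ᶠ v : ℝ × ℝ in nhds u, (|v.1| < 2 ∧ |v.2| < 2) ∧ (aeval ![v.1, v.2] G : ℝ) ≠ 0 := by
    refine Filter.Eventually.and (Filter.Eventually.and ?_ ?_) ?_
    · exact continuous_fst.abs.continuousAt.eventually (gt_mem_nhds hbox.1)
    · exact continuous_snd.abs.continuousAt.eventually (gt_mem_nhds hbox.2)
    · exact (continuous_aeval_pair G).continuousAt.eventually_ne hG
  have hall := (hψu.eventually hO).and (hev2.and (Filter.eventually_mem_set.mpr hs))
  obtain ⟨ε, hε, hball⟩ := Metric.eventually_nhds_iff_ball.mp hall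
  rw [Real.ball_eq_Ioo] at hball
  refine ⟨u.1 - ε, u.1 + ε, ψ, ⟨by linarith, ?_, ?_, ?_, ?_⟩, ⟨by linarith, by linarith⟩,
    hψd.hasFDerivAt.differentiableAt, ?_⟩
  · exact hLip.continuousOn.mono fun x hx => (hball x hx).2.2
  · exact fun x hx => (hball x hx).1.1
  · exact fun x hx => ((hball x hx).2.1).trans hF
  · exact fun x hx => (hball x hx).1.2
  · have hI : ∀ᶠ v : ℝ × ℝ in nhds u, v.1 ∈ Ioo (u.1 - ε) (u.1 + ε) :=
      continuous_fst.continuousAt.eventually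
        (isOpen_Ioo.mem_nhds ⟨by linarith, by linarith⟩)
    filter_upwards [hev1, hI] with v hv hvI hvF
    exact ⟨hvI, hv.mp (hvF.trans hF.symm)⟩

namespace IsArc

variable {F G : MvPolynomial (Fin 2) ℚ} {a b a' b' : ℝ} {φ ψ : ℝ → ℝ}

theorem tendsto_graph (h : IsArc F G a b φ) {x : ℝ} (hx : x ∈ Ioo a b) :
    Filter.Tendsto (fun t => (t, φ t)) (nhds x) (nhds (x, φ x)) :=
  Filter.tendsto_id.prodMk_nhds (h.cont.continuousAt (isOpen_Ioo.mem_nhds hx))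

theorem hasDerivAt (hqG : pderiv 1 F ∣ G) (h : IsArc F G a b φ) {x : ℝ} (hx : x ∈ Ioo a b) :
    HasDerivAt φ (-(aeval ![x, φ x] (pderiv 0 F) : ℝ) / aeval ![x, φ x] (pderiv 1 F)) x := by
  obtain ⟨a₁, b₁, ψ, -, -, hd, hev⟩ :=
    exists_isArc_eventually hqG (u := (x, φ x)) (h.box x hx) (h.zero x hx) (h.ne x hx)
  have hO : ∀ᶠ t in nhds x, t ∈ Ioo a b := isOpen_Ioo.mem_nhds hx
  have heq : φ =ᶠ[nhds x] ψ := by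
    filter_upwards [(h.tendsto_graph hx).eventually hev, hO] with t ht htI
    exact (ht (h.zero t htI)).2.symm
  have hdφ : HasDerivAt φ (deriv φ x) x :=
    (heq.differentiableAt_iff.mpr hd).hasDerivAt
  have h0 : HasDerivAt (fun t => (aeval ![t, φ t] F : ℝ)) 0 x := by
    refine (hasDerivAt_const x (0 : ℝ)).congr_of_eventuallyEq ?_
    filter_upwards [hO] with t ht using h.zero t ht
  have h1 := (hasDerivAt_aeval hdφ F).unique h0
  have hq := aeval_ne_zero_of_dvd hqG (h.ne x hx)
  convert hdφ using 1
  rw [div_eq_iff hq]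
  linarith

theorem contDiffOn (hqG : pderiv 1 F ∣ G) (h : IsArc F G a b φ) : ContDiffOn ℝ ∞ φ (Ioo a b) := by
  refine contDiffOn_infty.mpr fun n => ?_
  induction n with
  | zero => exact contDiffOn_zero.mpr h.cont
  | succ n ih =>
    refine (contDiffOn_succ_iff_deriv_of_isOpen isOpen_Ioo).mpr
      ⟨fun x hx => (h.hasDerivAt hqG hx).differentiableAt.differentiableWithinAt,
        fun hn => absurd hn (WithTop.coe_ne_top (a := (n : ℕ∞))), ?_⟩
    refine ((contDiffOn_aeval_graph ih (pderiv 0 F)).neg.div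
      (contDiffOn_aeval_graph ih (pderiv 1 F)) fun x hx =>
      aeval_ne_zero_of_dvd hqG (h.ne x hx)).congr fun x hx => (h.hasDerivAt hqG hx).deriv

theorem contDiffOn_aeval (hqG : pderiv 1 F ∣ G) (h : IsArc F G a b φ) (P : MvPolynomial (Fin 2) ℚ) :
    ContDiffOn ℝ ∞ (fun t => (aeval ![t, φ t] P : ℝ)) (Ioo a b) :=
  contDiffOn_aeval_graph (h.contDiffOn hqG) P

/-- Two arcs through a common point agree. -/
theorem eqOn (hqG : pderiv 1 F ∣ G) (h : IsArc F G a b φ) (h' : IsArc F G a' b' ψ) {c : ℝ}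
    (hc : c ∈ Ioo a b) (hc' : c ∈ Ioo a' b') (he : φ c = ψ c) {x : ℝ} (hx : x ∈ Ioo a b)
    (hx' : x ∈ Ioo a' b') : φ x = ψ x := by
  have hpre : IsPreconnected (Ioo a b ∩ Ioo a' b') := by
    rw [Set.Ioo_inter_Ioo]; exact isPreconnected_Ioo
  by_contra hne
  have hO : IsOpen (Ioo a b ∩ Ioo a' b') := isOpen_Ioo.inter isOpen_Ioo
  have hU : IsOpen {t ∈ Ioo a b ∩ Ioo a' b' | φ t = ψ t} := by
    rw [isOpen_iff_mem_nhds]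
    rintro t ⟨⟨ht, ht'⟩, hte⟩
    obtain ⟨a₁, b₁, χ, -, -, -, hev⟩ :=
      exists_isArc_eventually hqG (u := (t, φ t)) (h.box t ht) (h.zero t ht) (h.ne t ht)
    have hev' := hev
    rw [hte] at hev'
    filter_upwards [(h.tendsto_graph ht).eventually hev, (h'.tendsto_graph ht').eventually hev',
      hO.mem_nhds ⟨ht, ht'⟩] with y hy hy' hyI
    exact ⟨hyI, (hy (h.zero y hyI.1)).2.symm.trans (hy' (h'.zero y hyI.2)).2⟩
  have hV : IsOpen {t ∈ Ioo a b ∩ Ioo a' b' | φ t ≠ ψ t} := by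
    have hcont : ContinuousOn (fun t => φ t - ψ t) (Ioo a b ∩ Ioo a' b') :=
      (h.cont.mono Set.inter_subset_left).sub (h'.cont.mono Set.inter_subset_right)
    have := hcont.isOpen_inter_preimage hO (isOpen_ne (x := (0 : ℝ)))
    convert this using 1
    ext t
    simp [sub_eq_zero]
  obtain ⟨z, hz, hz1, hz2⟩ := hpre _ _ hU hV
    (fun t ht => (em (φ t = ψ t)).imp (fun e => ⟨ht, e⟩) fun e => ⟨ht, e⟩)
    ⟨c, ⟨hc, hc'⟩, ⟨hc, hc'⟩, he⟩ ⟨x, ⟨hx, hx'⟩, ⟨hx, hx'⟩, hne⟩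
  exact hz2.2 hz1.2

end IsArc

theorem IsArc.glue {F G : MvPolynomial (Fin 2) ℚ} {a b a' b' : ℝ} {φ ψ : ℝ → ℝ}
    (hqG : pderiv 1 F ∣ G) (h : IsArc F G a b φ) (h' : IsArc F G a' b' ψ) {c : ℝ}
    (hc : c ∈ Ioo a b) (hc' : c ∈ Ioo a' b') (he : φ c = ψ c) :
    ∃ χ, IsArc F G (min a a') (max b b') χ ∧ ∀ x ∈ Ioo a b, χ x = φ x := by
  classical
  have hcover : ∀ x ∈ Ioo (min a a') (max b b'), x ∈ Ioo a b ∨ x ∈ Ioo a' b' := by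
    rintro x ⟨h1, h2⟩
    rcases le_or_gt x c with hxc | hxc
    · rcases min_lt_iff.mp h1 with h3 | h3
      · exact Or.inl ⟨h3, hxc.trans_lt hc.2⟩
      · exact Or.inr ⟨h3, hxc.trans_lt hc'.2⟩
    · rcases lt_max_iff.mp h2 with h3 | h3
      · exact Or.inl ⟨hc.1.trans hxc, h3⟩
      · exact Or.inr ⟨hc'.1.trans hxc, h3⟩
  set χ : ℝ → ℝ := fun x => if x ∈ Ioo a b then φ x else ψ x with hχ
  have e1 : ∀ x ∈ Ioo a b, χ x = φ x := fun x hx => if_pos hx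
  have e2 : ∀ x ∈ Ioo a' b', χ x = ψ x := by
    intro x hx
    by_cases hxI : x ∈ Ioo a b
    · rw [e1 x hxI]; exact h.eqOn hqG h' hc hc' he hxI hx
    · exact if_neg hxI
  refine ⟨χ, ⟨(min_le_left _ _).trans_lt (h.lt.trans_le (le_max_left _ _)), ?_, ?_, ?_, ?_⟩, e1⟩
  · intro x hx
    refine ContinuousAt.continuousWithinAt ?_
    rcases hcover x hx with hx | hx
    · exact (h.cont.continuousAt (isOpen_Ioo.mem_nhds hx)).congr
        (Filter.eventuallyEq_of_mem (isOpen_Ioo.mem_nhds hx) fun y hy => (e1 y hy).symm)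
    · exact (h'.cont.continuousAt (isOpen_Ioo.mem_nhds hx)).congr
        (Filter.eventuallyEq_of_mem (isOpen_Ioo.mem_nhds hx) fun y hy => (e2 y hy).symm)
  · intro x hx
    rcases hcover x hx with hx | hx
    · rw [e1 x hx]; exact h.box x hx
    · rw [e2 x hx]; exact h'.box x hx
  · intro x hx
    rcases hcover x hx with hx | hx
    · rw [e1 x hx]; exact h.zero x hx
    · rw [e2 x hx]; exact h'.zero x hx
  · intro x hx
    rcases hcover x hx with hx | hx
    · rw [e1 x hx]
      exact h.ne x hx
    · rw [e2 x hx]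
      apply h'.ne
      exact hx

/-- An arc containing every arc it meets. -/
structure IsMaxArc (F G : MvPolynomial (Fin 2) ℚ) (a b : ℝ) (φ : ℝ → ℝ) : Prop
    extends IsArc F G a b φ where
  maximal : ∀ a' b' ψ, IsArc F G a' b' ψ → ∀ c ∈ Ioo a b, c ∈ Ioo a' b' → φ c = ψ c →
    Ioo a' b' ⊆ Ioo a b

theorem exists_isMaxArc {F G : MvPolynomial (Fin 2) ℚ} (hqG : pderiv 1 F ∣ G)
    {u : ℝ × ℝ} (hbox : |u.1| < 2 ∧ |u.2| < 2) (hF : (aeval ![u.1, u.2] F : ℝ) = 0)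
    (hG : (aeval ![u.1, u.2] G : ℝ) ≠ 0) :
    ∃ a b φ, IsMaxArc F G a b φ ∧ u.1 ∈ Ioo a b ∧ φ u.1 = u.2 := by
  classical
  let T : ℝ → ℝ → (ℝ → ℝ) → Prop := fun a b ψ =>
    IsArc F G a b ψ ∧ u.1 ∈ Ioo a b ∧ ψ u.1 = u.2
  let I : Set ℝ := {x | ∃ ψ a b, T a b ψ ∧ x ∈ Ioo a b}
  let φ : ℝ → ℝ := fun x => if h : x ∈ I then h.choose x else 0
  have hφ : ∀ a b ψ, T a b ψ → ∀ x ∈ Ioo a b, φ x = ψ x := by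
    intro a b ψ hT x hx
    have hxI : x ∈ I := ⟨ψ, a, b, hT, hx⟩
    obtain ⟨a', b', hT', hx'⟩ := hxI.choose_spec
    have : φ x = hxI.choose x := dif_pos hxI
    rw [this]
    exact hT'.1.eqOn hqG hT.1 hT'.2.1 hT.2.1 (hT'.2.2.trans hT.2.2.symm) hx' hx
  have huI : u.1 ∈ I := by
    obtain ⟨a, b, ψ, h, hu, -, hev⟩ := exists_isArc_eventually hqG hbox hF hG
    exact ⟨ψ, a, b, ⟨h, hu, (hev.self_of_nhds hF).2⟩, hu⟩
  have hbd : ∀ x ∈ I, -2 ≤ x ∧ x ≤ 2 := by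
    rintro x ⟨ψ, a, b, hT, hx⟩
    exact abs_le.mp (hT.1.box x hx).1.le
  have hA : BddAbove I := ⟨2, fun x hx => (hbd x hx).2⟩
  have hB : BddBelow I := ⟨-2, fun x hx => (hbd x hx).1⟩
  have hI : Ioo (sInf I) (sSup I) = I := by
    ext x
    constructor
    · rintro ⟨h1, h2⟩
      rcases le_or_gt u.1 x with hux | hux
      · obtain ⟨y, ⟨ψ, a, b, hT, hy⟩, hxy⟩ := exists_lt_of_lt_csSup ⟨_, huI⟩ h2
        exact ⟨ψ, a, b, hT, hT.2.1.1.trans_le hux, hxy.trans hy.2⟩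
      · obtain ⟨y, ⟨ψ, a, b, hT, hy⟩, hxy⟩ := exists_lt_of_csInf_lt ⟨_, huI⟩ h1
        exact ⟨ψ, a, b, hT, hy.1.trans hxy, hux.trans hT.2.1.2⟩
    · rintro ⟨ψ, a, b, hT, hx⟩
      obtain ⟨y, hy1, hy2⟩ := exists_between hx.1
      obtain ⟨z, hz1, hz2⟩ := exists_between hx.2
      exact ⟨(csInf_le hB ⟨ψ, a, b, hT, hy1, hy2.trans hx.2⟩).trans_lt hy2,
        hz1.trans_le (le_csSup hA ⟨ψ, a, b, hT, hx.1.trans hz1, hz2⟩)⟩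
  refine ⟨sInf I, sSup I, φ, ⟨⟨?_, ?_, ?_, ?_, ?_⟩, ?_⟩, by rwa [hI], ?_⟩
  · have : u.1 ∈ Ioo (sInf I) (sSup I) := by rwa [hI]
    exact this.1.trans this.2
  · rw [hI]
    rintro x ⟨ψ, a, b, hT, hx⟩
    exact ((hT.1.cont.continuousAt (isOpen_Ioo.mem_nhds hx)).congr
      (Filter.eventuallyEq_of_mem (isOpen_Ioo.mem_nhds hx)
        fun y hy => (hφ a b ψ hT y hy).symm)).continuousWithinAt
  · rw [hI]
    rintro x ⟨ψ, a, b, hT, hx⟩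
    rw [hφ a b ψ hT x hx]; exact hT.1.box x hx
  · rw [hI]
    rintro x ⟨ψ, a, b, hT, hx⟩
    rw [hφ a b ψ hT x hx]; exact hT.1.zero x hx
  · rw [hI]
    rintro x ⟨ψ, a, b, hT, hx⟩
    rw [hφ a b ψ hT x hx]; exact hT.1.ne x hx
  · rw [hI]
    rintro a' b' ψ' h' c ⟨ψ, a, b, hT, hc⟩ hc' he x hx
    rw [hφ a b ψ hT c hc] at he
    obtain ⟨χ, hχ, hχe⟩ := hT.1.glue hqG h' hc hc' he
    have hsub : ∀ y ∈ Ioo a b, y ∈ Ioo (min a a') (max b b') := fun y hy =>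
      ⟨(min_le_left _ _).trans_lt hy.1, hy.2.trans_le (le_max_left _ _)⟩
    exact ⟨χ, _, _, ⟨hχ, hsub _ hT.2.1, (hχe _ hT.2.1).trans hT.2.2⟩,
      (min_le_right _ _).trans_lt hx.1, hx.2.trans_le (le_max_right _ _)⟩
  · obtain ⟨ψ, a, b, hT, hx⟩ := huI
    rw [hφ a b ψ hT _ hx]; exact hT.2.2

theorem tendsto_aeval_graph (P : MvPolynomial (Fin 2) ℚ) {φ : ℝ → ℝ} {l : Filter ℝ} {p : ℝ × ℝ}
    (h : Filter.Tendsto (fun x => (x, φ x)) l (nhds p)) :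
    Filter.Tendsto (fun x => (aeval ![x, φ x] P : ℝ)) l (nhds (aeval ![p.1, p.2] P)) := by
  have h1 := (continuous_aeval_pair P).tendsto p
  generalize (aeval ![p.1, p.2] P : ℝ) = y at *
  have h2 := h1.comp h
  simpa only [Function.comp_def] using h2

namespace IsMaxArc

variable {F G : MvPolynomial (Fin 2) ℚ} {a b a' b' : ℝ} {φ ψ : ℝ → ℝ}

theorem tendsto_zero (hqG : pderiv 1 F ∣ G) (hXG : 4 - X 0 ^ 2 ∣ G) (hYG : 4 - X 1 ^ 2 ∣ G)
    (h : IsMaxArc F G a b φ) {l : Filter ℝ} {e : ℝ} (hl : l ≤ nhds e) (he : e ∉ Ioo a b)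
    (hlI : ∀ᶠ x in l, x ∈ Ioo a b) :
    Filter.Tendsto (fun x => (aeval ![x, φ x] G : ℝ)) l (nhds 0) := by
  rw [Filter.tendsto_iff_ultrafilter]
  intro U hU
  have hUI : ∀ᶠ x in (U : Filter ℝ), x ∈ Ioo a b := hU hlI
  have hK : IsCompact (Set.Icc (-2 : ℝ) 2 ×ˢ Set.Icc (-2 : ℝ) 2) :=
    isCompact_Icc.prod isCompact_Icc
  obtain ⟨p, hp, hUp⟩ := hK.ultrafilter_le_nhds' (U.map fun x => (x, φ x)) (by
    rw [Ultrafilter.mem_map]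
    filter_upwards [hUI] with x hx
    have := h.box x hx
    exact ⟨abs_le.mp this.1.le, abs_le.mp this.2.le⟩)
  have hUp' : Filter.Tendsto (fun x => (x, φ x)) U (nhds p) := hUp
  have hpe : p.1 = e :=
    tendsto_nhds_unique ((continuous_fst.tendsto p).comp hUp') (hU.trans hl)
  have hlim : ∀ P : MvPolynomial (Fin 2) ℚ,
      Filter.Tendsto (fun x => (aeval ![x, φ x] P : ℝ)) U (nhds (aeval ![p.1, p.2] P)) :=
    fun P => tendsto_aeval_graph P hUp'
  have hF : (aeval ![p.1, p.2] F : ℝ) = 0 := by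
    refine tendsto_nhds_unique (hlim F) (tendsto_const_nhds.congr' ?_)
    filter_upwards [hUI] with x hx using (h.zero x hx).symm
  have hG : (aeval ![p.1, p.2] G : ℝ) = 0 := by
    by_contra hG
    have h1 : |p.1| < 2 := by
      refine lt_of_le_of_ne (abs_le.mpr hp.1) fun h2 => ?_
      apply aeval_ne_zero_of_dvd hXG hG
      simp [← sq_abs p.1, h2]; norm_num
    have h2 : |p.2| < 2 := by
      refine lt_of_le_of_ne (abs_le.mpr hp.2) fun h2 => ?_
      apply aeval_ne_zero_of_dvd hYG hG
      simp [← sq_abs p.2, h2]; norm_num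
    obtain ⟨a₁, b₁, ψ, hψ, hpI, -, hev⟩ := exists_isArc_eventually hqG ⟨h1, h2⟩ hF hG
    obtain ⟨x, hx, hxI⟩ := ((hUp'.eventually hev).and hUI).exists
    have hx' := hx (h.zero x hxI)
    have := h.maximal _ _ _ hψ x hxI hx'.1 hx'.2.symm hpI
    rw [hpe] at this
    exact he this
  have hGlim := hlim G
  rw [hG] at hGlim
  exact hGlim

theorem exists_curveDeriv_eq_zero (hqG : pderiv 1 F ∣ G) (hXG : 4 - X 0 ^ 2 ∣ G)
    (hYG : 4 - X 1 ^ 2 ∣ G) (h : IsMaxArc F G a b φ) :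
    (∃ c ∈ Ioo a b, (aeval ![c, φ c] (curveDeriv F G) : ℝ) = 0) ∧ ¬ F ∣ curveDeriv F G := by
  have hq : ∀ x ∈ Ioo a b, (aeval ![x, φ x] (pderiv 1 F) : ℝ) ≠ 0 :=
    fun x hx => aeval_ne_zero_of_dvd hqG (h.ne x hx)
  have hd : ∀ x ∈ Ioo a b, HasDerivAt (fun t => aeval ![t, φ t] G)
      ((aeval ![x, φ x] (curveDeriv F G) : ℝ) / aeval ![x, φ x] (pderiv 1 F)) x :=
    fun x hx => hasDerivAt_aeval_curve (hq x hx) (h.hasDerivAt hqG hx) G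
  have hta := h.tendsto_zero hqG hXG hYG (nhdsWithin_le_nhds (a := a) (s := Set.Ioi a))
    (by simp) (Ioo_mem_nhdsGT h.lt)
  have htb := h.tendsto_zero hqG hXG hYG (nhdsWithin_le_nhds (a := b) (s := Set.Iio b))
    (by simp) (Ioo_mem_nhdsLT h.lt)
  constructor
  · obtain ⟨c, hc, h0⟩ := exists_hasDerivAt_eq_zero' h.lt hta htb hd
    exact ⟨c, hc, (div_eq_zero_iff.mp h0).resolve_right (hq c hc)⟩
  · rintro ⟨Q, hQ⟩
    have hd0 : ∀ x ∈ Ioo a b, HasDerivAt (fun t => (aeval ![t, φ t] G : ℝ)) 0 x := by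
      intro x hx
      have := hd x hx
      rwa [hQ, map_mul, h.zero x hx, zero_mul, zero_div] at this
    obtain ⟨c, hc⟩ := Set.nonempty_Ioo.mpr h.lt
    have hconst : ∀ x ∈ Ioo a b, (aeval ![x, φ x] G : ℝ) = aeval ![c, φ c] G := fun x hx =>
      isOpen_Ioo.is_const_of_deriv_eq_zero isPreconnected_Ioo
        (fun x hx => (hd0 x hx).differentiableAt.differentiableWithinAt)
        (fun x hx => (hd0 x hx).deriv) hx hc
    have : Filter.Tendsto (fun x => (aeval ![x, φ x] G : ℝ)) (nhdsWithin a (Set.Ioi a))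
        (nhds (aeval ![c, φ c] G)) := by
      refine tendsto_const_nhds.congr' ?_
      filter_upwards [Ioo_mem_nhdsGT h.lt] with x hx using (hconst x hx).symm
    exact h.ne c hc (tendsto_nhds_unique this hta)

theorem graph_subset (hqG : pderiv 1 F ∣ G) (h : IsMaxArc F G a b φ) (h' : IsArc F G a' b' ψ)
    {c : ℝ} (hc : c ∈ Ioo a b) (hc' : c ∈ Ioo a' b') (he : φ c = ψ c) {x : ℝ}
    (hx : x ∈ Ioo a' b') : x ∈ Ioo a b ∧ φ x = ψ x :=
  have hxI := h.maximal _ _ _ h' c hc hc' he hx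
  ⟨hxI, h.eqOn hqG h' hc hc' he hxI hx⟩

end IsMaxArc

/-- A large family of monomials of degree at most `M` that is linearly independent modulo `F`. -/
theorem exists_linearIndependent_monomials {F : MvPolynomial (Fin 2) ℚ} (hF : F ≠ 0) (M : ℕ) :
    ∃ (s : ℕ) (e : ℕ → ℕ × ℕ), (∀ j, (e j).1 + (e j).2 ≤ M) ∧
      2 * s ≤ (M + 1) * (M + 2) ∧
      (M + 1) * (M + 2) ≤ 2 * s + (M + 1 - F.totalDegree) * (M + 2 - F.totalDegree) ∧
      LinearIndependent ℚ fun j : Fin s =>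
        Ideal.Quotient.mkₐ ℚ (Ideal.span {F}) (X 0 ^ (e j).1 * X 1 ^ (e j).2) := by
  classical
  set π := (Ideal.Quotient.mkₐ ℚ (Ideal.span {F})).toLinearMap with hπ
  set V := restrictTotalDegree (Fin 2) ℚ M with hV
  let ι := {n : Fin 2 →₀ ℕ | (n.sum fun _ e => e) ≤ M}
  let v : ι → MvPolynomial (Fin 2) ℚ ⧸ Ideal.span {F} := fun n => π (monomial n.1 1)
  have hspan : Submodule.span ℚ (Set.range v) = V.map π := by
    have : V = Submodule.span ℚ ((monomial · (1 : ℚ)) '' ι) := restrictSupport_eq_span ℚ ι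
    rw [this, Submodule.map_span, ← Set.image_comp]
    congr 1
    ext y
    simp [v]
  have hfinι : Finite ι := by
    have : Module.Finite ℚ (restrictSupport ℚ ι) :=
      inferInstanceAs (Module.Finite ℚ (restrictTotalDegree (Fin 2) ℚ M))
    exact Module.Finite.finite_basis (basisRestrictSupport ℚ ι)
  obtain ⟨κ, a, ha, hsp, hli⟩ := exists_linearIndependent' ℚ v
  have : Finite κ := Finite.of_injective a ha
  have : Fintype κ := Fintype.ofFinite κ
  let ε := Fintype.equivFin κ
  have hcard : Fintype.card κ = Module.finrank ℚ (V.map π) := by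
    rw [← hspan, ← hsp]
    exact (finrank_span_eq_card hli).symm
  have h1 := LinearMap.finrank_range_add_finrank_ker (π.domRestrict V)
  rw [LinearMap.range_domRestrict, ← hcard] at h1
  have h2 := two_mul_finrank_restrictTotalDegree M
  rw [← hV] at h2
  have h3 : 2 * Module.finrank ℚ (LinearMap.ker (π.domRestrict V)) ≤
      (M + 1 - F.totalDegree) * (M + 2 - F.totalDegree) := by
    have hdvd : ∀ x : LinearMap.ker (π.domRestrict V), ∃ c, F * c = x.1.1 := by
      intro x
      have hx : π x.1.1 = 0 := x.2
      have : x.1.1 ∈ Ideal.span {F} := Ideal.Quotient.eq_zero_iff_mem.mp hx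
      obtain ⟨c, hc⟩ := Ideal.mem_span_singleton.mp this
      exact ⟨c, hc.symm⟩
    have hmem : ∀ x : LinearMap.ker (π.domRestrict V), x.1.1.totalDegree ≤ M := fun x =>
      (mem_restrictTotalDegree _ _ _).mp x.1.2
    rcases le_or_gt F.totalDegree M with hd | hd
    · have hle : (LinearMap.ker (π.domRestrict V)).map V.subtype ≤
          (restrictTotalDegree (Fin 2) ℚ (M - F.totalDegree)).map (LinearMap.mulLeft ℚ F) := by
        rintro _ ⟨x, hx, rfl⟩
        obtain ⟨c, hc⟩ := hdvd ⟨x, hx⟩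
        have hm := hmem ⟨x, hx⟩
        refine ⟨c, ?_, hc⟩
        simp only [SetLike.mem_coe, mem_restrictTotalDegree]
        by_cases hc0 : c = 0
        · simp [hc0]
        · rw [← hc, totalDegree_mul_of_isDomain hF hc0] at hm
          omega
      have h4 := Submodule.finrank_mono hle
      rw [← (Submodule.equivMapOfInjective _ (Submodule.subtype_injective V) _).finrank_eq,
        ← (Submodule.equivMapOfInjective _ (show Function.Injective (LinearMap.mulLeft ℚ F) from
          fun a b h => mul_left_cancel₀ hF (by simpa using h)) _).finrank_eq] at h4
      have h5 := two_mul_finrank_restrictTotalDegree (M - F.totalDegree)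
      have e1 : M + 1 - F.totalDegree = M - F.totalDegree + 1 := by omega
      have e2 : M + 2 - F.totalDegree = M - F.totalDegree + 2 := by omega
      rw [e1, e2]
      omega
    · have : LinearMap.ker (π.domRestrict V) = ⊥ := by
        rw [Submodule.eq_bot_iff]
        intro x hx
        obtain ⟨c, hc⟩ := hdvd ⟨x, hx⟩
        have hm := hmem ⟨x, hx⟩
        by_cases hc0 : c = 0
        · exact Subtype.ext (by simpa [hc0] using hc.symm)
        · rw [← hc, totalDegree_mul_of_isDomain hF hc0] at hm
          omega
      rw [this]
      simp
  let n : ℕ → Fin 2 →₀ ℕ := fun j =>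
    if h : j < Fintype.card κ then (a (ε.symm ⟨j, h⟩)).1 else 0
  refine ⟨Fintype.card κ, fun j => (n j 0, n j 1), fun j => ?_, by omega, by omega, ?_⟩
  · by_cases h : j < Fintype.card κ
    · have := (a (ε.symm ⟨j, h⟩)).2
      simp only [ι, Set.mem_ofPred_eq] at this
      rw [Finsupp.sum_fintype _ _ (fun _ => rfl), Fin.sum_univ_two] at this
      simpa [n, h] using this
    · simp [n, h]
  · have h6 := hli.comp ε.symm ε.symm.injective
    have hfun : (fun j : Fin (Fintype.card κ) => Ideal.Quotient.mkₐ ℚ (Ideal.span {F})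
        (X 0 ^ (n j 0) * X 1 ^ (n j 1))) = (v ∘ a) ∘ ε.symm := by
      funext j
      have hn : n j = (a (ε.symm j)).1 := by simp [n]
      simp only [Function.comp_apply, v, hπ, AlgHom.toLinearMap_apply]
      congr 1
      rw [hn, monomial_eq, Finsupp.prod_fintype _ _ (fun _ => by simp), Fin.prod_univ_two]
      simp
    rw [hfun]
    exact h6

/-- The point `(x, y)` has rational coordinates with a common denominator of size at most `H`. -/
def HasDenomLe (H x y : ℝ) : Prop :=
  ∃ n k l : ℤ, n ≠ 0 ∧ |(n : ℝ)| ≤ H ∧ n * x = k ∧ n * y = l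

theorem mul_sq_le_of_hilbert {d M s : ℕ} (hd : 0 < d) (hM : 0 < M)
    (hs : (M + 1) * (M + 2) ≤ 2 * s + (M + 1 - d) * (M + 2 - d)) :
    d * M ^ 2 ≤ (s - 1) * (M + 2 * d) := by
  suffices h : 2 * (d * M ^ 2) + 2 * (M + 2 * d) ≤ 2 * s * (M + 2 * d) by
    rw [mul_assoc] at h
    rw [Nat.sub_mul, one_mul]
    omega
  rcases le_or_gt d M with hdM | hdM
  · obtain ⟨e, rfl⟩ := Nat.exists_eq_add_of_le hdM
    have e1 : d + e + 1 - d = e + 1 := by omega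
    have e2 : d + e + 2 - d = e + 2 := by omega
    rw [e1, e2] at hs
    have h2 : d * (d + 2 * e + 3) ≤ 2 * s := by nlinarith
    have h3 := Nat.mul_le_mul_right (d + e + 2 * d) h2
    refine le_trans ?_ h3
    have h4 : 1 ≤ d := hd
    nlinarith [mul_le_mul' h4 h4, mul_le_mul' (mul_le_mul' h4 h4) (le_refl e), Nat.zero_le (d * e),
      Nat.zero_le (d * d * e), Nat.zero_le (d * d * d), mul_le_mul' h4 (le_refl e)]
  · have e1 : M + 1 - d = 0 := by omega
    rw [e1, zero_mul, add_zero] at hs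
    have h3 := Nat.mul_le_mul_right (M + 2 * d) hs
    refine le_trans ?_ h3
    nlinarith [Nat.zero_le (M * d), Nat.zero_le (M * M * M)]

theorem le_of_hilbert {d M s : ℕ} (hd : 0 < d)
    (hs : (M + 1) * (M + 2) ≤ 2 * s + (M + 1 - d) * (M + 2 - d)) : M + 1 ≤ s := by
  have h1 : (M + 1 - d) * (M + 2 - d) ≤ M * (M + 1) := Nat.mul_le_mul (by omega) (by omega)
  nlinarith

theorem det_size_lt_one {d M s : ℕ} {H ρ : ℝ} (hd : 0 < d) (hM : 0 < M) (hH : 2 < H)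
    (hMH : Real.log H ≤ M) (hs : (M + 1) * (M + 2) ≤ 2 * s + (M + 1 - d) * (M + 2 - d))
    (hρ : ρ = 1 / (2 ^ 30 * H ^ ((2 : ℝ) / d))) :
    H ^ (s * M) * (4 ^ (s * M) * (s.factorial * (48 * ρ) ^ (s * (s - 1) / 2))) < 1 := by
  have hs1 := le_of_hilbert hd hs
  have hkey := mul_sq_le_of_hilbert hd hM hs
  set N := s * (s - 1) / 2 with hN
  have h2N : 2 * N = s * (s - 1) := by
    rw [hN]
    exact Nat.mul_div_cancel' (Nat.even_mul_pred_self s).two_dvd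
  have hNpos : 0 < N := by
    have : 0 < s * (s - 1) := Nat.mul_pos (by omega) (by omega)
    omega
  have hH0 : 0 < H := by linarith
  have hd' : (0 : ℝ) < d := by exact_mod_cast hd
  have hM' : (0 : ℝ) < M := by exact_mod_cast hM
  have hexp : ((s * M : ℕ) : ℝ) ≤ (2 / d + 4 / M) * N := by
    have h1 : s * (d * M ^ 2) ≤ 2 * N * (M + 2 * d) := by
      rw [h2N, mul_assoc]
      exact Nat.mul_le_mul_left s hkey
    have h1' : (s : ℝ) * (d * M ^ 2) ≤ 2 * N * (M + 2 * d) := by exact_mod_cast h1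
    rw [div_add_div _ _ hd'.ne' hM'.ne', div_mul_eq_mul_div, le_div_iff₀ (by positivity)]
    push_cast
    nlinarith
  have h6 : s * M ≤ 6 * N := by
    have h2 : (2 : ℝ) / d + 4 / M ≤ 6 := by
      have a1 : (2 : ℝ) / d ≤ 2 := div_le_self (by norm_num) (by exact_mod_cast hd)
      have a2 : (4 : ℝ) / M ≤ 4 := div_le_self (by norm_num) (by exact_mod_cast hM)
      linarith
    have : ((s * M : ℕ) : ℝ) ≤ 6 * N := hexp.trans (by gcongr)
    exact_mod_cast this
  have hHs : H ^ (s * M) ≤ (H ^ ((2 : ℝ) / d) * Real.exp 4) ^ N := by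
    have h3 : H ^ ((4 : ℝ) / M) ≤ Real.exp 4 := by
      rw [Real.rpow_def_of_pos hH0, Real.exp_le_exp, mul_div_assoc', div_le_iff₀ hM']
      linarith
    calc H ^ (s * M) = H ^ ((s * M : ℕ) : ℝ) := (Real.rpow_natCast _ _).symm
      _ ≤ H ^ ((2 / d + 4 / M) * N : ℝ) := Real.rpow_le_rpow_of_exponent_le (by linarith) hexp
      _ = (H ^ ((2 : ℝ) / d) * H ^ ((4 : ℝ) / M)) ^ N := by
        rw [Real.rpow_mul hH0.le, Real.rpow_natCast, Real.rpow_add hH0]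
      _ ≤ _ := by gcongr
  have h4s : (4 : ℝ) ^ (s * M) ≤ (4 ^ 6) ^ N := by
    rw [← pow_mul]
    exact pow_le_pow_right₀ (by norm_num) h6
  have hfac : (s.factorial : ℝ) ≤ 4 ^ N := by
    have h7 : s.factorial ≤ 4 ^ N := by
      calc s.factorial ≤ s ^ s := Nat.factorial_le_pow s
        _ ≤ (2 ^ (s - 1)) ^ s := by
          gcongr
          have := Nat.lt_two_pow_self (n := s - 1)
          omega
        _ = 4 ^ N := by
          rw [show 4 = 2 ^ 2 by norm_num, ← pow_mul, ← pow_mul, h2N, mul_comm]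
    exact_mod_cast h7
  have hρ0 : 0 < ρ := by rw [hρ]; positivity
  calc H ^ (s * M) * (4 ^ (s * M) * (s.factorial * (48 * ρ) ^ N))
      ≤ (H ^ ((2 : ℝ) / d) * Real.exp 4) ^ N * ((4 ^ 6) ^ N * (4 ^ N * (48 * ρ) ^ N)) := by
        gcongr
    _ = (Real.exp 4 * (4 ^ 6 * 4 * 48) / 2 ^ 30) ^ N := by
        rw [← mul_pow, ← mul_pow, ← mul_pow, hρ]
        congr 1
        have : H ^ ((2 : ℝ) / d) ≠ 0 := by positivity
        field_simp
    _ < 1 := by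
        refine pow_lt_one₀ (by positivity) ?_ hNpos.ne'
        have h8 : Real.exp 4 ≤ 3 ^ 4 := by
          have : Real.exp 4 = Real.exp 1 ^ 4 := by rw [← Real.exp_nat_mul]; norm_num
          rw [this]
          gcongr
          exact Real.exp_one_lt_d9.le.trans (by norm_num)
        rw [div_lt_one (by positivity)]
        calc Real.exp 4 * (4 ^ 6 * 4 * 48) ≤ 3 ^ 4 * (4 ^ 6 * 4 * 48) := by gcongr
          _ < 2 ^ 30 := by norm_num

theorem one_le_abs_det_of_hasDenomLe {s M : ℕ} {H : ℝ} (e : ℕ → ℕ × ℕ)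
    (he : ∀ j, (e j).1 + (e j).2 ≤ M) {t y : Fin s → ℝ} (hr : ∀ j, HasDenomLe H (t j) (y j))
    (hdet : (Matrix.of fun i j : Fin s => t j ^ (e i).1 * y j ^ (e i).2).det ≠ 0) :
    1 ≤ H ^ (s * M) * |(Matrix.of fun i j : Fin s => t j ^ (e i).1 * y j ^ (e i).2).det| := by
  choose n k l hn hnH hk hl using hr
  have h1 : ((Matrix.of fun i j : Fin s => n j ^ (M - (e i).1 - (e i).2) * (k j ^ (e i).1 *
      l j ^ (e i).2)).det : ℝ) = (∏ j, (n j : ℝ) ^ M) *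
      (Matrix.of fun i j : Fin s => t j ^ (e i).1 * y j ^ (e i).2).det := by
    rw [← Matrix.det_mul_row, Int.cast_det]
    congr 1
    ext i j
    simp only [Matrix.map_apply, Matrix.of_apply]
    push_cast
    rw [← hk, ← hl, mul_pow, mul_pow]
    have : M = (M - (e i).1 - (e i).2) + (e i).1 + (e i).2 := by have := he i; omega
    conv_rhs => rw [this, pow_add, pow_add]
    ring
  have h2 : (∏ j, (n j : ℝ) ^ M) ≠ 0 :=
    Finset.prod_ne_zero_iff.mpr fun j _ => pow_ne_zero _ (by exact_mod_cast hn j)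
  have h3 := mul_ne_zero h2 hdet
  rw [← h1] at h3
  have h4 := Int.one_le_abs (Int.cast_ne_zero.mp h3)
  have h5 : (1 : ℝ) ≤ |((Matrix.of fun i j : Fin s => n j ^ (M - (e i).1 - (e i).2) * (k j ^ (e i).1 *
      l j ^ (e i).2)).det : ℝ)| := by exact_mod_cast h4
  rw [h1, abs_mul, Finset.abs_prod] at h5
  refine h5.trans ?_
  gcongr
  calc ∏ j, |(n j : ℝ) ^ M| ≤ ∏ _j : Fin s, H ^ M := by
        refine Finset.prod_le_prod (fun _ _ => abs_nonneg _) fun j _ => ?_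
        rw [abs_pow]
        exact pow_le_pow_left₀ (abs_nonneg _) (hnH j) M
    _ = H ^ (s * M) := by simp [← pow_mul, mul_comm]

/-- A short piece of an arc lying deep inside the arc carries few rational points. -/
theorem card_lt_of_short {φ : ℝ → ℝ} {a b H ρ : ℝ} {d M s : ℕ} {e : ℕ → ℕ × ℕ}
    (hd : 0 < d) (hM : 0 < M) (hH : 2 < H) (hMH : Real.log H ≤ M)
    (hs : (M + 1) * (M + 2) ≤ 2 * s + (M + 1 - d) * (M + 2 - d))
    (hρ : ρ = 1 / (2 ^ 30 * H ^ ((2 : ℝ) / d)))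
    (he : ∀ j, (e j).1 + (e j).2 ≤ M)
    (hφ : ContDiffOn ℝ ∞ φ (Ioo a b)) (hbox : ∀ x ∈ Ioo a b, |x| < 2 ∧ |φ x| < 2)
    (hW : ∀ k ≤ s, ∀ x ∈ Ioo a b, wronskian k (fun j t => t ^ (e j).1 * φ t ^ (e j).2) x ≠ 0)
    (hsign : ∀ k ≤ s, (∀ y ∈ Ioo a b, 0 ≤ iteratedDeriv k φ y) ∨
      (∀ y ∈ Ioo a b, iteratedDeriv k φ y ≤ 0))
    {u v R : ℝ} (hR : 0 < R) (hu : a ≤ u - R) (hv : v + R ≤ b) (huv : v - u ≤ ρ * R)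
    {T : Finset ℝ} (hT : ∀ t ∈ T, u ≤ t ∧ t ≤ v ∧ HasDenomLe H t (φ t)) : T.card < s := by
  by_contra! hcard
  let t := T.orderEmbOfCardLe hcard
  have htT : ∀ j, t j ∈ T := T.orderEmbOfCardLe_mem hcard
  have hdet := det_ne_zero_of_wronskian_ne_zero (t := t)
    (f := fun j t => t ^ (e j).1 * φ t ^ (e j).2)
    (fun j => (contDiffOn_id.pow _).mul (hφ.pow _)) hW t.strictMono
    (fun j => ⟨by have := (hT _ (htT j)).1; linarith, by have := (hT _ (htT j)).2.1; linarith⟩)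
  have hlow := one_le_abs_det_of_hasDenomLe e he (fun j => (hT _ (htT j)).2.2) hdet
  set a' := u - R / 2
  set b' := v + R / 2
  have hsub : Ioo a' b' ⊆ Ioo a b := Set.Ioo_subset_Ioo (by simp only [a']; linarith)
    (by simp only [b']; linarith)
  have hφ2 : ContDiffOn ℝ ∞ (fun x => 1 / 2 * φ x) (Ioo a b) := contDiffOn_const.mul hφ
  have hid2 : ContDiffOn ℝ ∞ (fun x : ℝ => 1 / 2 * x) (Ioo a b) :=
    contDiffOn_const.mul contDiffOn_id
  have hin : ∀ x ∈ Ioo a' b', a ≤ x - R / 2 ∧ x + R / 2 ≤ b := by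
    intro x hx
    simp only [a', b', Set.mem_Ioo] at hx
    constructor <;> linarith
  have hA : (12 : ℝ) / (R / 2) = 24 / R := by field_simp; norm_num
  have hb1 : ∀ x ∈ Ioo a' b', ∀ k < s,
      |iteratedDeriv k (fun x => 1 / 2 * φ x) x| / k.factorial ≤ (24 / R) ^ k := by
    intro x hx k hk
    rw [← hA]
    refine abs_iteratedDeriv_le_of_sign hφ2 (half_pos hR) (hin x hx) (fun y hy => ?_)
      (fun k _ hk => ?_) hk
    · rw [abs_mul, abs_of_pos (by norm_num : (0 : ℝ) < 1 / 2)]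
      linarith [(hbox y hy).2]
    · simp only [iteratedDeriv_const_mul_field]
      rcases hsign k hk with h | h
      · exact Or.inl fun y hy => by linarith [h y hy]
      · exact Or.inr fun y hy => by linarith [h y hy]
  have hb2 : ∀ x ∈ Ioo a' b', ∀ k < s,
      |iteratedDeriv k (fun x : ℝ => 1 / 2 * x) x| / k.factorial ≤ (24 / R) ^ k := by
    intro x hx k hk
    rw [← hA]
    refine abs_iteratedDeriv_le_of_sign hid2 (half_pos hR) (hin x hx) (fun y hy => ?_)
      (fun k _ hk => Or.inl fun y _ => ?_) hk
    · rw [abs_mul, abs_of_pos (by norm_num : (0 : ℝ) < 1 / 2)]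
      linarith [(hbox y hy).1]
    · rw [iteratedDeriv_const_mul_field, iteratedDeriv_fun_id]
      split_ifs <;> linarith
  have hup := abs_det_le_of_iteratedDeriv_le (s := s) (t := t) (a := a') (b := b')
    (f := fun i => (fun x : ℝ => 1 / 2 * x) ^ (e i).1 * (fun x => 1 / 2 * φ x) ^ (e i).2)
    (δ := ρ * R) (A := 2 * (24 / R)) (B := 2 ^ M)
    (fun i => ((hid2.mono hsub).pow _).mul ((hφ2.mono hsub).pow _)) t.injective
    (fun j => ⟨by have := (hT _ (htT j)).1; simp only [a']; linarith,
      by have := (hT _ (htT j)).2.1; simp only [b']; linarith⟩)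
    (fun j l => by
      have h1 := hT _ (htT j)
      have h2 := hT _ (htT l)
      rw [abs_le]
      constructor <;> linarith)
    (fun i k hk x hx => by
      refine (abs_iteratedDeriv_pow_mul_pow_le hx (hid2.mono hsub) (hφ2.mono hsub) (by positivity)
        (hb2 x hx) (hb1 x hx) (e i).1 (e i).2 hk).trans ?_
      gcongr
      · norm_num
      · exact he i)
  have hscale : (Matrix.of fun i j : Fin s => t j ^ (e i).1 * φ (t j) ^ (e i).2).det =
      (∏ i : Fin s, (2 : ℝ) ^ ((e i).1 + (e i).2)) * (Matrix.of fun i j : Fin s =>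
        ((fun x : ℝ => 1 / 2 * x) ^ (e i).1 * (fun x => 1 / 2 * φ x) ^ (e i).2) (t j)).det := by
    rw [← Matrix.det_mul_column]
    congr 1
    ext i j
    simp only [Matrix.of_apply, Pi.mul_apply, Pi.pow_apply, mul_pow]
    rw [pow_add, one_div, inv_pow, inv_pow]
    field_simp
  have hprod : (∏ i : Fin s, (2 : ℝ) ^ ((e i).1 + (e i).2)) ≤ 2 ^ (s * M) := by
    calc (∏ i : Fin s, (2 : ℝ) ^ ((e i).1 + (e i).2)) ≤ ∏ _i : Fin s, (2 : ℝ) ^ M := by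
          refine Finset.prod_le_prod (fun _ _ => by positivity) fun i _ => ?_
          exact pow_le_pow_right₀ (by norm_num) (he i)
      _ = 2 ^ (s * M) := by simp [← pow_mul, mul_comm]
  have hsmall := det_size_lt_one hd hM hH hMH hs hρ
  have hH0 : 0 < H := by linarith
  have hρR : ρ * R * (2 * (24 / R)) = 48 * ρ := by field_simp; ring
  rw [hρR] at hup
  rw [hscale, abs_mul, abs_of_pos (a := ∏ i : Fin s, (2 : ℝ) ^ ((e i).1 + (e i).2))
    (by positivity)] at hlow
  refine absurd (hlow.trans ?_) (not_le.mpr hsmall)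
  have h4 : (4 : ℝ) ^ (s * M) = 2 ^ (s * M) * 2 ^ (s * M) := by rw [← mul_pow]; norm_num
  have hρ0 : 0 ≤ ρ := by rw [hρ]; positivity
  have h5 := mul_le_mul hprod hup (abs_nonneg _) (by positivity)
  rw [h4]
  refine mul_le_mul_of_nonneg_left (h5.trans_eq ?_) (by positivity)
  rw [← pow_mul, mul_comm M s]
  ring

theorem HasDenomLe.abs_sub_ge {H x y x' y' : ℝ} (h : HasDenomLe H x y) (h' : HasDenomLe H x' y')
    (hne : x ≠ x') : (H ^ 2)⁻¹ ≤ |x - x'| := by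
  obtain ⟨n, k, -, hn, hnH, hk, -⟩ := h
  obtain ⟨m, l, -, hm, hmH, hl, -⟩ := h'
  have hn' : (n : ℝ) ≠ 0 := by exact_mod_cast hn
  have hm' : (m : ℝ) ≠ 0 := by exact_mod_cast hm
  have h1 : (n : ℝ) * m * (x - x') = ((m * k - n * l : ℤ) : ℝ) := by
    push_cast
    rw [← hk, ← hl]
    ring
  have h2 : (n : ℝ) * m * (x - x') ≠ 0 := mul_ne_zero (mul_ne_zero hn' hm') (sub_ne_zero.mpr hne)
  have h3 : (1 : ℝ) ≤ |(n : ℝ) * m * (x - x')| := by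
    rw [h1] at h2 ⊢
    exact_mod_cast Int.one_le_abs (Int.cast_ne_zero.mp h2)
  rw [abs_mul, abs_mul] at h3
  have hH : 0 ≤ H := (abs_nonneg _).trans hnH
  have h4 : (1 : ℝ) ≤ H ^ 2 * |x - x'| := by
    refine h3.trans ?_
    rw [sq]
    gcongr
  have hH2 : 0 < H ^ 2 := by
    rcases hH.eq_or_lt with h0 | h0
    · rw [← h0] at h4
      norm_num at h4
    · positivity
  rw [inv_le_iff_one_le_mul₀' hH2]
  assumption

/-- Covering a finite set by geometrically growing pieces. -/
theorem card_le_of_geometric_cover {T : Finset ℝ} {g : ℝ → ℝ} {H ρ : ℝ} {s : ℕ} (hH : 2 < H)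
    (hρ : 0 < ρ) (hρ1 : ρ ≤ 1) (hT : ∀ x ∈ T, (H ^ 2)⁻¹ ≤ g x ∧ g x ≤ 4)
    (hcell : ∀ r > 0, ∀ U ⊆ T, (∀ t ∈ U, r ≤ g t ∧ g t ≤ r + ρ * r) → U.card ≤ s) :
    (T.card : ℝ) ≤ s * (11 * Real.log H / ρ) := by
  set L := Real.log (1 + ρ) with hL
  have hLpos : ρ / 2 ≤ L := by
    refine le_trans ?_ (Real.le_log_one_add_of_nonneg hρ.le)
    rw [div_le_div_iff₀ (by norm_num) (by positivity)]
    nlinarith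
  have hL0 : 0 < L := by linarith [half_pos hρ]
  have hH0 : 0 < H := by linarith
  let j : ℝ → ℤ := fun x => ⌊Real.log (g x) / L⌋
  have hgpos : ∀ x ∈ T, 0 < g x := fun x hx => lt_of_lt_of_le (by positivity) (hT x hx).1
  have himg : T.image j ⊆ Finset.Icc ⌊-(2 * Real.log H) / L⌋ ⌊Real.log 4 / L⌋ := by
    intro i hi
    obtain ⟨x, hx, rfl⟩ := Finset.mem_image.mp hi
    rw [Finset.mem_Icc]
    constructor
    · refine Int.floor_le_floor (div_le_div_of_nonneg_right ?_ hL0.le)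
      have := Real.log_le_log (by positivity) (hT x hx).1
      rw [Real.log_inv, Real.log_pow] at this
      exact_mod_cast this
    · exact Int.floor_le_floor (div_le_div_of_nonneg_right
        (Real.log_le_log (hgpos x hx) (hT x hx).2) hL0.le)
  have hfib : ∀ i ∈ T.image j, (T.filter fun x => j x = i).card ≤ s := by
    intro i _
    refine hcell (Real.exp (i * L)) (Real.exp_pos _) _ (Finset.filter_subset _ _) fun t ht => ?_
    rw [Finset.mem_filter] at ht
    obtain ⟨ht, hj⟩ := ht
    obtain ⟨h1, h2⟩ := Int.floor_eq_iff.mp hj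
    rw [le_div_iff₀ hL0] at h1
    rw [div_lt_iff₀ hL0] at h2
    refine ⟨(Real.le_log_iff_exp_le (hgpos t ht)).mp h1, ?_⟩
    have h3 := ((Real.log_lt_iff_lt_exp (hgpos t ht)).mp h2).le
    rw [add_mul, one_mul, Real.exp_add, hL, Real.exp_log (by linarith)] at h3
    rw [← hL] at h3
    linarith
  have hcard := Finset.card_le_mul_card_image T s hfib
  have hcard2 := Finset.card_le_card himg
  rw [Int.card_Icc] at hcard2
  have hlogH : 0.69 < Real.log H :=
    lt_trans (by linarith [Real.log_two_gt_d9]) (Real.log_lt_log (by norm_num) hH)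
  have hlog4 : Real.log 4 ≤ 2 * Real.log H := by
    rw [show (4 : ℝ) = 2 ^ 2 by norm_num, Real.log_pow]
    have := Real.log_le_log (by norm_num) hH.le
    push_cast
    linarith
  have hcount : ((T.image j).card : ℝ) ≤ 11 * Real.log H / ρ := by
    have h1 : ((T.image j).card : ℝ) ≤
        ((⌊Real.log 4 / L⌋ + 1 - ⌊-(2 * Real.log H) / L⌋).toNat : ℝ) := by exact_mod_cast hcard2
    have h2 : ⌊-(2 * Real.log H) / L⌋ ≤ ⌊Real.log 4 / L⌋ := by
      refine Int.floor_le_floor (div_le_div_of_nonneg_right ?_ hL0.le)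
      have := Real.log_nonneg (show (1 : ℝ) ≤ 4 by norm_num)
      linarith
    have h3 : ((⌊Real.log 4 / L⌋ + 1 - ⌊-(2 * Real.log H) / L⌋).toNat : ℝ) =
        ⌊Real.log 4 / L⌋ + 1 - ⌊-(2 * Real.log H) / L⌋ := by
      have : ((⌊Real.log 4 / L⌋ + 1 - ⌊-(2 * Real.log H) / L⌋).toNat : ℤ) =
        ⌊Real.log 4 / L⌋ + 1 - ⌊-(2 * Real.log H) / L⌋ := Int.toNat_of_nonneg (by omega)
      exact_mod_cast this
    have h4 := Int.floor_le (Real.log 4 / L)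
    have h5 := Int.lt_floor_add_one (-(2 * Real.log H) / L)
    have h6 : Real.log 4 / L - -(2 * Real.log H) / L ≤ 8 * Real.log H / ρ := by
      rw [← sub_div, div_le_div_iff₀ hL0 hρ]
      nlinarith
    have h7 : 2 ≤ 3 * Real.log H / ρ := by
      rw [le_div_iff₀ hρ]
      linarith
    have h8 : 11 * Real.log H / ρ = 8 * Real.log H / ρ + 3 * Real.log H / ρ := by ring
    rw [h8]
    linarith
  calc (T.card : ℝ) ≤ (s * (T.image j).card : ℕ) := by exact_mod_cast hcard
    _ = s * ((T.image j).card : ℝ) := by push_cast; rfl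
    _ ≤ _ := by gcongr

/-- An arc along which no Wronskian vanishes and all derivatives have constant sign carries few
rational points. -/
theorem card_le_of_arc {φ : ℝ → ℝ} {a b H : ℝ} {d M s : ℕ} {e : ℕ → ℕ × ℕ}
    (hd : 0 < d) (hM : 0 < M) (hH : 2 < H) (hMH : Real.log H ≤ M)
    (hs : (M + 1) * (M + 2) ≤ 2 * s + (M + 1 - d) * (M + 2 - d))
    (he : ∀ j, (e j).1 + (e j).2 ≤ M)
    (hφ : ContDiffOn ℝ ∞ φ (Ioo a b)) (hbox : ∀ x ∈ Ioo a b, |x| < 2 ∧ |φ x| < 2)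
    (hW : ∀ k ≤ s, ∀ x ∈ Ioo a b, wronskian k (fun j t => t ^ (e j).1 * φ t ^ (e j).2) x ≠ 0)
    (hsign : ∀ k ≤ s, (∀ y ∈ Ioo a b, 0 ≤ iteratedDeriv k φ y) ∨
      (∀ y ∈ Ioo a b, iteratedDeriv k φ y ≤ 0))
    {T : Finset ℝ} (hT : ∀ t ∈ T, t ∈ Ioo a b ∧ HasDenomLe H t (φ t)) :
    (T.card : ℝ) ≤ 2 ^ 35 * s * H ^ ((2 : ℝ) / d) * Real.log H := by
  classical
  rcases T.eq_empty_or_nonempty with rfl | ⟨t₀, ht₀⟩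
  · have := Real.log_nonneg (show 1 ≤ H by linarith)
    simp only [Finset.card_empty, Nat.cast_zero]
    positivity
  have hab : a < b := (hT t₀ ht₀).1.1.trans (hT t₀ ht₀).1.2
  have hba : b - a ≤ 4 := by
    have hsub : Ioo a b ⊆ Set.Icc (-2) 2 := fun x hx =>
      ⟨(abs_lt.mp (hbox x hx).1).1.le, (abs_lt.mp (hbox x hx).1).2.le⟩
    have := closure_mono hsub
    rw [closure_Ioo hab.ne, isClosed_Icc.closure_eq] at this
    have h1 := this (Set.left_mem_Icc.mpr hab.le)
    have h2 := this (Set.right_mem_Icc.mpr hab.le)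
    linarith [h1.1, h2.2]
  have hP1 : 1 ≤ H ^ ((2 : ℝ) / d) := Real.one_le_rpow (by linarith) (by positivity)
  obtain ⟨ρ, hρ⟩ : ∃ ρ, ρ = 1 / (2 ^ 30 * H ^ ((2 : ℝ) / d)) := ⟨_, rfl⟩
  have hρ0 : 0 < ρ := by rw [hρ]; positivity
  have hρ1 : ρ ≤ 1 := by
    rw [hρ, div_le_one (by positivity)]
    nlinarith
  have hs1 : 1 ≤ s := le_trans (by omega) (le_of_hilbert hd hs)
  have hs1' : (1 : ℝ) ≤ s := by exact_mod_cast hs1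
  have hlogH : 0.69 < Real.log H :=
    lt_trans (by linarith [Real.log_two_gt_d9]) (Real.log_lt_log (by norm_num) hH)
  have hhalf : ∀ (T' : Finset ℝ) (g : ℝ → ℝ), T' ⊆ T → (∀ x ∈ T', 0 < g x ∧ g x ≤ 4) →
      (∀ x y, |g x - g y| = |x - y|) →
      (∀ r > 0, ∀ U ⊆ T', (∀ t ∈ U, r ≤ g t ∧ g t ≤ r + ρ * r) → U.card ≤ s) →
      (T'.card : ℝ) ≤ 2 ^ 34 * s * H ^ ((2 : ℝ) / d) * Real.log H := by
    intro T' g hT' hg hgd hcell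
    rcases T'.eq_empty_or_nonempty with rfl | hne
    · simp only [Finset.card_empty, Nat.cast_zero]
      positivity
    obtain ⟨x₀, hx₀, hmin⟩ := T'.exists_min_image g hne
    have h1 := card_le_of_geometric_cover (T := T'.erase x₀) (g := g) hH hρ0 hρ1
      (fun x hx => by
        rw [Finset.mem_erase] at hx
        refine ⟨?_, (hg x hx.2).2⟩
        have h2 := (hT x (hT' hx.2)).2.abs_sub_ge (hT x₀ (hT' hx₀)).2 hx.1
        rw [← hgd, abs_of_nonneg (sub_nonneg.mpr (hmin x hx.2))] at h2
        linarith [(hg x₀ hx₀).1])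
      (fun r hr U hU hUr => hcell r hr U (hU.trans (Finset.erase_subset _ _)) hUr)
    have h2 := Finset.card_erase_add_one hx₀
    have h3 : (T'.card : ℝ) = (T'.erase x₀).card + 1 := by exact_mod_cast h2.symm
    have h4 : (s : ℝ) * (11 * Real.log H / ρ) =
        11 * 2 ^ 30 * (s * H ^ ((2 : ℝ) / d) * Real.log H) := by
      rw [hρ]
      field_simp
    have h5 : 0.69 ≤ s * H ^ ((2 : ℝ) / d) * Real.log H := by
      have : 1 ≤ s * H ^ ((2 : ℝ) / d) := one_le_mul_of_one_le_of_one_le hs1' hP1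
      nlinarith
    rw [h4] at h1
    rw [h3]
    linarith
  have hcellT : ∀ {u v R : ℝ}, 0 < R → a ≤ u - R → v + R ≤ b → v - u ≤ ρ * R → ∀ U ⊆ T,
      (∀ t ∈ U, u ≤ t ∧ t ≤ v) → U.card ≤ s := fun hR hu hv huv U hU hUt =>
    (card_lt_of_short hd hM hH hMH hs hρ he hφ hbox hW hsign hR hu hv huv
      fun t ht => ⟨(hUt t ht).1, (hUt t ht).2, (hT t (hU ht)).2⟩).le
  have hleft := hhalf (T.filter fun x => x ≤ (a + b) / 2) (fun x => x - a)
    (Finset.filter_subset _ _)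
    (fun x hx => by
      have := (hT x (Finset.mem_filter.mp hx).1).1
      constructor <;> linarith [this.1, this.2])
    (fun x y => by ring_nf)
    (fun r hr U hU hUr => by
      rcases U.eq_empty_or_nonempty with rfl | ⟨t₁, ht₁⟩
      · simp
      have h1 := (Finset.mem_filter.mp (hU ht₁)).2
      have h2 := hUr t₁ ht₁
      refine hcellT (u := a + r) (v := min (a + r + ρ * r) ((a + b) / 2)) hr (by linarith) ?_ ?_ U
        (hU.trans (Finset.filter_subset _ _)) fun t ht => ⟨by linarith [(hUr t ht).1], ?_⟩
      · linarith [min_le_right (a + r + ρ * r) ((a + b) / 2)]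
      · linarith [min_le_left (a + r + ρ * r) ((a + b) / 2)]
      · exact le_min (by linarith [(hUr t ht).2]) (Finset.mem_filter.mp (hU ht)).2)
  have hright := hhalf (T.filter fun x => ¬ x ≤ (a + b) / 2) (fun x => b - x)
    (Finset.filter_subset _ _)
    (fun x hx => by
      have := (hT x (Finset.mem_filter.mp hx).1).1
      constructor <;> linarith [this.1, this.2])
    (fun x y => by
      rw [abs_sub_comm x y]
      ring_nf)
    (fun r hr U hU hUr => by
      rcases U.eq_empty_or_nonempty with rfl | ⟨t₁, ht₁⟩
      · simp
      have h1 := (Finset.mem_filter.mp (hU ht₁)).2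
      have h2 := hUr t₁ ht₁
      refine hcellT (u := max (b - r - ρ * r) ((a + b) / 2)) (v := b - r) hr ?_ (by linarith) ?_ U
        (hU.trans (Finset.filter_subset _ _)) fun t ht => ⟨?_, by linarith [(hUr t ht).1]⟩
      · linarith [le_max_right (b - r - ρ * r) ((a + b) / 2)]
      · linarith [le_max_left (b - r - ρ * r) ((a + b) / 2)]
      · exact max_le (by linarith [(hUr t ht).2]) (not_le.mp (Finset.mem_filter.mp (hU ht)).2).le)
  have hsplit := T.card_filter_add_card_filter_not (fun x => x ≤ (a + b) / 2)
  have hsplit' : (T.card : ℝ) = (T.filter fun x => x ≤ (a + b) / 2).card +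
      (T.filter fun x => ¬ x ≤ (a + b) / 2).card := by exact_mod_cast hsplit.symm
  rw [hsplit']
  calc _ ≤ _ := add_le_add hleft hright
    _ = _ := by ring

namespace IsArc

variable {F G P : MvPolynomial (Fin 2) ℚ} {a b : ℝ} {φ : ℝ → ℝ}

theorem aeval_eq_zero_of_dvd (h : IsArc F G a b φ) (hP : F ∣ P) {x : ℝ} (hx : x ∈ Ioo a b) :
    (aeval ![x, φ x] P : ℝ) = 0 := by
  obtain ⟨Q, rfl⟩ := hP
  rw [map_mul, h.zero x hx, zero_mul]

theorem dvd_of_aeval_eq_zero (hF : Prime F) (h : IsArc F G a b φ)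
    (hP : ∀ x ∈ Ioo a b, (aeval ![x, φ x] P : ℝ) = 0) : F ∣ P := by
  classical
  by_contra hFP
  obtain ⟨Z, hZ, hZc⟩ := (Set.Ioo_infinite h.lt).exists_subset_card_eq
    (F.totalDegree * P.totalDegree + 1)
  have hinj : Function.Injective fun x : ℝ => (![x, φ x] : Fin 2 → ℝ) := fun x y hxy => by
    simpa using congrFun hxy 0
  have h1 := card_common_zeros_le hF hFP (Z.image fun x => ![x, φ x])
    (fun z hz => by
      obtain ⟨x, hx, rfl⟩ := Finset.mem_image.mp hz
      exact h.zero x (hZ hx))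
    (fun z hz => by
      obtain ⟨x, hx, rfl⟩ := Finset.mem_image.mp hz
      exact hP x (hZ hx))
  rw [Finset.card_image_of_injective _ hinj] at h1
  omega

theorem sign_const (hqG : pderiv 1 F ∣ G) (h : IsArc F G a b φ) {k : ℕ}
    (hk : F ∣ curveIterDeriv F (X 1) k ∨ curveIterDeriv F (X 1) k ∣ G) :
    (∀ y ∈ Ioo a b, 0 ≤ iteratedDeriv k φ y) ∨ (∀ y ∈ Ioo a b, iteratedDeriv k φ y ≤ 0) := by
  have hform := iteratedDeriv_aeval_curve (fun x hx => aeval_ne_zero_of_dvd hqG (h.ne x hx))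
    (fun x hx => h.hasDerivAt hqG hx) (X 1) k
  simp only [aeval_X, Matrix.cons_val_one, Matrix.cons_val_fin_one] at hform
  change ∀ x ∈ Ioo a b, iteratedDeriv k φ x = _ at hform
  rcases hk with hk | hk
  · refine Or.inl fun y hy => ?_
    rw [hform y hy, h.aeval_eq_zero_of_dvd hk hy, zero_div]
  · have hne : ∀ y ∈ Ioo a b, iteratedDeriv k φ y ≠ 0 := fun y hy => by
      rw [hform y hy]
      exact div_ne_zero (aeval_ne_zero_of_dvd hk (h.ne y hy))
        (pow_ne_zero _ (aeval_ne_zero_of_dvd hqG (h.ne y hy)))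
    have hcont : ContinuousOn (iteratedDeriv k φ) (Ioo a b) :=
      ((h.contDiffOn hqG).iteratedDeriv_Ioo k).continuousOn
    by_contra! hcon
    obtain ⟨⟨y, hy, hy0⟩, z, hz, hz0⟩ := hcon
    obtain ⟨w, hw, hw0⟩ := isPreconnected_Ioo.intermediate_value hy hz hcont ⟨hy0.le, hz0.le⟩
    exact hne w hw hw0

theorem aeval_ratCast (P : MvPolynomial (Fin 2) ℚ) (x y : ℚ) :
    (aeval ![(x : ℝ), (y : ℝ)] P : ℝ) = ((eval ![x, y] P : ℚ) : ℝ) := by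
  have : (![(x : ℝ), (y : ℝ)] : Fin 2 → ℝ) = fun i => algebraMap ℚ ℝ (![x, y] i) := by
    funext i
    fin_cases i <;> simp
  rw [this]
  exact (aeval_algebraMap_apply ℝ ![x, y] P).trans (by simp)

/-- If `m₀, …, m_{s-1}` are linearly independent modulo `F`, then along an arc through a rational
point the Wronskians of these functions do not vanish identically. -/
theorem wronskian_ne_zero (hF : Prime F) (hqG : pderiv 1 F ∣ G) (h : IsArc F G a b φ) {s : ℕ}
    {m : ℕ → MvPolynomial (Fin 2) ℚ}
    (hli : LinearIndependent ℚ fun j : Fin s => Ideal.Quotient.mkₐ ℚ (Ideal.span {F}) (m j))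
    (hdich : ∀ k ≤ s, F ∣ curveWronskian F m k ∨ curveWronskian F m k ∣ G)
    {x₀ y₀ : ℚ} (hx₀ : (x₀ : ℝ) ∈ Ioo a b) (hy₀ : φ x₀ = y₀) :
    ∀ k ≤ s, ∀ x ∈ Ioo a b, wronskian k (fun j t => (aeval ![t, φ t] (m j) : ℝ)) x ≠ 0 := by
  have hq : ∀ x ∈ Ioo a b, (aeval ![x, φ x] (pderiv 1 F) : ℝ) ≠ 0 :=
    fun x hx => aeval_ne_zero_of_dvd hqG (h.ne x hx)
  have hφ' := fun x hx => h.hasDerivAt hqG (x := x) hx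
  have hsm : ∀ j, ContDiffOn ℝ ∞ (fun t => (aeval ![t, φ t] (m j) : ℝ)) (Ioo a b) :=
    fun j => h.contDiffOn_aeval hqG (m j)
  have hform := fun k x (hx : x ∈ Ioo a b) => wronskian_aeval_curve hq hφ' m k hx
  intro k
  induction k using Nat.strong_induction_on with
  | _ k ih =>
  intro hks x hx
  rcases k with _ | k
  · simp [wronskian]
  rcases hdich _ hks with hd | hd
  swap
  · rw [hform _ x hx]
    exact mul_ne_zero (Finset.prod_ne_zero_iff.mpr fun i _ =>
      inv_ne_zero (pow_ne_zero _ (hq x hx))) (aeval_ne_zero_of_dvd hd (h.ne x hx))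
  exfalso
  obtain ⟨c, hc⟩ := exists_eq_sum_of_wronskian_eq_zero (k := k) hsm
    (fun j hj => ih j (by omega) (by omega))
    (fun y hy => by rw [hform _ y hy, h.aeval_eq_zero_of_dvd hd hy, mul_zero])
  let D : ℕ → ℕ → ℚ := fun i j =>
    eval ![x₀, y₀] (curveIterDeriv F (m j) i) / eval ![x₀, y₀] (pderiv 1 F) ^ (2 * i)
  have hD : ∀ i j, iteratedDeriv i (fun t => (aeval ![t, φ t] (m j) : ℝ)) x₀ = (D i j : ℝ) := by
    intro i j
    rw [iteratedDeriv_aeval_curve hq hφ' _ _ _ hx₀, hy₀, aeval_ratCast, aeval_ratCast]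
    simp [D]
  let A : Matrix (Fin k) (Fin k) ℚ := Matrix.of fun i j => D i j
  have hAdet : A.det ≠ 0 := by
    have h1 := ih k (by omega) (by omega) x₀ hx₀
    have h2 : ((A.det : ℚ) : ℝ) = wronskian k (fun j t => (aeval ![t, φ t] (m j) : ℝ)) x₀ := by
      rw [wronskian, Rat.cast_det]
      congr 1
      ext i j
      simp [A, hD]
    rw [← h2] at h1
    exact_mod_cast h1
  have hunit : IsUnit A.det := isUnit_iff_ne_zero.mpr hAdet
  let c' : Fin k → ℚ := A⁻¹.mulVec fun i => D i k
  have hc' : A.mulVec c' = fun i : Fin k => D i k := by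
    simp only [c', Matrix.mulVec_mulVec, Matrix.mul_nonsing_inv A hunit, Matrix.one_mulVec]
  have hAc : ∀ i : Fin k, ∑ j : Fin k, (D i j : ℝ) * c j = D i k := by
    intro i
    have h1 : iteratedDeriv i (fun t => (aeval ![t, φ t] (m k) : ℝ)) x₀ =
        iteratedDeriv i (fun t => ∑ j : Fin k, c j * (aeval ![t, φ t] (m j) : ℝ)) x₀ :=
      Filter.EventuallyEq.iteratedDeriv_eq _ (Filter.eventually_of_mem
        (isOpen_Ioo.mem_nhds hx₀) hc)
    rw [hD, iteratedDeriv_fun_sum fun (j : Fin k) _ =>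
      contDiffAt_const.mul ((hsm j).contDiffAt_Ioo hx₀ i)] at h1
    rw [h1]
    refine Finset.sum_congr rfl fun j _ => ?_
    rw [iteratedDeriv_const_mul_field, hD, mul_comm]
  have hcc : ∀ j, c j = (c' j : ℝ) := by
    have hdetR : (A.map (fun q : ℚ => (q : ℝ))).det ≠ 0 := by
      rw [← Rat.cast_det]
      exact_mod_cast hAdet
    have h3 : (A.map (fun q : ℚ => (q : ℝ))).mulVec c =
        (A.map (fun q : ℚ => (q : ℝ))).mulVec fun j => (c' j : ℝ) := by
      funext i
      have h4 := congrFun hc' i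
      simp only [Matrix.mulVec, dotProduct, Matrix.map_apply, A, Matrix.of_apply] at h4 ⊢
      rw [hAc i, ← h4]
      push_cast
      rfl
    exact congrFun (Matrix.mulVec_injective_of_isUnit
      ((Matrix.isUnit_iff_isUnit_det _).mpr (isUnit_iff_ne_zero.mpr hdetR)) h3)
  have hdvd : F ∣ m k - ∑ j : Fin k, C (c' j) * m j := by
    refine h.dvd_of_aeval_eq_zero hF fun y hy => ?_
    simp only [map_sub, map_sum, map_mul, algHom_C]
    rw [hc y hy, sub_eq_zero]
    refine Finset.sum_congr rfl fun j _ => ?_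
    rw [hcc]
    simp
  have hks' : k < s := by omega
  have hmk : Ideal.Quotient.mkₐ ℚ (Ideal.span {F}) (m k) =
      ∑ j : Fin k, c' j • Ideal.Quotient.mkₐ ℚ (Ideal.span {F}) (m j) := by
    have h5 : Ideal.Quotient.mkₐ ℚ (Ideal.span {F}) (m k - ∑ j : Fin k, C (c' j) * m j) = 0 :=
      Ideal.Quotient.eq_zero_iff_mem.mpr (Ideal.mem_span_singleton.mpr hdvd)
    simp only [← smul_eq_C_mul, map_sub, map_sum, map_smul] at h5
    exact sub_eq_zero.mp h5
  have hni := (linearIndependent_iff_notMem_span.mp hli) ⟨k, hks'⟩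
  apply hni
  simp only
  rw [hmk]
  refine Submodule.sum_mem _ fun j _ => Submodule.smul_mem _ _ (Submodule.subset_span ?_)
  refine ⟨⟨j, by omega⟩, ⟨Set.mem_univ _, ?_⟩, rfl⟩
  simp only [Set.mem_singleton_iff, Fin.mk.injEq]
  omega

/-- The number of rational points of bounded height on an arc. -/
theorem card_rational_le (hF : Prime F) (hqG : pderiv 1 F ∣ G) (h : IsArc F G a b φ) {H : ℝ}
    {d M s : ℕ} {e : ℕ → ℕ × ℕ} (hd : 0 < d) (hM : 0 < M) (hH : 2 < H) (hMH : Real.log H ≤ M)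
    (hs : (M + 1) * (M + 2) ≤ 2 * s + (M + 1 - d) * (M + 2 - d))
    (he : ∀ j, (e j).1 + (e j).2 ≤ M)
    (hli : LinearIndependent ℚ fun j : Fin s => Ideal.Quotient.mkₐ ℚ (Ideal.span {F})
      (X 0 ^ (e j).1 * X 1 ^ (e j).2))
    (hI : ∀ k ≤ s, F ∣ curveIterDeriv F (X 1) k ∨ curveIterDeriv F (X 1) k ∣ G)
    (hW : ∀ k ≤ s, F ∣ curveWronskian F (fun j => X 0 ^ (e j).1 * X 1 ^ (e j).2) k ∨
      curveWronskian F (fun j => X 0 ^ (e j).1 * X 1 ^ (e j).2) k ∣ G)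
    {T : Finset ℝ} (hT : ∀ t ∈ T, t ∈ Ioo a b ∧ HasDenomLe H t (φ t)) :
    (T.card : ℝ) ≤ 2 ^ 35 * s * H ^ ((2 : ℝ) / d) * Real.log H := by
  rcases T.eq_empty_or_nonempty with rfl | ⟨t₀, ht₀⟩
  · have := Real.log_nonneg (show 1 ≤ H by linarith)
    simp only [Finset.card_empty, Nat.cast_zero]
    positivity
  obtain ⟨ht₀I, n, k, l, hn, -, hk, hl⟩ := hT t₀ ht₀
  have hn' : (n : ℝ) ≠ 0 := by exact_mod_cast hn
  have e1 : t₀ = ((k / n : ℚ) : ℝ) := by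
    push_cast
    rw [eq_div_iff hn', mul_comm, hk]
  have e2 : φ ((k / n : ℚ) : ℝ) = ((l / n : ℚ) : ℝ) := by
    rw [← e1]
    push_cast
    rw [eq_div_iff hn', mul_comm, hl]
  have hWr := h.wronskian_ne_zero hF hqG
    (m := fun j => X 0 ^ (e j).1 * X 1 ^ (e j).2) hli hW (by rw [← e1]; exact ht₀I) e2
  simp only [map_mul, map_pow, aeval_X, Matrix.cons_val_zero, Matrix.cons_val_one,
    Matrix.cons_val_fin_one] at hWr
  exact card_le_of_arc hd hM hH hMH hs he (h.contDiffOn hqG) h.box hWr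
    (fun k hk => h.sign_const hqG (hI k hk)) hT

end IsArc

theorem totalDegree_four_sub_sq_le (i : Fin 2) :
    (4 - X i ^ 2 : MvPolynomial (Fin 2) ℚ).totalDegree ≤ 2 := by
  refine (totalDegree_sub _ _).trans (max_le ?_ ?_)
  · rw [show (4 : MvPolynomial (Fin 2) ℚ) = C 4 from rfl, totalDegree_C]
    omega
  · rw [totalDegree_X_pow]

/-- A curve cutting `F = 0` into well-behaved arcs. -/
theorem exists_cutting_curve {F : MvPolynomial (Fin 2) ℚ} (hF : Prime F) (hq : pderiv 1 F ≠ 0)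
    {z : Fin 2 → ℝ} (hz : (aeval z F : ℝ) = 0) (hz1 : ∀ i, |z i| ≤ 1)
    {m : ℕ → MvPolynomial (Fin 2) ℚ} {s : ℕ} (hs : 0 < s) (hm : ∀ j, (m j).totalDegree ≤ s) :
    ∃ G : MvPolynomial (Fin 2) ℚ, ¬ F ∣ G ∧ pderiv 1 F ∣ G ∧ 4 - X 0 ^ 2 ∣ G ∧ 4 - X 1 ^ 2 ∣ G ∧
      (∀ k ≤ s, F ∣ curveIterDeriv F (X 1) k ∨ curveIterDeriv F (X 1) k ∣ G) ∧
      (∀ k ≤ s, F ∣ curveWronskian F m k ∨ curveWronskian F m k ∣ G) ∧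
      G.totalDegree ≤ 17 * F.totalDegree * s ^ 3 := by
  classical
  have hdpos : 0 < F.totalDegree := lt_of_le_of_lt (Nat.zero_le _) (totalDegree_pderiv_lt hq)
  set d := F.totalDegree with hd
  let trim : MvPolynomial (Fin 2) ℚ → MvPolynomial (Fin 2) ℚ := fun P => if F ∣ P then 1 else P
  have htrim : ∀ P, ¬ F ∣ trim P := fun P => by
    by_cases h : F ∣ P
    · simpa [trim, h] using hF.not_dvd_one
    · simp [trim, h]
  have htrimdeg : ∀ P, (trim P).totalDegree ≤ P.totalDegree := fun P => by
    by_cases h : F ∣ P <;> simp [trim, h]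
  have hprod : ∀ f : ℕ → MvPolynomial (Fin 2) ℚ, ∀ k ≤ s,
      F ∣ f k ∨ f k ∣ ∏ k ∈ Finset.range (s + 1), trim (f k) := fun f k hk => by
    by_cases h : F ∣ f k
    · exact Or.inl h
    · have h1 : trim (f k) = f k := by simp [trim, h]
      have h2 := Finset.dvd_prod_of_mem (fun k => trim (f k))
        (Finset.mem_range.mpr (Nat.lt_succ_of_le hk))
      rw [h1] at h2
      exact Or.inr h2
  have hnprod : ∀ f : ℕ → MvPolynomial (Fin 2) ℚ,
      ¬ F ∣ ∏ k ∈ Finset.range (s + 1), trim (f k) := fun f h => by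
    obtain ⟨k, -, hk⟩ := (hF.dvd_finsetProd_iff _).mp h
    exact htrim _ hk
  have hdegprod : ∀ (f : ℕ → MvPolynomial (Fin 2) ℚ) (B : ℕ),
      (∀ k ≤ s, (f k).totalDegree ≤ B) →
      (∏ k ∈ Finset.range (s + 1), trim (f k)).totalDegree ≤ (s + 1) * B := fun f B hB => by
    refine (totalDegree_finsetProd _ _).trans ?_
    refine (Finset.sum_le_card_nsmul _ _ B fun k hk => (htrimdeg _).trans
      (hB k (Nat.lt_succ_iff.mp (Finset.mem_range.mp hk)))).trans ?_
    simp
  have hsq : ∀ i : Fin 2, ¬ F ∣ 4 - X i ^ 2 := fun i hdvd => by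
    obtain ⟨Q, hQ⟩ := hdvd
    have h1 := congrArg (aeval z) hQ
    rw [map_mul, hz, zero_mul, map_sub, map_pow, aeval_X,
      show (4 : MvPolynomial (Fin 2) ℚ) = C 4 from rfl, algHom_C] at h1
    have h2 := abs_le.mp (hz1 i)
    simp only [map_ofNat] at h1
    nlinarith
  have hqF : ¬ F ∣ pderiv 1 F := fun h =>
    absurd (totalDegree_le_of_dvd_of_isDomain h hq) (not_le.mpr (totalDegree_pderiv_lt hq))
  set I := ∏ k ∈ Finset.range (s + 1), trim (curveIterDeriv F (X 1) k) with hI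
  set W := ∏ k ∈ Finset.range (s + 1), trim (curveWronskian F m k) with hW
  refine ⟨pderiv 1 F * (4 - X 0 ^ 2) * (4 - X 1 ^ 2) * I * W, ?_, ?_, ?_, ?_, fun k hk => ?_,
    fun k hk => ?_, ?_⟩
  · simp only [hF.dvd_mul, not_or]
    exact ⟨⟨⟨⟨hqF, hsq 0⟩, hsq 1⟩, hnprod _⟩, hnprod _⟩
  · exact ⟨(4 - X 0 ^ 2) * (4 - X 1 ^ 2) * I * W, by ring⟩
  · exact ⟨pderiv 1 F * (4 - X 1 ^ 2) * I * W, by ring⟩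
  · exact ⟨pderiv 1 F * (4 - X 0 ^ 2) * I * W, by ring⟩
  · exact (hprod _ k hk).imp_right fun h => (h.mul_left _).mul_right _
  · exact (hprod _ k hk).imp_right fun h => h.mul_left _
  · have h1 : I.totalDegree ≤ (s + 1) * (1 + 2 * s * d) :=
      hdegprod _ _ fun k hk => (totalDegree_curveIterDeriv_le F (X 1) k).trans (by
        rw [totalDegree_X]
        gcongr)
    have h2 : W.totalDegree ≤ (s + 1) * (s * (s + 2 * s * d)) :=
      hdegprod _ _ fun k hk => (totalDegree_curveWronskian_le hm k).trans (by gcongr)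
    have h3 := totalDegree_four_sub_sq_le 0
    have h4 := totalDegree_four_sub_sq_le 1
    have h5 : (pderiv 1 F).totalDegree ≤ d := (totalDegree_pderiv_lt hq).le
    have h6 := totalDegree_mul (pderiv 1 F) (4 - X 0 ^ 2)
    have h7 := totalDegree_mul (pderiv 1 F * (4 - X 0 ^ 2)) (4 - X 1 ^ 2)
    have h8 := totalDegree_mul (pderiv 1 F * (4 - X 0 ^ 2) * (4 - X 1 ^ 2)) I
    have h9 := totalDegree_mul (pderiv 1 F * (4 - X 0 ^ 2) * (4 - X 1 ^ 2) * I) W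
    have h10 : d + 4 + (s + 1) * (1 + 2 * s * d) + (s + 1) * (s * (s + 2 * s * d)) ≤
        17 * d * s ^ 3 := by
      obtain ⟨s, rfl⟩ := Nat.exists_eq_add_of_lt hs
      obtain ⟨d', hd'⟩ := Nat.exists_eq_add_of_lt hdpos
      rw [hd']
      ring_nf
      nlinarith [Nat.zero_le (d' * s), Nat.zero_le (d' * s ^ 2), Nat.zero_le (d' * s ^ 3),
        Nat.zero_le (s ^ 2), Nat.zero_le (s ^ 3)]
    omega

theorem card_affine_le_of_pderiv_ne_zero {F : MvPolynomial (Fin 2) ℚ} (hF : Prime F)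
    (hq : pderiv 1 F ≠ 0) {H : ℝ} (hH : 2 < H) (S : Finset (ℝ × ℝ))
    (hS : ∀ z ∈ S, (aeval ![z.1, z.2] F : ℝ) = 0 ∧ |z.1| ≤ 1 ∧ |z.2| ≤ 1 ∧
      HasDenomLe H z.1 z.2) :
    (S.card : ℝ) ≤ 2 ^ 58 * (F.totalDegree : ℝ) ^ 2 * H ^ ((2 : ℝ) / F.totalDegree) *
      Real.log H ^ 12 := by
  classical
  have hdpos : 0 < F.totalDegree := lt_of_le_of_lt (Nat.zero_le _) (totalDegree_pderiv_lt hq)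
  set d := F.totalDegree with hd
  have hlogH : 0.69 < Real.log H :=
    lt_trans (by linarith [Real.log_two_gt_d9]) (Real.log_lt_log (by norm_num) hH)
  set l := Real.log H with hl
  have hH0 : 0 < H := by linarith
  rcases S.eq_empty_or_nonempty with rfl | ⟨z₀, hz₀⟩
  · simp only [Finset.card_empty, Nat.cast_zero]
    positivity
  set M := ⌈l⌉₊ with hM
  have hM0 : 0 < M := Nat.ceil_pos.mpr (by linarith)
  have hMl : l ≤ M := Nat.le_ceil l
  have hMu : (M : ℝ) < l + 1 := Nat.ceil_lt_add_one (by linarith)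
  obtain ⟨s, e, he, hs2, hs, hli⟩ := exists_linearIndependent_monomials hF.ne_zero M
  have hMs := le_of_hilbert hdpos hs
  have hm : ∀ j, (X 0 ^ (e j).1 * X 1 ^ (e j).2 : MvPolynomial (Fin 2) ℚ).totalDegree ≤ s := by
    intro j
    refine (totalDegree_mul _ _).trans ?_
    rw [totalDegree_X_pow, totalDegree_X_pow]
    have := he j
    omega
  obtain ⟨G, hFG, hqG, hXG, hYG, hI, hW, hGdeg⟩ := exists_cutting_curve hF hq
    (z := ![z₀.1, z₀.2]) (hS z₀ hz₀).1
    (fun i => by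
      fin_cases i
      · exact (hS z₀ hz₀).2.1
      · exact (hS z₀ hz₀).2.2.1)
    (m := fun j => X 0 ^ (e j).1 * X 1 ^ (e j).2) (s := s) (by omega) hm
  rw [← hd] at hGdeg
  have hinj : Function.Injective fun z : ℝ × ℝ => (![z.1, z.2] : Fin 2 → ℝ) := fun z w h =>
    Prod.ext (by simpa using congrFun h 0) (by simpa using congrFun h 1)
  have hbez : ∀ (P : MvPolynomial (Fin 2) ℚ) (Z : Finset (ℝ × ℝ)), ¬ F ∣ P →
      (∀ z ∈ Z, (aeval ![z.1, z.2] F : ℝ) = 0 ∧ (aeval ![z.1, z.2] P : ℝ) = 0) →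
      Z.card ≤ d * P.totalDegree := by
    intro P Z hP hZ
    rw [← Finset.card_image_of_injective Z hinj]
    refine card_common_zeros_le hF hP _ (fun w hw => ?_) (fun w hw => ?_) <;>
    · obtain ⟨z, hz, rfl⟩ := Finset.mem_image.mp hw
      first
      | exact (hZ z hz).1
      | exact (hZ z hz).2
  have hbad := hbez G (S.filter fun z => (aeval ![z.1, z.2] G : ℝ) = 0) hFG fun z hz => by
    rw [Finset.mem_filter] at hz
    exact ⟨(hS z hz.1).1, hz.2⟩
  set S' := S.filter fun z => ¬ (aeval ![z.1, z.2] G : ℝ) = 0 with hS'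
  have hS'S : ∀ z ∈ S', z ∈ S := fun z hz => (Finset.mem_filter.mp hz).1
  set B : ℝ := 2 ^ 35 * s * H ^ ((2 : ℝ) / d) * l with hB
  have hgood : (S'.card : ℝ) ≤ B * (18 * d ^ 2 * s ^ 3 : ℕ) := by
    have harc : ∀ z : ℝ × ℝ, ∃ a b φ c, z ∈ S' → IsMaxArc F G a b φ ∧ z.1 ∈ Ioo a b ∧
        φ z.1 = z.2 ∧ c ∈ Ioo a b ∧ (aeval ![c, φ c] (curveDeriv F G) : ℝ) = 0 := by
      intro z
      by_cases hz : z ∈ S'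
      · have hzS := hS z (hS'S z hz)
        obtain ⟨a, b, φ, hmax, hzI, hzφ⟩ := exists_isMaxArc hqG (u := z)
          ⟨by linarith, by linarith⟩ hzS.1 (Finset.mem_filter.mp hz).2
        obtain ⟨⟨c, hc, hc0⟩, -⟩ := hmax.exists_curveDeriv_eq_zero hqG hXG hYG
        exact ⟨a, b, φ, c, fun _ => ⟨hmax, hzI, hzφ, hc, hc0⟩⟩
      · exact ⟨0, 0, 0, 0, fun h => absurd h hz⟩
    choose a b φ c harc using harc
    let κ : ℝ × ℝ → ℝ × ℝ := fun z => (c z, φ z (c z))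
    have himg : (S'.image κ).card ≤ 18 * d ^ 2 * s ^ 3 := by
      rcases S'.eq_empty_or_nonempty with h0 | ⟨z₁, hz₁⟩
      · simp [h0]
      have hFD := ((harc z₁ hz₁).1.exists_curveDeriv_eq_zero hqG hXG hYG).2
      have h1 := hbez (curveDeriv F G) (S'.image κ) hFD fun w hw => by
        obtain ⟨z, hz, rfl⟩ := Finset.mem_image.mp hw
        obtain ⟨hmax, -, -, hc, hc0⟩ := harc z hz
        exact ⟨hmax.zero _ hc, hc0⟩
      have h2 := totalDegree_curveDeriv_le F G
      have h3 : (curveDeriv F G).totalDegree ≤ 18 * d * s ^ 3 := by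
        have : d ≤ d * s ^ 3 := Nat.le_mul_of_pos_right d (pow_pos (by omega) 3)
        nlinarith
      calc _ ≤ d * (curveDeriv F G).totalDegree := h1
        _ ≤ d * (18 * d * s ^ 3) := Nat.mul_le_mul_left d h3
        _ = _ := by ring
    have hfib : ∀ w ∈ S'.image κ, (S'.filter fun z => κ z = w).card ≤ ⌊B⌋₊ := by
      intro w hw
      obtain ⟨z₁, hz₁, rfl⟩ := Finset.mem_image.mp hw
      obtain ⟨hmax, -, -, hc, -⟩ := harc z₁ hz₁
      have hon : ∀ z ∈ S'.filter fun z => κ z = κ z₁, z.1 ∈ Ioo (a z₁) (b z₁) ∧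
          φ z₁ z.1 = z.2 := by
        intro z hz
        obtain ⟨hz, hκ⟩ := Finset.mem_filter.mp hz
        obtain ⟨hmaxz, hzI, hzφ, hcz, -⟩ := harc z hz
        have h1 : c z = c z₁ := congrArg Prod.fst hκ
        have h2 : φ z (c z) = φ z₁ (c z₁) := congrArg Prod.snd hκ
        rw [h1] at hcz h2
        have h3 := hmax.graph_subset hqG hmaxz.toIsArc hc hcz h2.symm hzI
        exact ⟨h3.1, h3.2.trans hzφ⟩
      have hinjOn : Set.InjOn Prod.fst (S'.filter fun z => κ z = κ z₁ : Set (ℝ × ℝ)) := by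
        intro z hz w hw h
        have h1 := (hon z (by simpa using hz)).2
        have h2 := (hon w (by simpa using hw)).2
        rw [h] at h1
        exact Prod.ext h (h1.symm.trans h2)
      rw [← Finset.card_image_of_injOn (f := Prod.fst) (by simpa using hinjOn)]
      refine Nat.le_floor ?_
      refine hmax.toIsArc.card_rational_le hF hqG hdpos hM0 hH hMl hs he hli hI hW fun t ht => ?_
      obtain ⟨z, hz, rfl⟩ := Finset.mem_image.mp ht
      have h1 := hon z hz
      refine ⟨h1.1, ?_⟩
      rw [h1.2]
      exact (hS z (hS'S z (Finset.mem_filter.mp hz).1)).2.2.2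
    have h1 := (Finset.card_le_mul_card_image S' _ hfib).trans (Nat.mul_le_mul_left _ himg)
    have h2 : ((⌊B⌋₊ : ℕ) : ℝ) ≤ B := Nat.floor_le (by positivity)
    calc (S'.card : ℝ) ≤ ((⌊B⌋₊ * (18 * d ^ 2 * s ^ 3) : ℕ) : ℝ) := by exact_mod_cast h1
      _ = (⌊B⌋₊ : ℝ) * (18 * d ^ 2 * s ^ 3 : ℕ) := by rw [Nat.cast_mul]
      _ ≤ _ := by gcongr
  have hsplit := S.card_filter_add_card_filter_not fun z => (aeval ![z.1, z.2] G : ℝ) = 0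
  have hbad2 : (S.filter fun z => (aeval ![z.1, z.2] G : ℝ) = 0).card ≤ 17 * d ^ 2 * s ^ 3 := by
    refine hbad.trans ((Nat.mul_le_mul_left d hGdeg).trans_eq (by ring))
  have hbad3 : ((S.filter fun z => (aeval ![z.1, z.2] G : ℝ) = 0).card : ℝ) ≤
      17 * (d : ℝ) ^ 2 * (s : ℝ) ^ 3 := by exact_mod_cast hbad2
  have hsplit2 : (S.card : ℝ) = (S.filter fun z => (aeval ![z.1, z.2] G : ℝ) = 0).card +
      S'.card := by exact_mod_cast hsplit.symm
  have hP1 : 1 ≤ H ^ ((2 : ℝ) / d) := Real.one_le_rpow (by linarith) (by positivity)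
  have hs1 : (1 : ℝ) ≤ s := by exact_mod_cast (show 1 ≤ s by omega)
  have hsl : (s : ℝ) ≤ 12 * l ^ 2 := by
    have h1 : (2 : ℝ) * s ≤ (M + 1) * (M + 2) := by exact_mod_cast hs2
    have h2 : ((M : ℝ) + 1) * (M + 2) ≤ (4 * l) * (6 * l) := by
      gcongr <;> linarith
    linarith
  set Q := H ^ ((2 : ℝ) / d) with hQ
  have hone : 1 ≤ 2 * (s * Q * l) := by
    have : 1 ≤ s * Q := one_le_mul_of_one_le_of_one_le hs1 hP1
    nlinarith
  have hmain : (S.card : ℝ) ≤ 2 ^ 40 * (d : ℝ) ^ 2 * Q * (s ^ 4 * l) := by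
    push_cast at hgood
    have h3 : 17 * (d : ℝ) ^ 2 * (s : ℝ) ^ 3 ≤ 17 * (d : ℝ) ^ 2 * (s : ℝ) ^ 3 * (2 * (s * Q * l)) :=
      le_mul_of_one_le_right (by positivity) hone
    have h4 : 0 ≤ (d : ℝ) ^ 2 * Q * (s ^ 4 * l) := by positivity
    rw [hB] at hgood
    linarith
  have hs4 : (s : ℝ) ^ 4 * l ≤ 2 ^ 18 * l ^ 12 := by
    have h5 : (1 : ℝ) ≤ 4 * l ^ 3 := by
      have : (0.69 : ℝ) ^ 3 ≤ l ^ 3 := by gcongr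
      norm_num at this ⊢
      linarith
    calc (s : ℝ) ^ 4 * l ≤ (12 * l ^ 2) ^ 4 * l := by gcongr
      _ = 12 ^ 4 * l ^ 9 := by ring
      _ ≤ 12 ^ 4 * l ^ 9 * (4 * l ^ 3) := le_mul_of_one_le_right (by positivity) h5
      _ = 12 ^ 4 * 4 * l ^ 12 := by ring
      _ ≤ 2 ^ 18 * l ^ 12 := by
        gcongr
        norm_num
  calc (S.card : ℝ) ≤ 2 ^ 40 * (d : ℝ) ^ 2 * Q * (s ^ 4 * l) := hmain
    _ ≤ 2 ^ 40 * (d : ℝ) ^ 2 * Q * (2 ^ 18 * l ^ 12) := by gcongr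
    _ = _ := by ring

theorem exists_pderiv_ne_zero {F : MvPolynomial (Fin 2) ℚ} (hF : Prime F) :
    pderiv 1 F ≠ 0 ∨ pderiv 0 F ≠ 0 := by
  by_contra! h
  have h0 : ∀ i : Fin 2, pderiv i F = 0 := by
    intro i
    fin_cases i
    · exact h.2
    · exact h.1
  have hC : F = C (coeff 0 F) := by
    ext n
    rw [coeff_C]
    split_ifs with hn
    · rw [hn]
    obtain ⟨i, hi⟩ : ∃ i, n i ≠ 0 := by
      by_contra! hn0
      exact hn (Finsupp.ext hn0).symm
    have h1 := coeff_pderiv (i := i) F (n - Finsupp.single i 1)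
    have hle : Finsupp.single i 1 ≤ n := by
      rw [Finsupp.single_le_iff]
      omega
    rw [h0 i, coeff_zero, tsub_add_cancel_of_le hle] at h1
    refine (mul_eq_zero.mp h1.symm).resolve_right ?_
    positivity
  rw [hC] at hF
  exact hF.not_isUnit ((isUnit_iff_ne_zero.mpr fun h => hF.ne_zero (by rw [h, C_0])).map C)

theorem HasDenomLe.symm {H x y : ℝ} : HasDenomLe H x y → HasDenomLe H y x
  | ⟨n, k, l, hn, hH, hk, hl⟩ => ⟨n, l, k, hn, hH, hl, hk⟩

/-- The rational points of an affine plane curve in the unit box. -/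
theorem card_affine_le {F : MvPolynomial (Fin 2) ℚ} (hF : Prime F) {H : ℝ} (hH : 2 < H)
    (S : Finset (ℝ × ℝ))
    (hS : ∀ z ∈ S, (aeval ![z.1, z.2] F : ℝ) = 0 ∧ |z.1| ≤ 1 ∧ |z.2| ≤ 1 ∧
      HasDenomLe H z.1 z.2) :
    (S.card : ℝ) ≤ 2 ^ 58 * (F.totalDegree : ℝ) ^ 2 * H ^ ((2 : ℝ) / F.totalDegree) *
      Real.log H ^ 12 := by
  classical
  rcases exists_pderiv_ne_zero hF with hq | hq
  · exact card_affine_le_of_pderiv_ne_zero hF hq hH S hS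
  set σ : Equiv.Perm (Fin 2) := Equiv.swap 0 1
  have hdeg : (rename σ F).totalDegree = F.totalDegree := totalDegree_renameEquiv σ F
  have hpr : Prime (rename σ F) := (MulEquiv.prime_iff (renameEquiv ℚ σ)).mpr hF
  have hpd : pderiv 1 (rename σ F) ≠ 0 := by
    have h1 : pderiv (σ 0) (rename σ F) = rename σ (pderiv 0 F) := pderiv_rename σ.injective 0 F
    rw [show σ 0 = 1 from Equiv.swap_apply_left 0 1] at h1
    rw [h1]
    exact (map_ne_zero_iff _ (rename_injective σ σ.injective)).mpr hq
  rw [← hdeg, ← Finset.card_image_of_injective S Prod.swap_injective]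
  refine card_affine_le_of_pderiv_ne_zero hpr hpd hH _ fun w hw => ?_
  obtain ⟨z, hz, rfl⟩ := Finset.mem_image.mp hw
  obtain ⟨h1, h2, h3, h4⟩ := hS z hz
  refine ⟨?_, h3, h2, h4.symm⟩
  rw [aeval_rename]
  convert h1 using 3
  funext i
  fin_cases i <;> rfl

theorem MvPolynomial.IsHomogeneous.aeval_smul {σ A : Type*} [CommRing A] [Algebra ℚ A]
    {f : MvPolynomial σ ℚ} {d : ℕ} (hf : f.IsHomogeneous d) (c : A) (v : σ → A) :
    MvPolynomial.aeval (c • v) f = c ^ d * MvPolynomial.aeval v f := by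
  simp only [aeval_def, eval₂_eq, Finset.mul_sum]
  refine Finset.sum_congr rfl fun m hm => ?_
  simp only [Pi.smul_apply, smul_eq_mul, mul_pow, Finset.prod_mul_distrib,
    Finset.prod_pow_eq_pow_sum]
  rw [hf.degree_eq_sum_deg_support hm]
  ring

/-- Setting the `i`-th variable equal to `1`. -/
noncomputable def dehomogenize {n : ℕ} (i : Fin (n + 1)) :
    MvPolynomial (Fin (n + 1)) ℚ →ₐ[ℚ] MvPolynomial (Fin n) ℚ :=
  aeval (Fin.insertNth (α := fun _ => MvPolynomial (Fin n) ℚ) i 1 X)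

theorem aeval_dehomogenize {n : ℕ} (i : Fin (n + 1)) {A : Type*} [CommRing A] [Algebra ℚ A]
    (z : Fin n → A) (f : MvPolynomial (Fin (n + 1)) ℚ) :
    aeval z (dehomogenize i f) = aeval (Fin.insertNth (α := fun _ => A) i 1 z) f := by
  rw [dehomogenize, ← AlgHom.comp_apply, comp_aeval]
  congr 2
  funext j
  refine Fin.succAboveCases i ?_ (fun k => ?_) j <;> simp

@[simp]
theorem dehomogenize_X_self {n : ℕ} (i : Fin (n + 1)) : dehomogenize i (X i) = 1 := by
  simp [dehomogenize]

@[simp]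
theorem dehomogenize_rename {n : ℕ} (i : Fin (n + 1)) (A : MvPolynomial (Fin n) ℚ) :
    dehomogenize i (rename i.succAbove A) = A := by
  rw [dehomogenize, aeval_rename]
  convert aeval_X_left_apply A using 3
  funext j
  simp

theorem exists_isHomogeneous_dehomogenize_eq {n : ℕ} (i : Fin (n + 1)) {k : ℕ}
    (A : MvPolynomial (Fin n) ℚ) (hk : A.totalDegree ≤ k) :
    ∃ B : MvPolynomial (Fin (n + 1)) ℚ, B.IsHomogeneous k ∧ dehomogenize i B = A := by
  refine ⟨∑ j ∈ Finset.range (A.totalDegree + 1),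
    X i ^ (k - j) * rename i.succAbove (homogeneousComponent j A), ?_, ?_⟩
  · refine IsHomogeneous.sum _ _ _ fun j hj => ?_
    have hj' := Finset.mem_range.mp hj
    have h := (isHomogeneous_X_pow (R := ℚ) i (k - j)).mul
      ((homogeneousComponent_isHomogeneous j A).rename_isHomogeneous (f := i.succAbove))
    rwa [show k - j + j = k by omega] at h
  · simp [map_sum, sum_homogeneousComponent]

theorem MvPolynomial.IsHomogeneous.eq_zero_of_dehomogenize_eq_zero {n : ℕ} {i : Fin (n + 1)}
    {f : MvPolynomial (Fin (n + 1)) ℚ} {k : ℕ} (hf : f.IsHomogeneous k)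
    (h : dehomogenize i f = 0) : f = 0 := by
  have h1 : X i * f = 0 := by
    refine MvPolynomial.funext fun v => ?_
    rw [map_mul, eval_X, map_zero]
    by_cases hv : v i = 0
    · rw [hv, zero_mul]
    have h2 := aeval_dehomogenize i (fun j => v (i.succAbove j) / v i) f
    rw [h, map_zero] at h2
    have h3 : v = v i • Fin.insertNth (α := fun _ => ℚ) i 1
        (fun j => v (i.succAbove j) / v i) := by
      funext j
      refine Fin.succAboveCases i ?_ (fun k => ?_) j
      · simp
      · simp [mul_div_cancel₀ _ hv]
    have h4 := hf.aeval_smul (v i) (Fin.insertNth (α := fun _ => ℚ) i 1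
      (fun j => v (i.succAbove j) / v i))
    rw [← h3, ← h2, mul_zero] at h4
    rw [← coe_aeval_eq_eval, RingHom.coe_coe, h4, mul_zero]
  exact (mul_eq_zero.mp h1).resolve_left (X_ne_zero i)

theorem MvPolynomial.IsHomogeneous.eq_of_dehomogenize_eq {n : ℕ} {i : Fin (n + 1)}
    {f g : MvPolynomial (Fin (n + 1)) ℚ} {k : ℕ} (hf : f.IsHomogeneous k)
    (hg : g.IsHomogeneous k) (h : dehomogenize i f = dehomogenize i g) : f = g :=
  sub_eq_zero.mp ((hf.sub hg).eq_zero_of_dehomogenize_eq_zero (i := i)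
    (by rw [map_sub, h, sub_self]))

theorem totalDegree_dehomogenize_le {n : ℕ} (i : Fin (n + 1))
    (f : MvPolynomial (Fin (n + 1)) ℚ) : (dehomogenize i f).totalDegree ≤ f.totalDegree := by
  rw [dehomogenize, aeval_def, eval₂_eq]
  refine totalDegree_finsetSum_le fun m hm => ?_
  refine (totalDegree_mul _ _).trans ?_
  rw [algebraMap_eq, totalDegree_C, zero_add]
  refine (totalDegree_finsetProd _ _).trans ((Finset.sum_le_sum fun j _ => ?_).trans
    (le_totalDegree hm))
  refine (totalDegree_pow _ _).trans (mul_le_of_le_one_right (Nat.zero_le _) ?_)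
  refine Fin.succAboveCases i ?_ (fun k => ?_) j <;> simp

theorem totalDegree_dehomogenize {n : ℕ} {i : Fin (n + 1)} {f : MvPolynomial (Fin (n + 1)) ℚ}
    {d : ℕ} (hf : f.IsHomogeneous d) (hX : ¬ X i ∣ f) : (dehomogenize i f).totalDegree = d := by
  refine ((totalDegree_dehomogenize_le i f).trans hf.totalDegree_le).antisymm ?_
  by_contra! hlt
  obtain ⟨B, hB, hBf⟩ := exists_isHomogeneous_dehomogenize_eq i (dehomogenize i f)
    (k := d - 1) (by omega)
  have h := (isHomogeneous_X ℚ i).mul hB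
  rw [show 1 + (d - 1) = d by omega] at h
  exact hX ⟨B, hf.eq_of_dehomogenize_eq (i := i) h (by simp [hBf])⟩

theorem dvd_of_dehomogenize_dvd {n : ℕ} {i : Fin (n + 1)} {f g : MvPolynomial (Fin (n + 1)) ℚ}
    {d k : ℕ} (hf : f.IsHomogeneous d) (hg : g.IsHomogeneous k)
    (h : dehomogenize i f ∣ dehomogenize i g) : ∃ m, f ∣ X i ^ m * g := by
  obtain ⟨Q, hQ⟩ := h
  obtain ⟨B, hB, hBQ⟩ := exists_isHomogeneous_dehomogenize_eq i Q le_rfl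
  have h1 := (isHomogeneous_X_pow (R := ℚ) i (d + Q.totalDegree)).mul hg
  have h2 := (isHomogeneous_X_pow (R := ℚ) i k).mul (hf.mul hB)
  rw [add_comm k] at h2
  refine ⟨d + Q.totalDegree, X i ^ k * B, ?_⟩
  rw [h1.eq_of_dehomogenize_eq (i := i) h2 (by simp [hBQ, hQ])]
  ring

theorem prime_dehomogenize {n : ℕ} {i : Fin (n + 1)} {f : MvPolynomial (Fin (n + 1)) ℚ}
    {d : ℕ} (hd : 0 < d) (hf : f.IsHomogeneous d) (hp : Prime f) (hX : ¬ X i ∣ f) :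
    Prime (dehomogenize i f) := by
  have hdeg := totalDegree_dehomogenize hf hX
  refine ⟨fun h => ?_, fun h => ?_, fun A B hAB => ?_⟩
  · rw [h, totalDegree_zero] at hdeg
    omega
  · have := (isUnit_iff_totalDegree_of_isReduced.mp h).2
    omega
  · obtain ⟨A', hA, hA'⟩ := exists_isHomogeneous_dehomogenize_eq i A le_rfl
    obtain ⟨B', hB, hB'⟩ := exists_isHomogeneous_dehomogenize_eq i B le_rfl
    rw [← hA', ← hB', ← map_mul] at hAB
    obtain ⟨m, hm⟩ := dvd_of_dehomogenize_dvd hf (hA.mul hB) hAB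
    have hnX : ¬ f ∣ X i ^ m := fun h => hX
      ((hp.associated_of_dvd X_prime (hp.dvd_of_dvd_pow h)).symm.dvd)
    rw [← hA', ← hB']
    exact ((hp.dvd_or_dvd ((hp.dvd_or_dvd hm).resolve_left hnX))).imp
      (map_dvd (dehomogenize i)) (map_dvd (dehomogenize i))

/-- The affine coordinates of a point in the chart where the `i`-th coordinate is nonzero. -/
noncomputable def affineCoord {n : ℕ} (i : Fin (n + 1))
    (x : Projectivization ℚ (Fin (n + 1) → ℚ)) (j : Fin n) : ℚ :=
  x.rep (i.succAbove j) / x.rep i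

theorem insertNth_affineCoord {n : ℕ} {i : Fin (n + 1)}
    {x : Projectivization ℚ (Fin (n + 1) → ℚ)} (hx : x.rep i ≠ 0) :
    Fin.insertNth (α := fun _ => ℚ) i 1 (affineCoord i x) = (x.rep i)⁻¹ • x.rep := by
  funext j
  refine Fin.succAboveCases i ?_ (fun k => ?_) j
  · simp [hx]
  · simp [affineCoord, div_eq_inv_mul]

theorem affineCoord_injOn {n : ℕ} (i : Fin (n + 1)) :
    {x : Projectivization ℚ (Fin (n + 1) → ℚ) | x.rep i ≠ 0}.InjOn (affineCoord i) := by
  intro x hx z hz h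
  have h1 := insertNth_affineCoord hx
  rw [h, insertNth_affineCoord hz] at h1
  rw [← x.mk_rep, ← z.mk_rep, Projectivization.mk_eq_mk_iff']
  refine ⟨x.rep i * (z.rep i)⁻¹, ?_⟩
  rw [mul_smul, h1, smul_smul, mul_inv_cancel₀ hx, one_smul]

theorem exists_affineCoord_eq {n : ℕ} {x : Projectivization ℚ (Fin (n + 1) → ℚ)} {H : ℝ}
    (hx : qHeightLe x H) :
    ∃ (i : Fin (n + 1)) (y : Fin (n + 1) → ℤ), y i ≠ 0 ∧ x.rep i ≠ 0 ∧ (∀ j, |(y j : ℝ)| ≤ H) ∧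
      (∀ j, |y j| ≤ |y i|) ∧ ∀ j, y i * affineCoord i x j = y (i.succAbove j) := by
  obtain ⟨y, ⟨hy, rfl⟩, -, hH⟩ := hx
  obtain ⟨i, -, hi⟩ := Finset.exists_max_image Finset.univ (fun i => |y i|) Finset.univ_nonempty
  obtain ⟨c, hc⟩ := Projectivization.exists_smul_eq_mk_rep ℚ (fun i => (y i : ℚ)) hy
  have hyi : y i ≠ 0 := by
    intro h0
    refine hy (funext fun j => ?_)
    have := hi j (Finset.mem_univ j)
    rw [h0, abs_zero, abs_nonpos_iff] at this
    simp [this]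
  have hyq : (y i : ℚ) ≠ 0 := Int.cast_ne_zero.mpr hyi
  have hr : ∀ j, (Projectivization.mk ℚ (fun i => (y i : ℚ)) hy).rep j = c * y j :=
    fun j => by rw [← hc]; rfl
  refine ⟨i, y, hyi, ?_, hH, fun j => hi j (Finset.mem_univ j), fun j => ?_⟩
  · rw [hr]
    exact mul_ne_zero c.ne_zero hyq
  · rw [affineCoord, hr, hr, mul_div_mul_left _ _ c.ne_zero, mul_div_cancel₀ _ hyq]

/-- The rational points of a plane curve in one of the three unit boxes covering the plane. -/
theorem card_chart_le {d : ℕ} (hd : 0 < d) {f : MvPolynomial (Fin 3) ℚ} (hf : Irreducible f)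
    (hfd : f.IsHomogeneous d) {H : ℝ} (hH : 2 < H) (i : Fin 3)
    (T : Finset (Projectivization ℚ (Fin 3 → ℚ)))
    (hT : ∀ x ∈ T, eval x.rep f = 0 ∧ x.rep i ≠ 0 ∧ ∃ y : Fin 3 → ℤ, y i ≠ 0 ∧
      (∀ j, |(y j : ℝ)| ≤ H) ∧ (∀ j, |y j| ≤ |y i|) ∧
      ∀ j, y i * affineCoord i x j = y (i.succAbove j)) :
    (T.card : ℝ) ≤ 2 ^ 58 * (d : ℝ) ^ 2 * H ^ ((2 : ℝ) / d) * Real.log H ^ 12 := by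
  classical
  by_cases hX : X i ∣ f
  · have hT0 : T = ∅ := by
      refine Finset.eq_empty_of_forall_notMem fun x hx => ?_
      obtain ⟨h1, h2, -⟩ := hT x hx
      have h3 := map_dvd (eval x.rep)
        ((X_prime.irreducible.associated_of_dvd hf hX).symm.dvd)
      rw [h1, eval_X, zero_dvd_iff] at h3
      exact h2 h3
    rw [hT0, Finset.card_empty, Nat.cast_zero]
    have : 0 ≤ H := by linarith
    positivity
  set g : Projectivization ℚ (Fin 3 → ℚ) → ℝ × ℝ :=
    fun x => ((affineCoord i x 0 : ℝ), (affineCoord i x 1 : ℝ)) with hg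
  have hinj : Set.InjOn g T := by
    intro x hx z hz h
    refine affineCoord_injOn i (hT x hx).2.1 (hT z hz).2.1 (funext fun j => ?_)
    simp only [hg, Prod.mk.injEq, Rat.cast_inj] at h
    fin_cases j
    · exact h.1
    · exact h.2
  rw [← Finset.card_image_of_injOn hinj]
  have hdeg := totalDegree_dehomogenize hfd hX
  have := card_affine_le (prime_dehomogenize hd hfd hf.prime hX) hH (T.image g) ?_
  · rwa [hdeg] at this
  intro w hw
  obtain ⟨x, hx, rfl⟩ := Finset.mem_image.mp hw
  obtain ⟨h1, h2, y, hy0, hyH, hy, hxy⟩ := hT x hx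
  have hxyR : ∀ j, (y i : ℝ) * affineCoord i x j = y (i.succAbove j) := fun j => by
    exact_mod_cast congrArg (Rat.cast : ℚ → ℝ) (hxy j)
  have hle : ∀ j, |(affineCoord i x j : ℝ)| ≤ 1 := by
    intro j
    have hpos : 0 < |(y i : ℝ)| := abs_pos.mpr (Int.cast_ne_zero.mpr hy0)
    refine le_of_mul_le_mul_left ?_ hpos
    rw [← abs_mul, hxyR, mul_one]
    exact_mod_cast hy _
  refine ⟨?_, hle 0, hle 1, y i, y (i.succAbove 0), y (i.succAbove 1), hy0, hyH i, hxyR 0, hxyR 1⟩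
  have h3 : (![(affineCoord i x 0 : ℝ), (affineCoord i x 1 : ℝ)] : Fin 2 → ℝ) =
      algebraMap ℚ ℝ ∘ affineCoord i x := by
    funext j
    fin_cases j <;> rfl
  rw [← coe_aeval_eq_eval, RingHom.coe_coe] at h1
  change aeval ![(affineCoord i x 0 : ℝ), (affineCoord i x 1 : ℝ)] (dehomogenize i f) = 0
  rw [h3, aeval_algebraMap_apply, aeval_dehomogenize, insertNth_affineCoord h2,
    hfd.aeval_smul, h1, mul_zero, map_zero]

/-- There is an absolute constant `c` such that for every irreducible homogeneous
`f ∈ ℚ[x₀,x₁,x₂]` of degree `d > 0` defining the plane curve `C ⊆ ℙ²_ℚ` and every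
real `H > 2`, one has `#C(ℚ,H) ≤ c·d²·H^(2/d)·(log H)^12`. -/
theorem statement0 :
    ∃ c : ℝ, ∀ (d : ℕ), 0 < d →
      ∀ f : MvPolynomial (Fin 3) ℚ, Irreducible f → f.IsHomogeneous d →
      ∀ H : ℝ, 2 < H →
      (Nat.card {x : Projectivization ℚ (Fin 3 → ℚ) //
          eval x.rep f = 0 ∧ qHeightLe x H} : ℝ)
        ≤ c * (d : ℝ) ^ 2 * H ^ ((2 : ℝ) / (d : ℝ)) * Real.log H ^ 12 := by
  classical
  refine ⟨3 * 2 ^ 58, fun d hd f hf hfd H hH => ?_⟩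
  set P : Set (Projectivization ℚ (Fin 3 → ℚ)) := {x | eval x.rep f = 0 ∧ qHeightLe x H}
  change (P.ncard : ℝ) ≤ _
  rcases P.finite_or_infinite with hP | hP
  swap
  · rw [hP.ncard, Nat.cast_zero]
    have : 0 ≤ H := by linarith
    positivity
  choose! chart hchart using fun (x : Projectivization ℚ (Fin 3 → ℚ)) (hx : qHeightLe x H) =>
    exists_affineCoord_eq hx
  rw [Set.ncard_eq_toFinset_card P hP, Finset.card_eq_sum_card_fiberwise (f := chart)
    (t := Finset.univ) fun _ _ => Finset.mem_coe.mpr (Finset.mem_univ _), Nat.cast_sum]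
  refine (Finset.sum_le_card_nsmul _ _ _ fun i _ => card_chart_le hd hf hfd hH i _ ?_).trans
    (le_of_eq ?_)
  · intro x hx
    obtain ⟨hxP, rfl⟩ := Finset.mem_filter.mp hx
    obtain ⟨h1, h2⟩ := hP.mem_toFinset.mp hxP
    obtain ⟨y, hy, hr, h⟩ := hchart x h2
    exact ⟨h1, hr, y, hy, h⟩
  · rw [Finset.card_univ, Fintype.card_fin, nsmul_eq_mul]
    push_cast
    ring
end

section
/- There is a universal constant N such that the following holds for every field F (of any characteristic). Let f ∈ F[x₀,x₁,x₂] be a homogeneous polynomial of degree D > 0 and let k ≥ 1 be a real number. Then there exists a nonzero homogeneous polynomial g ∈ F[x₀,x₁,x₂] with 1 ≤ deg g ≤ N·k that vanishes at every point P ∈ ℙ²(F) with mult_P(f) ≥ D/k. -/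
open MvPolynomial

/-- The multiplicity of a polynomial `g` at a point `q`: the smallest total
degree of a monomial occurring with nonzero coefficient in the translate
`g(q + y)`. -/
noncomputable def multAt {F : Type*} [CommRing F] {m : ℕ} (q : Fin m → F)
    (g : MvPolynomial (Fin m) F) : ℕ :=
  sInf {k : ℕ | ∃ s ∈ (MvPolynomial.aeval
      (fun i => MvPolynomial.C (q i) + MvPolynomial.X i) g).support,
    (s.sum fun _ e => e) = k}

/-- A dehomogenised affine chart around a nonzero vector, centred at that vector: it sends forms to
polynomials in two local coordinates, it turns multiplicity into order of vanishing, and the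
constant `1` and the coordinates are images of linear forms. -/
theorem exists_affine_chart {F : Type*} [Field F] {n : ℕ} (p : Fin (n + 1) → F) (hp : p ≠ 0) :
    ∃ φ : MvPolynomial (Fin (n + 1)) F →ₐ[F] MvPolynomial (Fin n) F,
      (∀ g, constantCoeff (φ g) = eval p g) ∧
      (∀ g m, m ≤ multAt p g → φ g ∈ idealOfVars (Fin n) F ^ m) ∧
      (∃ L, L.IsHomogeneous 1 ∧ φ L = 1) ∧
      ∀ j, ∃ L, L.IsHomogeneous 1 ∧ φ L = X j := by
  obtain ⟨i, hi⟩ := Function.ne_iff.mp hp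
  replace hi : p i ≠ 0 := hi
  set T : MvPolynomial (Fin (n + 1)) F →ₐ[F] MvPolynomial (Fin (n + 1)) F :=
    aeval fun j => C (p j) + X j with hT
  set ψ : MvPolynomial (Fin (n + 1)) F →ₐ[F] MvPolynomial (Fin n) F :=
    aeval (i.insertNth (α := fun _ => MvPolynomial (Fin n) F) 0 X) with hψ
  have hψX (j) : constantCoeff (ψ (X j)) = 0 := by
    rcases Fin.eq_self_or_eq_succAbove i j with rfl | ⟨j, rfl⟩ <;> simp [hψ]
  have hψI (j) : ψ (X j) ∈ idealOfVars (Fin n) F := by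
    rcases Fin.eq_self_or_eq_succAbove i j with rfl | ⟨j, rfl⟩
    · simp [hψ]
    · simpa [hψ] using Ideal.subset_span (Set.mem_range_self j)
  have hi' : ψ (T (X i)) = C (p i) := by simp [hT, hψ, MvPolynomial.algebraMap_eq]
  have hinv : ψ (T (C (p i)⁻¹ * X i)) = 1 := by
    rw [map_mul, map_mul, hi', ← MvPolynomial.algebraMap_eq, AlgHom.commutes, AlgHom.commutes,
      MvPolynomial.algebraMap_eq, ← C_mul, inv_mul_cancel₀ hi, C_1]
  refine ⟨ψ.comp T, fun g => ?_, fun g m hm => ?_, ⟨_, ?_, hinv⟩, fun j =>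
    ⟨X (i.succAbove j) - C (p (i.succAbove j)) * (C (p i)⁻¹ * X i), ?_, ?_⟩⟩
  · induction g using MvPolynomial.induction_on with
    | C a => simp [MvPolynomial.algebraMap_eq]
    | add a b ha hb => simp only [map_add, ha, hb]
    | mul_X a j ha =>
      rw [map_mul, map_mul, ha, map_mul, eval_X]
      congr 1
      simpa [hT, MvPolynomial.algebraMap_eq] using hψX j
  · have h1 : T g ∈ idealOfVars (Fin (n + 1)) F ^ m := by
      rw [mem_pow_idealOfVars_iff]
      exact fun s hs => hm.trans (Nat.sInf_le ⟨s, hs, rfl⟩)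
    have h2 : (idealOfVars (Fin (n + 1)) F).map ψ ≤ idealOfVars (Fin n) F := by
      rw [Ideal.map_span, Ideal.span_le]
      rintro _ ⟨_, ⟨j, rfl⟩, rfl⟩
      exact hψI j
    have h3 := Ideal.mem_map_of_mem ψ h1
    rw [Ideal.map_pow] at h3
    exact Ideal.pow_right_mono h2 m h3
  · simpa using (isHomogeneous_C _ (p i)⁻¹).mul (isHomogeneous_X F i)
  · refine (isHomogeneous_X F _).sub ?_
    simpa using (isHomogeneous_C _ (p (i.succAbove j))).mul
      ((isHomogeneous_C _ (p i)⁻¹).mul (isHomogeneous_X F i))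
  · rw [AlgHom.comp_apply, map_sub, map_sub, map_mul, map_mul ψ, hinv]
    simp [hT, hψ, MvPolynomial.algebraMap_eq]

/-- In a chart, forms of degree `r` realise every jet of order `r`. -/
theorem exists_isHomogeneous_chart_sub_mem {F : Type*} [Field F] {σ τ : Type*}
    (φ : MvPolynomial σ F →ₐ[F] MvPolynomial τ F)
    (h₀ : ∃ L, L.IsHomogeneous 1 ∧ φ L = 1) (h₁ : ∀ j, ∃ L, L.IsHomogeneous 1 ∧ φ L = X j)
    (r : ℕ) (q : MvPolynomial τ F) :
    ∃ B : MvPolynomial σ F, B.IsHomogeneous r ∧ φ B - q ∈ idealOfVars τ F ^ (r + 1) := by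
  obtain ⟨L₀, hL₀, hφ₀⟩ := h₀
  choose L hL hφ using h₁
  induction q using MvPolynomial.induction_on' with
  | monomial s a =>
    by_cases hs : s.degree ≤ r
    · refine ⟨C a * (L₀ ^ (r - s.degree) * s.prod fun j k => L j ^ k), ?_, ?_⟩
      · have h1 : (s.prod fun j k => L j ^ k).IsHomogeneous s.degree :=
          IsHomogeneous.prod _ _ _ fun j _ => by simpa using (hL j).pow (s j)
        have h2 := (isHomogeneous_C σ a).mul ((hL₀.pow (r - s.degree)).mul h1)
        convert h2 using 1
        omega
      · convert Submodule.zero_mem _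
        rw [sub_eq_zero, map_mul, map_mul, map_pow, hφ₀, one_pow, one_mul,
          monomial_eq, Finsupp.prod, map_prod, ← MvPolynomial.algebraMap_eq, AlgHom.commutes,
          MvPolynomial.algebraMap_eq]
        simp [Finsupp.prod, hφ]
    · refine ⟨0, isHomogeneous_zero _ _ _, ?_⟩
      rw [map_zero, zero_sub, Ideal.neg_mem_iff, mem_pow_idealOfVars_iff]
      intro x hx
      have := support_monomial_subset hx
      simp only [Finset.mem_singleton] at this
      subst this
      omega
  | add a b ha hb =>
    obtain ⟨A, hA, hA'⟩ := ha
    obtain ⟨B, hB, hB'⟩ := hb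
    refine ⟨A + B, hA.add hB, ?_⟩
    rw [map_add, add_sub_add_comm]
    exact add_mem hA' hB'

theorem exists_pow_mul_sub_mem_pow {R : Type*} [CommRing R] {I : Ideal R} {u : R}
    (hu : u - 1 ∈ I) (t : ℕ) (q : R) : ∃ w, u ^ t * w - q ∈ I ^ t := by
  have h1 : IsNilpotent (Ideal.Quotient.mk (I ^ t) (u - 1)) :=
    ⟨t, by rw [← map_pow, Ideal.Quotient.eq_zero_iff_mem]; exact Ideal.pow_mem_pow hu t⟩
  have h2 : IsUnit (Ideal.Quotient.mk (I ^ t) (u ^ t)) := by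
    rw [map_pow]
    refine IsUnit.pow t ?_
    simpa using h1.isUnit_add_one
  obtain ⟨w, hw⟩ := h2.dvd (a := Ideal.Quotient.mk (I ^ t) q)
  obtain ⟨w, rfl⟩ := Ideal.Quotient.mk_surjective w
  exact ⟨w, by rw [← Ideal.Quotient.eq, map_mul, hw]⟩

/-- Points separated by forms of degree `e` have their jets of order `r` jointly realised by forms
of degree `(r + 1) * e + r`. -/
theorem exists_isHomogeneous_forall_chart_sub_mem {F : Type*} [Field F] {σ τ ι : Type*} [Fintype ι]
    [DecidableEq ι] (φ : ι → MvPolynomial σ F →ₐ[F] MvPolynomial τ F)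
    (h₀ : ∀ i, ∃ L, L.IsHomogeneous 1 ∧ φ i L = 1)
    (h₁ : ∀ i j, ∃ L, L.IsHomogeneous 1 ∧ φ i L = X j)
    {e : ℕ} (h : ι → MvPolynomial σ F) (hh : ∀ i, (h i).IsHomogeneous e)
    (hφ : ∀ i j, constantCoeff (φ j (h i)) = if i = j then 1 else 0)
    (r : ℕ) (q : ι → MvPolynomial τ F) :
    ∃ G : MvPolynomial σ F, G.IsHomogeneous ((r + 1) * e + r) ∧
      ∀ i, φ i G - q i ∈ idealOfVars τ F ^ (r + 1) := by
  have mem_of_constantCoeff (a : MvPolynomial τ F) (ha : constantCoeff a = 0) :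
      a ∈ idealOfVars τ F := by
    rw [← pow_one (idealOfVars τ F), mem_pow_idealOfVars_iff']
    intro x hx
    obtain rfl : x = 0 := (Finsupp.degree_eq_zero_iff x).1 (by omega)
    exact ha
  have key (i) : ∃ G : MvPolynomial σ F, G.IsHomogeneous ((r + 1) * e + r) ∧
      ∀ j, φ j G - (if i = j then q i else 0) ∈ idealOfVars τ F ^ (r + 1) := by
    obtain ⟨w, hw⟩ := exists_pow_mul_sub_mem_pow (I := idealOfVars τ F) (u := φ i (h i))
      (mem_of_constantCoeff _ (by simp [hφ])) (r + 1) (q i)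
    obtain ⟨B, hB, hB'⟩ := exists_isHomogeneous_chart_sub_mem (φ i) (h₀ i) (h₁ i) r w
    refine ⟨h i ^ (r + 1) * B, ?_, fun j => ?_⟩
    · simpa [mul_comm] using ((hh i).pow (r + 1)).mul hB
    · rw [map_mul, map_pow]
      split_ifs with hij
      · subst hij
        have h3 := add_mem (Ideal.mul_mem_left _ (φ i (h i) ^ (r + 1)) hB') hw
        convert h3 using 1
        ring
      · rw [sub_zero]
        exact Ideal.mul_mem_right _ _
          (Ideal.pow_mem_pow (mem_of_constantCoeff _ (by simp [hφ, hij])) _)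
  choose G hG hG' using key
  refine ⟨∑ i, G i, IsHomogeneous.sum _ _ _ fun i _ => hG i, fun j => ?_⟩
  have h4 := sum_mem fun i (_ : i ∈ Finset.univ) => hG' i j
  simpa [Finset.sum_sub_distrib] using h4

theorem exists_dual_family_of_separating {F V α : Type*} [Field F] [AddCommGroup V] [Module F V]
    [FiniteDimensional F V] (ev : α → Module.Dual F V) (hev : ∀ v, (∀ a, ev a v = 0) → v = 0) :
    ∃ (x : Fin (Module.finrank F V) → α) (h : Fin (Module.finrank F V) → V),
      ∀ i j, ev (x j) (h i) = if i = j then 1 else 0 := by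
  have hspan : Submodule.span F (Set.range ev) = ⊤ := by
    have h1 : (Submodule.span F (Set.range ev)).dualCoannihilator = ⊥ := by
      rw [eq_bot_iff]
      intro v hv
      exact hev v fun a =>
        (Submodule.mem_dualCoannihilator v).1 hv _ (Submodule.subset_span ⟨a, rfl⟩)
    have h2 := Subspace.finrank_add_finrank_dualCoannihilator_eq (Submodule.span F (Set.range ev))
    rw [h1, finrank_bot, add_zero] at h2
    exact Submodule.eq_top_of_finrank_eq (h2.trans (Subspace.dual_finrank_eq).symm)
  have hn : Module.finrank F (Submodule.span F (Set.range ev)) = Module.finrank F V := by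
    rw [hspan, finrank_top, Subspace.dual_finrank_eq]
  obtain ⟨f, hf, hfs, -⟩ := Submodule.exists_fun_fin_finrank_span_eq F (Set.range ev)
  generalize Module.finrank F (Submodule.span F (Set.range ev)) = k at f hf hfs hn
  subst hn
  choose x hx using hf
  have hinj : Function.Injective (LinearMap.pi f) := by
    rw [injective_iff_map_eq_zero]
    intro v hv
    have h1 : Submodule.span F (Set.range f) ≤ LinearMap.ker (Module.Dual.eval F V v) := by
      rw [Submodule.span_le]
      rintro _ ⟨i, rfl⟩
      simpa using congrFun hv i
    rw [hfs, hspan] at h1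
    exact hev v fun a => by simpa using h1 (Submodule.mem_top (x := ev a))
  have hsurj : Function.Surjective (LinearMap.pi f) :=
    (LinearMap.injective_iff_surjective_of_finrank_eq_finrank (by simp)).1 hinj
  choose h hh using fun i => hsurj (Pi.single i 1)
  refine ⟨x, h, fun i j => ?_⟩
  have h2 := congrFun (hh i) j
  rw [LinearMap.pi_apply, ← hx] at h2
  rw [h2, Pi.single_apply]
  simp only [eq_comm]

/-- The exponents of the monomials of degree less than `t` in two variables. -/
noncomputable def lowExponents (t : ℕ) : Finset (Fin 2 →₀ ℕ) :=
  (Finset.range t).biUnion fun j => Finset.univ.finsuppAntidiag j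

theorem mem_lowExponents {t : ℕ} {s : Fin 2 →₀ ℕ} : s ∈ lowExponents t ↔ s.degree < t := by
  simp [lowExponents, Finsupp.degree_eq_sum]

theorem two_mul_card_lowExponents (t : ℕ) : 2 * (lowExponents t).card = t * (t + 1) := by
  rw [lowExponents, Finset.card_biUnion]
  · simp only [Finset.card_finsuppAntidiag_nat_eq_choose, Finset.card_univ, Fintype.card_fin]
    induction t with
    | zero => simp
    | succ t ih =>
      have : (2 + t - 1).choose t = t + 1 := by
        rw [show 2 + t - 1 = t + 1 by omega, Nat.choose_succ_self_right]
      rw [Finset.sum_range_succ, mul_add, ih, this]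
      ring
  · intro i _ j _ hij
    rw [Function.onFun, Finset.disjoint_left]
    intro s hs hs'
    simp only [Finset.mem_finsuppAntidiag] at hs hs'
    exact hij (hs.1.symm.trans hs'.1)

instance finite_homogeneousSubmodule {F σ : Type*} [Field F] [Finite σ] (d : ℕ) :
    Module.Finite F (homogeneousSubmodule σ F d) :=
  Module.Finite.iff_fg.2 (homogeneousSubmodule_fg σ F d)

theorem two_mul_finrank_homogeneousSubmodule (F : Type*) [Field F] (d : ℕ) :
    2 * Module.finrank F (homogeneousSubmodule (Fin 3) F d) = (d + 1) * (d + 2) := by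
  have h1 : homogeneousSubmodule (Fin 3) F d =
      restrictSupport F (Finset.univ.finsuppAntidiag d : Finset (Fin 3 →₀ ℕ)) := by
    rw [homogeneousSubmodule_eq_finsupp_supported, restrictSupport]
    congr 1
    ext s
    simp [Finsupp.degree_eq_sum]
  rw [h1, Module.finrank_eq_card_basis (basisRestrictSupport F _)]
  simp only [Finset.coe_sort_coe, Fintype.card_coe, Finset.card_finsuppAntidiag_nat_eq_choose,
    Finset.card_univ, Fintype.card_fin]
  rw [show 3 + d - 1 = d + 2 by omega, Nat.choose_symm_add, Nat.choose_two_right,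
    Nat.mul_div_cancel' (Nat.even_mul_pred_self _).two_dvd]
  simp [mul_comm]

section JetMap

variable {F σ ι : Type*} [Field F]

/-- The jets of order less than `t` of a form of degree `d`, in a family of charts. -/
noncomputable def jetMap (φ : ι → MvPolynomial σ F →ₐ[F] MvPolynomial (Fin 2) F) (d t : ℕ) :
    homogeneousSubmodule σ F d →ₗ[F] (ι → lowExponents t → F) :=
  LinearMap.pi fun i => LinearMap.pi fun s =>
    lcoeff F s.1 ∘ₗ (φ i).toLinearMap ∘ₗ (homogeneousSubmodule σ F d).subtype

theorem mem_ker_jetMap (φ : ι → MvPolynomial σ F →ₐ[F] MvPolynomial (Fin 2) F) (d t : ℕ)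
    (g : homogeneousSubmodule σ F d) :
    g ∈ LinearMap.ker (jetMap φ d t) ↔
      ∀ i, φ i (g : MvPolynomial σ F) ∈ idealOfVars (Fin 2) F ^ t := by
  simp only [LinearMap.mem_ker, mem_pow_idealOfVars_iff', funext_iff, jetMap]
  simp [mem_lowExponents]

variable [Fintype ι]

theorem finrank_le_finrank_ker_jetMap_add [Finite σ]
    (φ : ι → MvPolynomial σ F →ₐ[F] MvPolynomial (Fin 2) F) (d t : ℕ) :
    Module.finrank F (homogeneousSubmodule σ F d) ≤
      Module.finrank F (LinearMap.ker (jetMap φ d t)) +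
        Fintype.card ι * (lowExponents t).card := by
  have h1 := (jetMap φ d t).finrank_range_add_finrank_ker
  have h2 := (LinearMap.range (jetMap φ d t)).finrank_le
  simp [Module.finrank_pi_fintype] at h2
  omega

theorem finrank_ker_jetMap_add [Finite σ]
    (φ : ι → MvPolynomial σ F →ₐ[F] MvPolynomial (Fin 2) F)
    (h₀ : ∀ i, ∃ L, L.IsHomogeneous 1 ∧ φ i L = 1)
    (h₁ : ∀ i j, ∃ L, L.IsHomogeneous 1 ∧ φ i L = X j)
    [DecidableEq ι] {e : ℕ} (h : ι → MvPolynomial σ F) (hh : ∀ i, (h i).IsHomogeneous e)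
    (hφ : ∀ i j, constantCoeff (φ j (h i)) = if i = j then 1 else 0) (r : ℕ) :
    Module.finrank F (LinearMap.ker (jetMap φ ((r + 1) * e + r) (r + 1))) +
      Fintype.card ι * (lowExponents (r + 1)).card =
      Module.finrank F (homogeneousSubmodule σ F ((r + 1) * e + r)) := by
  have h1 : LinearMap.range (jetMap φ ((r + 1) * e + r) (r + 1)) = ⊤ := by
    rw [LinearMap.range_eq_top]
    intro v
    obtain ⟨G, hG, hG'⟩ := exists_isHomogeneous_forall_chart_sub_mem φ h₀ h₁ h hh hφ r
      fun i => ∑ s, monomial s.1 (v i s)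
    refine ⟨⟨G, hG⟩, ?_⟩
    ext i s
    have h2 := (mem_pow_idealOfVars_iff' _ _).1 (hG' i) s.1 (mem_lowExponents.1 s.2)
    rw [coeff_sub, sub_eq_zero, coeff_sum] at h2
    simpa [jetMap, coeff_monomial, Subtype.coe_inj] using h2
  have h3 := (jetMap φ ((r + 1) * e + r) (r + 1)).finrank_range_add_finrank_ker
  rw [h1, finrank_top] at h3
  simp [Module.finrank_pi_fintype] at h3
  omega

end JetMap

theorem finrank_ker_jetMap_le {F σ ι : Type*} [Field F] [Finite σ]
    (φ : ι → MvPolynomial σ F →ₐ[F] MvPolynomial (Fin 2) F)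
    {f : MvPolynomial σ F} (hf : f ≠ 0) {D m : ℕ} (hD : f.IsHomogeneous D)
    (hm : ∀ i, φ i f ∈ idealOfVars (Fin 2) F ^ m) (d t : ℕ) :
    Module.finrank F (LinearMap.ker (jetMap φ d t)) ≤
      Module.finrank F (LinearMap.ker (jetMap φ (D + d) (m + t))) := by
  let M : homogeneousSubmodule σ F d →ₗ[F] homogeneousSubmodule σ F (D + d) :=
    (LinearMap.mulLeft F f).restrict fun g hg => hD.mul hg
  have hM : Function.Injective M := by
    intro a b hab
    exact Subtype.ext (mul_left_cancel₀ hf (congrArg Subtype.val hab))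
  have hmap : (LinearMap.ker (jetMap φ d t)).map M ≤
      LinearMap.ker (jetMap φ (D + d) (m + t)) := by
    rintro _ ⟨g, hg, rfl⟩
    rw [SetLike.mem_coe, mem_ker_jetMap] at hg
    rw [mem_ker_jetMap]
    intro i
    change φ i (f * g) ∈ _
    rw [map_mul, pow_add]
    exact Ideal.mul_mem_mul (hm i) (hg i)
  rw [(Submodule.equivMapOfInjective M hM _).finrank_eq]
  exact Submodule.finrank_mono hmap

/-- The arithmetic comparison behind the dimension count in `mul_add_two_le_two_mul_degree`. -/
theorem jet_count_lt_of_two_mul_degree_lt {e m D r t' d n : ℕ} (hn : 2 * n = (e + 1) * (e + 2))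
    (hlt : 2 * D < m * (e + 2)) (hD : 0 < D) (hr : r = (e + 2) * m ^ 2 + D) (ht : r + 1 = m + t')
    (hd : (r + 1) * e + r = D + d) :
    ((r + 1) * e + r + 1) * ((r + 1) * e + r + 2) + n * (t' * (t' + 1)) <
      (d + 1) * (d + 2) + n * ((r + 1) * (r + 2)) := by
  zify at *
  have ht' : (t' : ℤ) = r + 1 - m := by linarith
  have hd' : (d : ℤ) = (r + 1) * (e + 1) - D - 1 := by linarith
  have hm : (0 : ℤ) ≤ m := Int.natCast_nonneg m
  have he : (0 : ℤ) ≤ e := Int.natCast_nonneg e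
  have hT : ((e : ℤ) + 2) * m ^ 2 < r + 1 := by linarith
  have h1 : (r + 1 : ℤ) * (2 * D + 1) ≤ (r + 1) * (m * (e + 2)) :=
    mul_le_mul_of_nonneg_left (by linarith) (by positivity)
  have h2 : 4 * (r + 1 : ℤ) * D < (e + 2) * (2 * (r + 1) * m - m ^ 2 + m) := by
    nlinarith [mul_nonneg he hm]
  have h3 := mul_lt_mul_of_pos_left h2 (show (0 : ℤ) < e + 1 by linarith)
  have h4 : (n : ℤ) * (2 * (r + 1) * m - m ^ 2 + m) * 2 =
      (e + 1) * ((e + 2) * (2 * (r + 1) * m - m ^ 2 + m)) := by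
    linear_combination (2 * (r + 1) * m - m ^ 2 + m : ℤ) * hn
  rw [ht', hd']
  nlinarith [mul_self_nonneg ((D : ℤ) - 1)]

/-- If no nonzero plane form of degree `e` vanishes at all points of `Z`, then a nonzero form of
degree `D` with multiplicity at least `m` at the points of `Z` satisfies `m * (e + 2) ≤ 2 * D`. -/
theorem mul_add_two_le_two_mul_degree {F : Type*} [Field F] (Z : Set (Fin 3 → F))
    (hZ : ∀ p ∈ Z, p ≠ 0) {e : ℕ}
    (he : ∀ g : MvPolynomial (Fin 3) F, g.IsHomogeneous e → (∀ p ∈ Z, eval p g = 0) → g = 0)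
    {f : MvPolynomial (Fin 3) F} (hf : f ≠ 0) {D m : ℕ} (hD : f.IsHomogeneous D) (hD0 : 0 < D)
    (hm : ∀ p ∈ Z, m ≤ multAt p f) : m * (e + 2) ≤ 2 * D := by
  obtain ⟨x, h, hxh⟩ := exists_dual_family_of_separating
    (V := homogeneousSubmodule (Fin 3) F e)
    (fun p : Z => (aeval (R := F) p.1).toLinearMap ∘ₗ (homogeneousSubmodule (Fin 3) F e).subtype)
    fun v hv => Subtype.ext <| he v v.2 fun p hp => by
      simpa [aeval_eq_eval] using hv ⟨p, hp⟩
  choose φ hφ hφm h₀ h₁ using fun i => exists_affine_chart (x i).1 (hZ _ (x i).2)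
  by_contra! hlt
  have hm0 : m ≠ 0 := by rintro rfl; simp at hlt
  obtain ⟨t', ht⟩ : ∃ t', (e + 2) * m ^ 2 + D + 1 = m + t' := by
    refine Nat.exists_eq_add_of_le ?_
    nlinarith [Nat.pos_of_ne_zero hm0, Nat.zero_le (e * m ^ 2)]
  set r := (e + 2) * m ^ 2 + D with hr
  obtain ⟨d, hd⟩ : ∃ d, (r + 1) * e + r = D + d := Nat.exists_eq_add_of_le (by omega)
  have hK := finrank_ker_jetMap_add φ h₀ h₁ (fun i => (h i : MvPolynomial (Fin 3) F))
    (fun i => (h i).2) (fun i j => by simpa [hφ, aeval_eq_eval] using hxh i j) r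
  have hK' := finrank_le_finrank_ker_jetMap_add φ d t'
  have hKK' := finrank_ker_jetMap_le φ hf hD (fun i => hφm i f m (hm _ (x i).2)) d t'
  rw [← hd, ← ht] at hKK'
  rw [Fintype.card_fin] at hK hK'
  have hn := two_mul_finrank_homogeneousSubmodule F e
  have hS := two_mul_finrank_homogeneousSubmodule F ((r + 1) * e + r)
  have hS' := two_mul_finrank_homogeneousSubmodule F d
  have hA := two_mul_card_lowExponents (r + 1)
  have hA' := two_mul_card_lowExponents t'
  set n := Module.finrank F (homogeneousSubmodule (Fin 3) F e)
  have hcount : (d + 1) * (d + 2) + n * ((r + 1) * (r + 2)) ≤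
      ((r + 1) * e + r + 1) * ((r + 1) * e + r + 2) + n * (t' * (t' + 1)) := by
    rw [← hS, ← hS', ← hA', show (r + 1) * (r + 2) = (r + 1) * (r + 1 + 1) by rfl, ← hA]
    nlinarith
  exact absurd hcount (not_le.2 (jet_count_lt_of_two_mul_degree_lt hn hlt hD0 hr ht hd))

/-- There is a universal constant `N` such that for every field `F`, every
nonzero homogeneous `f ∈ F[x₀,x₁,x₂]` of degree `D > 0` and every real `k ≥ 1`,
there is a nonzero homogeneous `g ∈ F[x₀,x₁,x₂]` of degree `e` with
`1 ≤ e ≤ N·k` vanishing at every point `P ∈ ℙ²(F)` with `mult_P(f) ≥ D/k`. -/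
theorem statement7 :
    ∃ N : ℝ, ∀ (F : Type*) [Field F], ∀ (D : ℕ), 0 < D →
      ∀ f : MvPolynomial (Fin 3) F, f ≠ 0 → f.IsHomogeneous D →
      ∀ k : ℝ, 1 ≤ k →
      ∃ g : MvPolynomial (Fin 3) F, g ≠ 0 ∧
        ∃ e : ℕ, g.IsHomogeneous e ∧ 1 ≤ e ∧ (e : ℝ) ≤ N * k ∧
          ∀ P : Projectivization F (Fin 3 → F),
            (D : ℝ) / k ≤ (multAt P.rep f : ℝ) → eval P.rep g = 0 := by
  refine ⟨2, fun F _ D hD f hf hfD k hk => ?_⟩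
  have hk0 : 0 < k := one_pos.trans_le hk
  have hfloor : 2 * k < ⌊2 * k⌋₊ + 1 := Nat.lt_floor_add_one _
  have hpos : 1 ≤ ⌊2 * k⌋₊ := Nat.le_floor (by push_cast; linarith)
  by_contra! hcon
  set Z : Set (Fin 3 → F) := {p | ∃ P : Projectivization F (Fin 3 → F),
    (D : ℝ) / k ≤ (multAt P.rep f : ℝ) ∧ P.rep = p}
  have hbound := mul_add_two_le_two_mul_degree Z (by rintro _ ⟨P, -, rfl⟩; exact P.rep_nonzero)
    (e := ⌊2 * k⌋₊) (fun g hg hgZ => by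
      by_contra hg0
      obtain ⟨P, hP, hP'⟩ := hcon g hg0 _ hg hpos (Nat.floor_le (by positivity))
      exact hP' (hgZ _ ⟨P, hP, rfl⟩)) hf (m := ⌈(D : ℝ) / k⌉₊) hfD hD
    (by rintro _ ⟨P, hP, rfl⟩; exact Nat.ceil_le.2 hP)
  have hbound' : (⌈(D : ℝ) / k⌉₊ : ℝ) * (⌊2 * k⌋₊ + 2) ≤ 2 * D := by exact_mod_cast hbound
  have hD' : (0 : ℝ) < D / k := by positivity
  have : (D : ℝ) / k * (2 * k) < ⌈(D : ℝ) / k⌉₊ * (⌊2 * k⌋₊ + 2) :=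
    mul_lt_mul' (Nat.le_ceil _) (by linarith) (by positivity) (hD'.trans_le (Nat.le_ceil _))
  rw [mul_left_comm, div_mul_cancel₀ _ hk0.ne'] at this
  linarith
end
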